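/- For every graph H and every positive integer Δ, there exists a positive integer N such that every odd H-minor free graph G with maximum degree at most Δ has a 3-coloring with clustering at most N. -/

import Mathlib

open SimpleGraph

universe u v

/-- `a` and `b` lie in a common monochromatic component of the coloring `c`
restricted to the set `S` of colored vertices. -/
def MonoReach {β : Type*} {α : Type*} (G : SimpleGraph β) (S : Set β) (c : β → α)
    (a b : β) : Prop :=
  ∃ w : G.Walk a b, ∀ v ∈ w.support, v ∈ S ∧ c v = c a

/-- The coloring `c` (with domain `S`) has clustering at most `N`:
every monochromatic component has at most `N` vertices. -/
def HasClusteringLE {β : Type*} {α : Type*} (G : SimpleGraph β) (S : Set β) (c : β → α)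
    (N : ℕ) : Prop :=
  ∀ a : β, {b | MonoReach G S c a b}.ncard ≤ N

/-- `G` has maximum degree at most `Δ`. -/
def MaxDegreeLE {V : Type*} (G : SimpleGraph V) (Δ : ℕ) : Prop :=
  ∀ v, (G.neighborSet v).ncard ≤ Δ

/-- `H` is an odd minor of `G`. -/
def IsOddMinor {W : Type*} {V : Type*} (H : SimpleGraph W) (G : SimpleGraph V) : Prop :=
  ∃ (B : W → Set V) (F : W → SimpleGraph V) (col : V → Bool),
    (∀ w, (B w).Nonempty) ∧
    (∀ w, F w ≤ G) ∧
    (∀ w, ∀ ⦃x y⦄, (F w).Adj x y → x ∈ B w ∧ y ∈ B w) ∧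
    (∀ w, ((F w).induce (B w)).Connected) ∧
    (∀ w, (F w).IsAcyclic) ∧
    (∀ w₁ w₂, w₁ ≠ w₂ → Disjoint (B w₁) (B w₂)) ∧
    (∀ w, ∀ ⦃x y⦄, (F w).Adj x y → col x ≠ col y) ∧
    (∀ ⦃w₁ w₂⦄, H.Adj w₁ w₂ →
      ∃ x ∈ B w₁, ∃ y ∈ B w₂, G.Adj x y ∧ col x = col y)

namespace OddMinor
open scoped Classical
open Relation

section Connectivity

variable {V : Type*}

/-- The relation `r` is symmetric. -/
def RSymm (r : V → V → Prop) : Prop := ∀ ⦃a b⦄, r a b → r b a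

/-- The set `B` is connected with respect to the relation `r`. -/
def RConn (r : V → V → Prop) (B : Set V) : Prop :=
  ∀ x ∈ B, ∀ y ∈ B, ReflTransGen (fun a b => r a b ∧ b ∈ B) x y

/-- The vertices reachable from `x` by walks of `r` inside `S`. -/
def rcomp (r : V → V → Prop) (S : Set V) (x : V) : Set V :=
  {y | ReflTransGen (fun a b => r a b ∧ b ∈ S) x y}

lemma mem_rcomp_self {r : V → V → Prop} {S : Set V} (x : V) : x ∈ rcomp r S x :=
  ReflTransGen.refl

lemma rcomp_subset {r : V → V → Prop} {S : Set V} {x : V} (hx : x ∈ S) :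
    rcomp r S x ⊆ S := by
  intro y hy
  induction (show ReflTransGen _ x y from hy) with
  | refl => exact hx
  | tail _ h _ => exact h.2

lemma rcomp_closed {r : V → V → Prop} {S : Set V} {x a b : V} (ha : a ∈ rcomp r S x)
    (hab : r a b) (hb : b ∈ S) : b ∈ rcomp r S x :=
  ReflTransGen.tail ha ⟨hab, hb⟩

lemma reach_in_rcomp {r : V → V → Prop} {S : Set V} {x y : V} (hy : y ∈ rcomp r S x) :
    ReflTransGen (fun a b => r a b ∧ b ∈ rcomp r S x) x y := by
  induction (show ReflTransGen _ x y from hy) with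
  | refl => exact ReflTransGen.refl
  | tail h1 h ih =>
    exact (ih h1).tail ⟨h.1, ReflTransGen.tail h1 h⟩

lemma reach_symm {r : V → V → Prop} (hr : RSymm r) {S : Set V} {x y : V} (hx : x ∈ S)
    (h : ReflTransGen (fun a b => r a b ∧ b ∈ S) x y) :
    ReflTransGen (fun a b => r a b ∧ b ∈ S) y x := by
  induction h with
  | refl => exact ReflTransGen.refl
  | @tail b c h1 h ih =>
    have hb : b ∈ S := rcomp_subset hx h1
    exact ReflTransGen.head ⟨hr h.1, hb⟩ ih

lemma rconn_of_root {r : V → V → Prop} (hr : RSymm r) {B : Set V} {x : V} (hx : x ∈ B)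
    (h : ∀ y ∈ B, ReflTransGen (fun a b => r a b ∧ b ∈ B) x y) : RConn r B :=
  fun y hy z hz => (reach_symm hr hx (h y hy)).trans (h z hz)

lemma rconn_rcomp {r : V → V → Prop} (hr : RSymm r) {S : Set V} {x : V} :
    RConn r (rcomp r S x) :=
  rconn_of_root hr (mem_rcomp_self x) fun _ hy => reach_in_rcomp hy

lemma reach_mono {r r' : V → V → Prop} {B B' : Set V} {x y : V}
    (h : ReflTransGen (fun a b => r a b ∧ b ∈ B) x y)
    (hr : ∀ a b, r a b → r' a b) (hB : B ⊆ B') :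
    ReflTransGen (fun a b => r' a b ∧ b ∈ B') x y :=
  ReflTransGen.mono (p := fun a b => r' a b ∧ b ∈ B')
    (fun a b hab => ⟨hr a b hab.1, hB hab.2⟩) _ _ h

lemma RConn.mono {r r' : V → V → Prop} {B : Set V} (h : RConn r B)
    (hr : ∀ a b, r a b → r' a b) : RConn r' B :=
  fun x hx y hy => reach_mono (h x hx y hy) hr subset_rfl

lemma RConn.mono' {r r' : V → V → Prop} {B : Set V} (h : RConn r B)
    (hr : ∀ a ∈ B, ∀ b ∈ B, r a b → r' a b) : RConn r' B := by
  intro x hx y hy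
  have h1 := h x hx y hy
  induction h1 with
  | refl => exact ReflTransGen.refl
  | @tail b c h1 h2 ih =>
    have hb : b ∈ B := rcomp_subset hx h1
    exact (ih hb).tail ⟨hr b hb c h2.2 h2.1, h2.2⟩

lemma rconn_singleton (r : V → V → Prop) (x : V) : RConn r {x} := by
  intro a ha b hb
  rw [Set.mem_singleton_iff] at ha hb
  subst ha; subst hb
  exact ReflTransGen.refl

lemma rconn_empty (r : V → V → Prop) : RConn r ∅ := fun _ hx => hx.elim

lemma RConn.subset_rcomp {r : V → V → Prop} {B S : Set V} (h : RConn r B) (hB : B ⊆ S)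
    {x : V} (hx : x ∈ B) : B ⊆ rcomp r S x :=
  fun y hy => reach_mono (h x hx y hy) (fun _ _ h => h) hB

/-- A property that propagates along edges of a connected set holds everywhere on it. -/
lemma RConn.induct {r : V → V → Prop} {B : Set V} (h : RConn r B) {P : V → Prop}
    {x : V} (hx : x ∈ B) (hPx : P x)
    (hstep : ∀ a ∈ B, ∀ b ∈ B, r a b → P a → P b) : ∀ y ∈ B, P y := by
  intro y hy
  have h1 := h x hx y hy
  induction h1 with
  | refl => exact hPx
  | @tail b c h1 h2 ih =>
    have hb : b ∈ B := rcomp_subset hx h1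
    exact hstep b hb c h2.2 h2.1 (ih hb)

lemma RConn.exists_cross {r : V → V → Prop} {B : Set V} (h : RConn r B) {A : Set V}
    {x y : V} (hx : x ∈ B) (hxA : x ∈ A) (hy : y ∈ B) (hyA : y ∉ A) :
    ∃ a ∈ B, ∃ b ∈ B, r a b ∧ a ∈ A ∧ b ∉ A := by
  by_contra hc
  push Not at hc
  exact hyA (h.induct (P := fun v => v ∈ A) hx hxA (fun a ha b hb hab haA => hc a ha b hb hab haA)
    y hy)

lemma RConn.union_inter {r : V → V → Prop} (hr : RSymm r) {A B : Set V} (hA : RConn r A)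
    (hB : RConn r B) {x : V} (hxA : x ∈ A) (hxB : x ∈ B) : RConn r (A ∪ B) := by
  refine rconn_of_root hr (Or.inl hxA) ?_
  rintro y (hy | hy)
  · exact reach_mono (hA x hxA y hy) (fun _ _ h => h) Set.subset_union_left
  · exact reach_mono (hB x hxB y hy) (fun _ _ h => h) Set.subset_union_right

lemma RConn.union {r : V → V → Prop} (hr : RSymm r) {A B : Set V} (hA : RConn r A)
    (hB : RConn r B) {x y : V} (hxA : x ∈ A) (hyB : y ∈ B) (hxy : r x y) : RConn r (A ∪ B) := by
  refine rconn_of_root hr (Or.inl hxA) ?_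
  rintro z (hz | hz)
  · exact reach_mono (hA x hxA z hz) (fun _ _ h => h) Set.subset_union_left
  · exact ReflTransGen.head ⟨hxy, Or.inr hyB⟩
      (reach_mono (hB y hyB z hz) (fun _ _ h => h) Set.subset_union_right)

/-- A connected set together with connected sets attached to it is connected. -/
lemma RConn.union_iUnion {r : V → V → Prop} (hr : RSymm r) {ι : Sort*} {A : Set V}
    {B : ι → Set V} (hA : RConn r A) (hB : ∀ i, RConn r (B i))
    (hAB : ∀ i, ∃ x ∈ A, ∃ y ∈ B i, x = y ∨ r x y) (hne : A.Nonempty) :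
    RConn r (A ∪ ⋃ i, B i) := by
  obtain ⟨a, ha⟩ := hne
  refine rconn_of_root hr (Or.inl ha) ?_
  rintro z (hz | hz)
  · exact reach_mono (hA a ha z hz) (fun _ _ h => h) Set.subset_union_left
  · obtain ⟨i, hi⟩ := Set.mem_iUnion.1 hz
    obtain ⟨x, hx, y, hy, hxy⟩ := hAB i
    have hsub : B i ⊆ A ∪ ⋃ i, B i := fun w hw => Or.inr (Set.mem_iUnion.2 ⟨i, hw⟩)
    have h1 := reach_mono (B' := A ∪ ⋃ i, B i) (hA a ha x hx) (fun _ _ h => h)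
      Set.subset_union_left
    have h2 := reach_mono (hB i y hy z hi) (fun _ _ h => h) hsub
    rcases hxy with rfl | hxy
    · exact h1.trans h2
    · exact (h1.tail ⟨hxy, hsub hy⟩).trans h2

/-- Connectivity lifts from a quotient to the union of connected fibres. -/
lemma RConn.lift {r : V → V → Prop} (hr : RSymm r) {ι : Type*} {q : ι → ι → Prop}
    {Z : Set ι} {D : ι → Set V} (hZ : RConn q Z) (hD : ∀ z ∈ Z, RConn r (D z))
    (hne : ∀ z ∈ Z, (D z).Nonempty)
    (hq : ∀ z ∈ Z, ∀ z' ∈ Z, q z z' → ∃ a ∈ D z, ∃ b ∈ D z', a = b ∨ r a b) :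
    RConn r (⋃ z ∈ Z, D z) := by
  have hsub : ∀ z ∈ Z, D z ⊆ ⋃ z ∈ Z, D z := fun z hz => Set.subset_biUnion_of_mem hz
  intro x hx y hy
  simp only [Set.mem_iUnion, exists_prop] at hx hy
  obtain ⟨z, hz, hxz⟩ := hx
  obtain ⟨z', hz', hyz⟩ := hy
  have key := hZ.induct (P := fun w => ∀ y ∈ D w,
    ReflTransGen (fun a b => r a b ∧ b ∈ ⋃ z ∈ Z, D z) x y) hz
    (fun y hy => reach_mono (hD z hz x hxz y hy) (fun _ _ h => h) (hsub z hz)) ?_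
  · exact key z' hz' y hyz
  · intro a ha b hb hab ih y hy
    obtain ⟨u, hu, v, hv, huv⟩ := hq a ha b hb hab
    have h1 := ih u hu
    have h2 := reach_mono (hD b hb v hv y hy) (fun _ _ h => h) (hsub b hb)
    rcases huv with rfl | huv
    · exact h1.trans h2
    · exact (h1.tail ⟨huv, hsub b hb hv⟩).trans h2

end Connectivity

section Models

/-- A model of a complete graph on `s` vertices for the relation `r`. -/
structure CliqueModel {V : Type*} (r : V → V → Prop) (s : ℕ) (B : Fin s → Set V) : Prop where
  nonempty : ∀ i, (B i).Nonempty
  conn : ∀ i, RConn r (B i)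
  disj : ∀ i j, i ≠ j → Disjoint (B i) (B j)
  adj : ∀ i j, i ≠ j → ∃ x ∈ B i, ∃ y ∈ B j, r x y

lemma CliqueModel.comp {V : Type*} {r : V → V → Prop} {s s' : ℕ} {B : Fin s → Set V}
    (h : CliqueModel r s B) (f : Fin s' → Fin s) (hf : Function.Injective f) :
    CliqueModel r s' (B ∘ f) :=
  ⟨fun i => h.nonempty _, fun i => h.conn _, fun _ _ hij => h.disj _ _ (fun h => hij (hf h)),
    fun _ _ hij => h.adj _ _ (fun h => hij (hf h))⟩

/-- Models lift from a quotient to the disjoint connected fibres. -/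
lemma CliqueModel.lift {V ι : Type*} {r : V → V → Prop} (hr : RSymm r) {q : ι → ι → Prop}
    {s : ℕ} {B : Fin s → Set ι} (h : CliqueModel q s B) {Z : Set ι} (hBZ : ∀ i, B i ⊆ Z)
    {D : ι → Set V} (hD : ∀ z ∈ Z, RConn r (D z)) (hne : ∀ z ∈ Z, (D z).Nonempty)
    (hdisj : ∀ z ∈ Z, ∀ z' ∈ Z, z ≠ z' → Disjoint (D z) (D z'))
    (hq : ∀ z ∈ Z, ∀ z' ∈ Z, q z z' → ∃ a ∈ D z, ∃ b ∈ D z', r a b) :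
    CliqueModel r s (fun i => ⋃ z ∈ B i, D z) := by
  refine ⟨fun i => ?_, fun i => ?_, fun i j hij => ?_, fun i j hij => ?_⟩
  · obtain ⟨z, hz⟩ := h.nonempty i
    obtain ⟨a, ha⟩ := hne z (hBZ i hz)
    exact ⟨a, Set.mem_biUnion hz ha⟩
  · refine (h.conn i).lift hr (fun z hz => hD z (hBZ i hz)) (fun z hz => hne z (hBZ i hz)) ?_
    intro z hz z' hz' hzz
    obtain ⟨a, ha, b, hb, hab⟩ := hq z (hBZ i hz) z' (hBZ i hz') hzz
    exact ⟨a, ha, b, hb, Or.inr hab⟩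
  · rw [Set.disjoint_left]
    intro x hx hy
    simp only [Set.mem_iUnion, exists_prop] at hx hy
    obtain ⟨z, hz, hxz⟩ := hx
    obtain ⟨z', hz', hyz⟩ := hy
    have hne : z ≠ z' := by
      rintro rfl
      exact Set.disjoint_left.1 (h.disj i j hij) hz hz'
    exact Set.disjoint_left.1 (hdisj z (hBZ i hz) z' (hBZ j hz') hne) hxz hyz
  · obtain ⟨z, hz, z', hz', hzz⟩ := h.adj i j hij
    obtain ⟨a, ha, b, hb, hab⟩ := hq z (hBZ i hz) z' (hBZ j hz') hzz
    exact ⟨a, Set.mem_biUnion hz ha, b, Set.mem_biUnion hz' hb, hab⟩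

/-- The number of ordered pairs of related elements of `R`. -/
noncomputable def pairCount {ι : Type*} (r : ι → ι → Prop) (R : Finset ι) : ℕ :=
  ∑ x ∈ R, ∑ y ∈ R, if r x y then 1 else 0

lemma pairCount_insert {ι : Type*} {r : ι → ι → Prop} (hr : RSymm r)
    (hirr : ∀ x, ¬ r x x) {R : Finset ι} {v : ι} (hv : v ∉ R) :
    pairCount r (insert v R) = pairCount r R + 2 * ∑ y ∈ R, if r v y then 1 else 0 := by
  unfold pairCount
  rw [Finset.sum_insert hv, Finset.sum_insert hv, if_neg (hirr v)]
  simp_rw [Finset.sum_insert hv]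
  rw [Finset.sum_add_distrib]
  have : ∑ x ∈ R, (if r x v then 1 else 0) = ∑ y ∈ R, if r v y then 1 else 0 :=
    Finset.sum_congr rfl fun x _ => by
      by_cases h : r x v
      · rw [if_pos h, if_pos (hr h)]
      · rw [if_neg h, if_neg (fun h' => h (hr h'))]
  omega

lemma exists_cliqueModel_of_contract {ι : Type*} {r : ι → ι → Prop} (hr : RSymm r)
    {u v : ι} (huv : r u v) {R : Finset ι} (hvR : v ∉ R) {s : ℕ} {B : Fin s → Set ι}
    (h : CliqueModel (fun x y => x ≠ y ∧ (r x y ∨ (x = u ∧ r v y) ∨ (y = u ∧ r x v))) s B)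
    (hB : ∀ i, B i ⊆ R) :
    ∃ B' : Fin s → Set ι, CliqueModel r s B' ∧ ∀ i, B' i ⊆ insert v (R : Set ι) := by
  have huv' : u ≠ v ∨ u = v := by tauto
  refine ⟨_, h.lift hr (Z := R) hB (D := fun z => if z = u then {u, v} else {z})
    ?_ ?_ ?_ ?_, ?_⟩
  · intro z _
    split_ifs
    · exact (rconn_singleton r u).union hr (rconn_singleton r v) rfl rfl huv
    · exact rconn_singleton r z
  · intro z _
    split_ifs
    · exact ⟨u, by simp⟩
    · exact ⟨z, rfl⟩
  · intro z hz z' hz' hne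
    have h1 : z ≠ v := fun h => hvR (h ▸ hz)
    have h2 : z' ≠ v := fun h => hvR (h ▸ hz')
    rw [Set.disjoint_left]
    intro a ha hb
    split_ifs at ha hb <;> simp at ha hb <;> grind
  · intro z _ z' _ ⟨hne, hq⟩
    rcases hq with hq | ⟨rfl, hq⟩ | ⟨rfl, hq⟩
    · exact ⟨z, by split_ifs with h <;> simp [h], z', by split_ifs with h <;> simp [h], hq⟩
    · exact ⟨v, by simp, z', by split_ifs with h <;> simp [h], hq⟩
    · exact ⟨z, by split_ifs with h <;> simp [h], v, by simp, hq⟩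
  · intro i x hx
    simp only [Set.mem_iUnion, exists_prop] at hx
    obtain ⟨z, hz, hx⟩ := hx
    have := hB i hz
    split_ifs at hx with h
    · rcases hx with rfl | rfl
      · right; rw [← h]; exact this
      · left; rfl
    · right; rw [Set.mem_singleton_iff] at hx; rw [hx]; exact this

lemma CliqueModel.cons {ι : Type*} {r : ι → ι → Prop} (hr : RSymm r) {s : ℕ}
    {B : Fin s → Set ι} (h : CliqueModel r s B) {v : ι} (hv : ∀ i, v ∉ B i)
    (hadj : ∀ i, ∃ x ∈ B i, r v x) : CliqueModel r (s + 1) (Fin.cons {v} B) := by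
  refine ⟨fun i => ?_, fun i => ?_, fun i j hij => ?_, fun i j hij => ?_⟩
  · refine Fin.cases ?_ (fun i => ?_) i
    · exact ⟨v, rfl⟩
    · exact h.nonempty i
  · refine Fin.cases ?_ (fun i => ?_) i
    · exact rconn_singleton r v
    · exact h.conn i
  · revert hij
    refine Fin.cases ?_ (fun i => ?_) i <;> refine Fin.cases ?_ (fun j => ?_) j <;> intro hij
    · exact (hij rfl).elim
    · simpa using hv j
    · simpa using hv i
    · simpa using h.disj i j (fun e => hij (by rw [e]))
  · revert hij
    refine Fin.cases ?_ (fun i => ?_) i <;> refine Fin.cases ?_ (fun j => ?_) j <;> intro hij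
    · exact (hij rfl).elim
    · obtain ⟨x, hx, hvx⟩ := hadj j
      exact ⟨v, rfl, x, hx, hvx⟩
    · obtain ⟨x, hx, hvx⟩ := hadj i
      exact ⟨x, hx, v, rfl, hr hvx⟩
    · simpa using h.adj i j (fun e => hij (by rw [e]))

/-- A relation with sufficiently many pairs contains a model of a large complete graph. -/
theorem exists_cliqueModel_of_pairCount {ι : Type*} (s : ℕ) :
    ∀ (n : ℕ) (R : Finset ι) (r : ι → ι → Prop), R.card = n → RSymm r → (∀ x, ¬ r x x) →
      R.Nonempty → 2 ^ (s + 1) * R.card ≤ pairCount r R →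
      ∃ B : Fin s → Set ι, CliqueModel r s B ∧ ∀ i, B i ⊆ R := by
  induction s with
  | zero =>
    intro n R r _ _ _ _ _
    exact ⟨fun _ => ∅, ⟨fun i => i.elim0, fun i => i.elim0, fun i => i.elim0, fun i => i.elim0⟩,
      fun i => i.elim0⟩
  | succ s ihs =>
    intro n
    induction n with
    | zero => intro R r h0 _ _ hne _; rw [Finset.card_eq_zero] at h0; simp [h0] at hne
    | succ n ihn =>
      intro R r hcard hr hirr hne hcount
      by_cases hlow : ∃ u ∈ R, ∃ v ∈ R, r u v ∧
          (R.filter fun x => r u x ∧ r v x).card < 2 ^ (s + 1)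
      · obtain ⟨u, hu, v, hv, huv, hcom⟩ := hlow
        have huv' : u ≠ v := by rintro rfl; exact hirr _ huv
        set R0 := R.erase v with hR0
        set R1 := R0.erase u with hR1
        have huR0 : u ∈ R0 := Finset.mem_erase.2 ⟨huv', hu⟩
        have hvR0 : v ∉ R0 := Finset.notMem_erase v R
        have huR1 : u ∉ R1 := Finset.notMem_erase u R0
        have e0 : insert v R0 = R := Finset.insert_erase hv
        have e1 : insert u R1 = R0 := Finset.insert_erase huR0
        have hcard0 : R0.card = n := by
          rw [hR0, Finset.card_erase_of_mem hv]; omega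
        obtain ⟨r', hr'⟩ : ∃ r' : ι → ι → Prop, r' =
          fun x y => x ≠ y ∧ (r x y ∨ (x = u ∧ r v y) ∨ (y = u ∧ r x v)) := ⟨_, rfl⟩
        have hsym' : RSymm r' := by
          rw [hr']
          rintro x y ⟨h1, h2⟩
          refine ⟨h1.symm, ?_⟩
          rcases h2 with h | ⟨h, h'⟩ | ⟨h, h'⟩
          · exact Or.inl (hr h)
          · exact Or.inr (Or.inr ⟨h, hr h'⟩)
          · exact Or.inr (Or.inl ⟨h, hr h'⟩)
        have hirr' : ∀ x, ¬ r' x x := by rw [hr']; exact fun x h => h.1 rfl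
        have c1 := pairCount_insert hr hirr hvR0
        have c2 := pairCount_insert hr hirr huR1
        have c3 := pairCount_insert hsym' hirr' huR1
        rw [e0] at c1
        rw [e1] at c2 c3
        have hsame : pairCount r' R1 = pairCount r R1 := by
          unfold pairCount
          refine Finset.sum_congr rfl fun x hx => Finset.sum_congr rfl fun y hy => ?_
          have hxu : x ≠ u := fun h => huR1 (h ▸ hx)
          have hyu : y ≠ u := fun h => huR1 (h ▸ hy)
          have : r' x y ↔ r x y := by
            rw [hr']
            refine ⟨fun h => ?_, fun h => ⟨?_, Or.inl h⟩⟩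
            · rcases h.2 with h | ⟨h, _⟩ | ⟨h, _⟩
              · exact h
              · exact (hxu h).elim
              · exact (hyu h).elim
            · rintro rfl; exact hirr _ h
          simp only [this]
        have hv1 : (∑ y ∈ R0, if r v y then 1 else 0) =
            1 + ∑ y ∈ R1, if r v y then 1 else 0 := by
          rw [← e1, Finset.sum_insert huR1, if_pos (hr huv)]
        have hmix : (∑ y ∈ R1, if r u y then 1 else 0) + (∑ y ∈ R1, if r v y then 1 else 0)
            ≤ (∑ y ∈ R1, if r' u y then 1 else 0) + (R.filter fun x => r u x ∧ r v x).card := by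
          have : (∑ y ∈ R1, if r u y ∧ r v y then 1 else 0) ≤
              (R.filter fun x => r u x ∧ r v x).card := by
            rw [← Finset.card_filter]
            exact Finset.card_le_card (Finset.filter_subset_filter _
              ((Finset.erase_subset _ _).trans (Finset.erase_subset _ _)))
          refine le_trans ?_ (Nat.add_le_add_left this _)
          rw [← Finset.sum_add_distrib, ← Finset.sum_add_distrib]
          refine Finset.sum_le_sum fun y hy => ?_
          have hyu : u ≠ y := fun h => huR1 (h ▸ hy)
          have : r' u y ↔ r u y ∨ r v y := by
            rw [hr']
            constructor
            · rintro ⟨_, h | ⟨_, h⟩ | ⟨h, _⟩⟩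
              · exact Or.inl h
              · exact Or.inr h
              · exact (hyu h.symm).elim
            · rintro (h | h)
              · exact ⟨hyu, Or.inl h⟩
              · exact ⟨hyu, Or.inr (Or.inl ⟨rfl, h⟩)⟩
          by_cases h1 : r u y <;> by_cases h2 : r v y <;> simp [this, h1, h2]
        have hpow : 2 ^ (s + 1 + 1) = 2 * 2 ^ (s + 1) := by ring
        have hfin : 2 ^ (s + 1 + 1) * R0.card ≤ pairCount r' R0 := by
          rw [hcard] at hcount
          rw [hcard0]
          have : 2 ^ (s + 1 + 1) * (n + 1) = 2 ^ (s + 1 + 1) * n + 2 * 2 ^ (s + 1) := by ring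
          omega
        obtain ⟨B, hB, hBR⟩ := ihn R0 r' hcard0 hsym' hirr' ⟨u, huR0⟩ hfin
        rw [hr'] at hB
        obtain ⟨B', hB', hBR'⟩ := exists_cliqueModel_of_contract hr huv hvR0 hB hBR
        refine ⟨B', hB', fun i => (hBR' i).trans ?_⟩
        rw [← e0]; simp
      · push Not at hlow
        have hpos : 0 < pairCount r R := by
          have : 0 < R.card := hne.card_pos
          exact lt_of_lt_of_le (by positivity) hcount
        obtain ⟨v, hv, u, hu, hvu⟩ : ∃ v ∈ R, ∃ u ∈ R, r v u := by
          by_contra hc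
          push Not at hc
          have : pairCount r R = 0 :=
            Finset.sum_eq_zero fun x hx => Finset.sum_eq_zero fun y hy => if_neg (hc x hx y hy)
          omega
        set N := R.filter fun x => r v x with hN
        have hcN : 2 ^ (s + 1) * N.card ≤ pairCount r N := by
          unfold pairCount
          rw [mul_comm, ← smul_eq_mul]
          refine Finset.card_nsmul_le_sum _ _ _ fun x hx => ?_
          rw [← Finset.card_filter, hN, Finset.filter_filter]
          exact hlow v hv x (Finset.mem_filter.1 hx).1 (Finset.mem_filter.1 hx).2
        obtain ⟨B, hB, hBN⟩ := ihs N.card N r rfl hr hirr ⟨u, Finset.mem_filter.2 ⟨hu, hvu⟩⟩ hcN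
        refine ⟨Fin.cons {v} B, hB.cons hr (fun i h => ?_) (fun i => ?_), fun i => ?_⟩
        · exact hirr v (Finset.mem_filter.1 (Finset.mem_coe.1 (hBN i h))).2
        · obtain ⟨x, hx⟩ := hB.nonempty i
          exact ⟨x, hx, (Finset.mem_filter.1 (Finset.mem_coe.1 (hBN i hx))).2⟩
        · refine Fin.cases ?_ (fun i => ?_) i
          · simpa using hv
          · exact (hBN i).trans (Finset.coe_subset.2 (Finset.filter_subset _ _))

/-- Ramsey's theorem for two colours. -/
theorem exists_ramsey (s t : ℕ) : ∃ N : ℕ, ∀ {ι : Type} (p : ι → ι → Prop), RSymm p →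
    ∀ R : Finset ι, N ≤ R.card →
    (∃ A ⊆ R, A.card = s ∧ ∀ x ∈ A, ∀ y ∈ A, x ≠ y → p x y) ∨
    (∃ A ⊆ R, A.card = t ∧ ∀ x ∈ A, ∀ y ∈ A, x ≠ y → ¬ p x y) := by
  induction s generalizing t with
  | zero => exact ⟨0, fun p _ R _ => Or.inl ⟨∅, by simp⟩⟩
  | succ s ihs =>
    induction t with
    | zero => exact ⟨0, fun p _ R _ => Or.inr ⟨∅, by simp⟩⟩
    | succ t iht =>
      obtain ⟨N1, h1⟩ := ihs (t + 1)
      obtain ⟨N2, h2⟩ := iht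
      refine ⟨N1 + N2 + 1, fun {ι} p hp R hR => ?_⟩
      obtain ⟨v, hv⟩ : R.Nonempty := Finset.card_pos.1 (by omega)
      have hcard := Finset.card_filter_add_card_filter_not (s := R.erase v) (fun x => p v x)
      rw [Finset.card_erase_of_mem hv] at hcard
      by_cases hc : N1 ≤ ((R.erase v).filter fun x => p v x).card
      · rcases h1 p hp _ hc with ⟨A, hA, hAc, hAp⟩ | ⟨A, hA, hAc, hAp⟩
        · left
          have hvA : v ∉ A := fun h => by simpa using hA h
          refine ⟨insert v A, ?_, by rw [Finset.card_insert_of_notMem hvA, hAc], ?_⟩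
          · intro x hx
            rcases Finset.mem_insert.1 hx with rfl | hx
            · exact hv
            · exact Finset.mem_of_mem_erase (Finset.mem_filter.1 (hA hx)).1
          · intro x hx y hy hxy
            rcases Finset.mem_insert.1 hx with hx | hx <;>
              rcases Finset.mem_insert.1 hy with hy | hy
            · exact (hxy (hx.trans hy.symm)).elim
            · exact hx ▸ (Finset.mem_filter.1 (hA hy)).2
            · exact hy ▸ hp (Finset.mem_filter.1 (hA hx)).2
            · exact hAp x hx y hy hxy
        · exact Or.inr ⟨A, fun x hx => Finset.mem_of_mem_erase (Finset.mem_filter.1 (hA hx)).1,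
            hAc, hAp⟩
      · have hc2 : N2 ≤ ((R.erase v).filter fun x => ¬ p v x).card := by omega
        rcases h2 p hp _ hc2 with ⟨A, hA, hAc, hAp⟩ | ⟨A, hA, hAc, hAp⟩
        · exact Or.inl ⟨A, fun x hx => Finset.mem_of_mem_erase (Finset.mem_filter.1 (hA hx)).1,
            hAc, hAp⟩
        · right
          have hvA : v ∉ A := fun h => by simpa using hA h
          refine ⟨insert v A, ?_, by rw [Finset.card_insert_of_notMem hvA, hAc], ?_⟩
          · intro x hx
            rcases Finset.mem_insert.1 hx with rfl | hx
            · exact hv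
            · exact Finset.mem_of_mem_erase (Finset.mem_filter.1 (hA hx)).1
          · intro x hx y hy hxy
            rcases Finset.mem_insert.1 hx with hx | hx <;>
              rcases Finset.mem_insert.1 hy with hy | hy
            · exact (hxy (hx.trans hy.symm)).elim
            · exact hx ▸ (Finset.mem_filter.1 (hA hy)).2
            · exact hy ▸ fun h => (Finset.mem_filter.1 (hA hx)).2 (hp h)
            · exact hAp x hx y hy hxy

end Models
end OddMinor

namespace OddMinor
open scoped Classical
open Relation

section Chunks
variable {V : Type*}

lemma exists_rconn_subset_card {r : V → V → Prop} (hr : RSymm r) {R : Finset V}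
    (hR : RConn r (R : Set V)) (k : ℕ) (hk : k ≤ R.card) :
    ∃ A ⊆ R, A.card = k ∧ RConn r (A : Set V) := by
  induction k with
  | zero => exact ⟨∅, by simp, rfl, by simpa using rconn_empty r⟩
  | succ k ih =>
    obtain ⟨A, hAR, hA, hAc⟩ := ih (by omega)
    obtain ⟨b, hbR, hbA⟩ : ∃ b ∈ R, b ∉ A :=
      Finset.exists_mem_notMem_of_card_lt_card (by omega)
    rcases A.eq_empty_or_nonempty with rfl | ⟨a, ha⟩
    · exact ⟨{b}, by simpa using hbR, by rw [← hA]; rfl, by simpa using rconn_singleton r b⟩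
    · obtain ⟨x, hx, y, hy, hxy, hxA, hyA⟩ := hR.exists_cross (A := (A : Set V))
        (hAR ha) ha hbR hbA
      refine ⟨insert y A, Finset.insert_subset hy hAR, ?_, ?_⟩
      · rw [Finset.card_insert_of_notMem hyA, hA]
      · rw [Finset.coe_insert, Set.insert_eq, Set.union_comm]
        exact hAc.union hr (rconn_singleton r y) hxA rfl hxy

lemma exists_rconn_erase {r : V → V → Prop} (hr : RSymm r) {R : Finset V}
    (hR : RConn r (R : Set V)) (hne : R.Nonempty) :
    ∃ v ∈ R, RConn r (R.erase v : Set V) := by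
  obtain ⟨A, hAR, hA, hAc⟩ := exists_rconn_subset_card hr hR (R.card - 1) (by omega)
  have hpos := hne.card_pos
  obtain ⟨v, hv, hvA⟩ : ∃ b ∈ R, b ∉ A :=
    Finset.exists_mem_notMem_of_card_lt_card (by omega)
  refine ⟨v, hv, ?_⟩
  have : A = R.erase v := by
    refine Finset.eq_of_subset_of_card_le (fun x hx => Finset.mem_erase.2 ⟨?_, hAR hx⟩) ?_
    · rintro rfl; exact hvA hx
    · rw [Finset.card_erase_of_mem hv, hA]
  rw [← this]; exact hAc

/-- A connected set of bounded degree and large weight has many disjoint connected subsets of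
prescribed weight. -/
theorem exists_chunks {r : V → V → Prop} (hr : RSymm r) (q L : ℕ) (n : ℕ) :
    ∀ (R : Finset V) (μ : V → ℕ) (M : ℕ), R.card = n → RConn r (R : Set V) →
      (∀ v ∈ R, μ v + q * (R.filter (r v)).card ≤ L) → M * L + q ≤ ∑ v ∈ R, μ v →
      ∃ T : Fin M → Finset V, (∀ i, T i ⊆ R) ∧ (∀ i, RConn r (T i : Set V)) ∧
        (∀ i j, i ≠ j → Disjoint (T i) (T j)) ∧ ∀ i, q ≤ ∑ v ∈ T i, μ v := by
  induction n with
  | zero =>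
    intro R μ M hcard _ _ hsum
    rw [Finset.card_eq_zero] at hcard
    subst hcard
    rw [Finset.sum_empty] at hsum
    have hq : q = 0 := by omega
    subst hq
    exact ⟨fun _ => ∅, by simp, fun i => by simpa using rconn_empty r, by simp, by simp⟩
  | succ n ih =>
    intro R μ M hcard hR hL hsum
    rcases M with _ | M
    · exact ⟨fun i => i.elim0, fun i => i.elim0, fun i => i.elim0, fun i => i.elim0,
        fun i => i.elim0⟩
    obtain ⟨v, hv, hRv⟩ := exists_rconn_erase hr hR (Finset.card_pos.1 (by omega))
    have hcard' : (R.erase v).card = n := by rw [Finset.card_erase_of_mem hv]; omega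
    have hsplit := Finset.add_sum_erase R μ hv
    have hsub : ∀ u, ((R.erase v).filter (r u)).card ≤ (R.filter (r u)).card := fun u =>
      Finset.card_le_card (Finset.filter_subset_filter _ (Finset.erase_subset _ _))
    by_cases hq : q ≤ μ v
    · have hLv := hL v hv
      obtain ⟨T, h1, h2, h3, h4⟩ := ih (R.erase v) μ M hcard' hRv
        (fun u hu => (Nat.add_le_add_left (Nat.mul_le_mul_left _ (hsub u)) _).trans
          (hL u (Finset.mem_of_mem_erase hu))) (by rw [Nat.succ_mul] at hsum; omega)
      have hvT : ∀ i, v ∉ T i := fun i h => Finset.notMem_erase v R (h1 i h)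
      refine ⟨Fin.cons {v} T, fun i => ?_, fun i => ?_, fun i j => ?_, fun i => ?_⟩
      · refine Fin.cases ?_ (fun i => ?_) i
        · simpa using hv
        · exact (h1 i).trans (Finset.erase_subset _ _)
      · refine Fin.cases ?_ (fun i => ?_) i
        · simpa using rconn_singleton r v
        · exact h2 i
      · refine Fin.cases ?_ (fun i => ?_) i <;> refine Fin.cases ?_ (fun j => ?_) j <;> intro hij
        · exact (hij rfl).elim
        · simpa using hvT j
        · simpa using hvT i
        · simpa using h3 i j (fun e => hij (by rw [e]))
      · refine Fin.cases ?_ (fun i => ?_) i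
        · simpa using hq
        · exact h4 i
    · have hne : ∃ w ∈ R, w ≠ v := by
        by_contra hc
        push Not at hc
        have : R.erase v = ∅ := Finset.eq_empty_of_forall_notMem fun x hx =>
          (Finset.mem_erase.1 hx).1 (hc x (Finset.mem_erase.1 hx).2)
        rw [this, Finset.sum_empty] at hsplit
        rw [Nat.succ_mul] at hsum
        omega
      obtain ⟨w, hw, hwv⟩ := hne
      obtain ⟨a, ha, u, hu, hau, hav, huv⟩ := hR.exists_cross (A := {v}) hv rfl hw hwv
      rw [Set.mem_singleton_iff] at hav
      subst hav
      have hua : u ≠ a := huv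
      have huR : u ∈ R.erase a := Finset.mem_erase.2 ⟨hua, hu⟩
      set μ' : V → ℕ := fun x => μ x + if x = u then μ a else 0 with hμ'
      have hμ'ne : ∀ x, x ≠ u → μ' x = μ x := fun x hx => by simp [hμ', hx]
      have hμ'u : μ' u = μ u + μ a := by simp [hμ']
      have hsum' : ∀ T : Finset V, ∑ x ∈ T, μ' x = ∑ x ∈ T, μ x + if u ∈ T then μ a else 0 := by
        intro T
        simp only [hμ', Finset.sum_add_distrib]
        rw [Finset.sum_ite_eq']
      have hside : ∀ x ∈ R.erase a, μ' x + q * ((R.erase a).filter (r x)).card ≤ L := by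
        intro x hx
        have hLx := hL x (Finset.mem_of_mem_erase hx)
        by_cases hxu : x = u
        · subst hxu
          rw [hμ'u]
          have : ((R.erase a).filter (r x)).card + 1 ≤ (R.filter (r x)).card := by
            rw [← Finset.card_insert_of_notMem (a := a)
              (s := (R.erase a).filter (r x)) (by simp)]
            refine Finset.card_le_card (Finset.insert_subset ?_ ?_)
            · exact Finset.mem_filter.2 ⟨ha, hr hau⟩
            · exact Finset.filter_subset_filter _ (Finset.erase_subset _ _)
          have h5 := Nat.mul_le_mul_left q this
          rw [Nat.mul_add, Nat.mul_one] at h5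
          omega
        · rw [hμ'ne x hxu]
          exact (Nat.add_le_add_left (Nat.mul_le_mul_left _ (hsub x)) _).trans hLx
      obtain ⟨T, h1, h2, h3, h4⟩ := ih (R.erase a) μ' (M + 1) hcard' hRv hside (by rw [hsum', if_pos huR]; omega)
      have haT : ∀ i, a ∉ T i := fun i h => Finset.notMem_erase a R (h1 i h)
      refine ⟨fun i => if u ∈ T i then insert a (T i) else T i, fun i => ?_, fun i => ?_,
        fun i j hij => ?_, fun i => ?_⟩
      · beta_reduce; split_ifs
        · exact Finset.insert_subset ha ((h1 i).trans (Finset.erase_subset _ _))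
        · exact (h1 i).trans (Finset.erase_subset _ _)
      · beta_reduce; split_ifs with h
        · rw [Finset.coe_insert, Set.insert_eq]
          exact (rconn_singleton r a).union hr (h2 i) rfl h hau
        · exact h2 i
      · have hd := h3 i j hij
        have hd' := Finset.disjoint_left.1 hd
        beta_reduce; split_ifs with hi hj hj
        · exact (hd' hi hj).elim
        · rw [Finset.disjoint_insert_left]; exact ⟨haT j, hd⟩
        · rw [Finset.disjoint_insert_right]; exact ⟨haT i, hd⟩
        · exact hd
      · have := h4 i
        rw [hsum'] at this
        beta_reduce
        split_ifs at this ⊢ with h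
        · rw [Finset.sum_insert (haT i)]; omega
        · simpa using this

end Chunks
end OddMinor

namespace OddMinor
open scoped Classical
open Relation

section AlternatingPaths

variable {α β : Type*}

/-- `l` is the list of inner vertices of an alternating path from `x` to `y`: an entry `(v, c)`
means that the path enters `v` at its copy `!c` and leaves it from its copy `c`. -/
def PathOK (D : SimpleGraph (α ⊕ β × Bool)) : α ⊕ β × Bool → List (β × Bool) → α ⊕ β × Bool → Prop
  | x, [], y => D.Adj x y
  | x, (v, c) :: l, y => D.Adj x (Sum.inr (v, !c)) ∧ PathOK D (Sum.inr (v, c)) l y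

/-- The same path traversed backwards. -/
def flipRev (l : List (β × Bool)) : List (β × Bool) := (l.map fun p => (p.1, !p.2)).reverse

lemma flipRev_append (l l' : List (β × Bool)) : flipRev (l ++ l') = flipRev l' ++ flipRev l := by
  simp [flipRev]

lemma flipRev_cons (p : β × Bool) (l : List (β × Bool)) :
    flipRev (p :: l) = flipRev l ++ [(p.1, !p.2)] := by
  simp [flipRev]

lemma mem_map_fst_flipRev {l : List (β × Bool)} {b : β} :
    b ∈ (flipRev l).map Prod.fst ↔ b ∈ l.map Prod.fst := by
  simp [flipRev]

lemma PathOK.append {D : SimpleGraph (α ⊕ β × Bool)} {v : β} {c : Bool} {l' : List (β × Bool)}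
    {y : α ⊕ β × Bool} (l : List (β × Bool)) (x : α ⊕ β × Bool)
    (h : PathOK D x l (Sum.inr (v, !c))) (h' : PathOK D (Sum.inr (v, c)) l' y) :
    PathOK D x (l ++ (v, c) :: l') y := by
  induction l generalizing x with
  | nil => exact ⟨h, h'⟩
  | cons p l ih =>
    obtain ⟨w, e⟩ := p
    exact ⟨h.1, ih _ h.2⟩

lemma PathOK.flip {D : SimpleGraph (α ⊕ β × Bool)} (l : List (β × Bool)) (x y : α ⊕ β × Bool)
    (h : PathOK D x l y) : PathOK D y (flipRev l) x := by
  induction l generalizing x with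
  | nil => exact SimpleGraph.Adj.symm h
  | cons p l ih =>
    obtain ⟨w, e⟩ := p
    rw [flipRev_cons]
    exact PathOK.append _ _ (by simpa using ih _ h.2) (h.1.symm)

/-- A family of `n` disjoint alternating paths with distinct ends. -/
structure AltPaths (D : SimpleGraph (α ⊕ β × Bool)) (n : ℕ) (s t : Fin n → α)
    (l : Fin n → List (β × Bool)) : Prop where
  path : ∀ i, PathOK D (Sum.inl (s i)) (l i) (Sum.inl (t i))
  s_inj : Function.Injective s
  t_inj : Function.Injective t
  s_ne_t : ∀ i j, s i ≠ t j
  nodup : ∀ i, ((l i).map Prod.fst).Nodup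
  disj : ∀ i j, i ≠ j → ∀ b ∈ (l i).map Prod.fst, b ∉ (l j).map Prod.fst

/-- The terminals, and the nodes over `U`. -/
def NodeIn (U : Finset β) : α ⊕ β × Bool → Prop
  | Sum.inl _ => True
  | Sum.inr (v, _) => v ∈ U

/-- A partial matching together with alternating paths realizing its pairs. -/
structure PathSystem (D : SimpleGraph (α ⊕ β × Bool)) (d : ℕ) (U : Finset β)
    (m : α ⊕ β × Bool → α ⊕ β × Bool) (L : α ⊕ β × Bool → List (β × Bool)) : Prop where
  maps : ∀ x, NodeIn U x → NodeIn U (m x)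
  invol : ∀ x, NodeIn U x → m (m x) = x
  path : ∀ x, NodeIn U x → m x ≠ x → PathOK D x (L x) (m x)
  flip : ∀ x, NodeIn U x → m x ≠ x → L (m x) = flipRev (L x)
  nodup : ∀ x, NodeIn U x → m x ≠ x → ((L x).map Prod.fst).Nodup
  avoid : ∀ x, NodeIn U x → m x ≠ x → ∀ b ∈ (L x).map Prod.fst, b ∉ U
  disj : ∀ x y, NodeIn U x → NodeIn U y → m x ≠ x → m y ≠ y → ∀ b ∈ (L x).map Prod.fst,
    b ∈ (L y).map Prod.fst → y = x ∨ y = m x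
  fixed : {x | NodeIn U x ∧ m x = x}.ncard ≤ d

lemma PathSystem.remove [Finite α] [Finite β] {D : SimpleGraph (α ⊕ β × Bool)} {d : ℕ}
    {U : Finset β} {v : β} (hv : v ∉ U) {m : α ⊕ β × Bool → α ⊕ β × Bool}
    {L : α ⊕ β × Bool → List (β × Bool)} (S : PathSystem D d (insert v U) m L) :
    ∃ m' L', PathSystem D d U m' L' := by
  obtain ⟨A', hA'⟩ : ∃ A' : α ⊕ β × Bool → Prop, A' = NodeIn (insert v U) := ⟨_, rfl⟩
  have hAv : ∀ c, A' (Sum.inr (v, c)) := fun c => by rw [hA']; exact Finset.mem_insert_self v U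
  have hAsub : ∀ x, NodeIn U x → A' x := by
    rw [hA']
    rintro (a | ⟨w, c⟩) h
    · trivial
    · exact Finset.mem_insert_of_mem h
  have hAne : ∀ x : α ⊕ β × Bool, NodeIn U x → ∀ c, x ≠ Sum.inr (v, c) := by
    rintro x h c rfl; exact hv h
  have hAof : ∀ x, A' x → (∀ c, x ≠ Sum.inr (v, c)) → NodeIn U x := by
    rw [hA']
    rintro (a | ⟨w, c⟩) h h'
    · trivial
    · rcases Finset.mem_insert.1 h with rfl | h
      · exact (h' c rfl).elim
      · exact h
  have S1 := S.maps
  have S2 := S.invol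
  have S3 := S.path
  have S4 := S.flip
  have S5 := S.nodup
  have S6 := S.avoid
  have S7 := S.disj
  have S8 := S.fixed
  rw [← hA'] at S1 S2 S3 S4 S5 S6 S7 S8
  obtain ⟨m', hm'1, hm'2, hm'3⟩ : ∃ m' : α ⊕ β × Bool → α ⊕ β × Bool,
      (∀ x, (∀ c, m x ≠ Sum.inr (v, c)) → m' x = m x) ∧
      (∀ x c, m x = Sum.inr (v, c) → m (Sum.inr (v, !c)) = Sum.inr (v, !c) → m' x = x) ∧
      (∀ x c, m x = Sum.inr (v, c) → m (Sum.inr (v, !c)) ≠ Sum.inr (v, !c) →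
        m' x = m (Sum.inr (v, !c))) := by
    refine ⟨fun x => if h : ∃ c, m x = Sum.inr (v, c) then
      if m (Sum.inr (v, !h.choose)) = Sum.inr (v, !h.choose) then x
        else m (Sum.inr (v, !h.choose)) else m x, fun x hx => ?_, fun x c hx hc => ?_,
        fun x c hx hc => ?_⟩
    · exact dif_neg (by push Not; exact hx)
    all_goals
      have h : ∃ c, m x = Sum.inr (v, c) := ⟨c, hx⟩
      have hcc : h.choose = c := by
        have := h.choose_spec.symm.trans hx
        simpa using this
      simp only [dif_pos h, hcc]
    · rw [if_pos hc]
    · rw [if_neg hc]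
  obtain ⟨L', hL'1, hL'2⟩ : ∃ L' : α ⊕ β × Bool → List (β × Bool),
      (∀ x, (∀ c, m x ≠ Sum.inr (v, c)) → L' x = L x) ∧
      (∀ x c, m x = Sum.inr (v, c) → L' x = L x ++ (v, !c) :: L (Sum.inr (v, !c))) := by
    refine ⟨fun x => if h : ∃ c, m x = Sum.inr (v, c) then
      L x ++ (v, !h.choose) :: L (Sum.inr (v, !h.choose)) else L x, fun x hx => ?_,
      fun x c hx => ?_⟩
    · exact dif_neg (by push Not; exact hx)
    · have h : ∃ c, m x = Sum.inr (v, c) := ⟨c, hx⟩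
      have hcc : h.choose = c := by
        have := h.choose_spec.symm.trans hx
        simpa using this
      simp only [dif_pos h, hcc]
  -- the three kinds of nodes
  have kinds : ∀ x, NodeIn U x → ((∀ c, m x ≠ Sum.inr (v, c)) ∧ m' x = m x ∧ L' x = L x) ∨
      (∃ c, m x = Sum.inr (v, c) ∧ m (Sum.inr (v, !c)) = Sum.inr (v, !c) ∧ m' x = x) ∨
      (∃ c, m x = Sum.inr (v, c) ∧ m (Sum.inr (v, !c)) ≠ Sum.inr (v, !c) ∧
        NodeIn U (m (Sum.inr (v, !c))) ∧ m' x = m (Sum.inr (v, !c)) ∧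
        L' x = L x ++ (v, !c) :: L (Sum.inr (v, !c))) := by
    intro x hx
    by_cases h : ∃ c, m x = Sum.inr (v, c)
    · right
      obtain ⟨c, hc⟩ := h
      by_cases h' : m (Sum.inr (v, !c)) = Sum.inr (v, !c)
      · exact Or.inl ⟨c, hc, h', hm'2 x c hc h'⟩
      · refine Or.inr ⟨c, hc, h', hAof _ (S1 _ (hAv _)) ?_, hm'3 x c hc h', hL'2 x c hc⟩
        intro e he
        rcases Bool.eq_or_eq_not e c with rfl | rfl
        · have h1 := S2 _ (hAv (!e))
          rw [he, ← hc, S2 _ (hAsub x hx)] at h1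
          exact hAne x hx _ h1
        · exact h' he
    · push Not at h
      exact Or.inl ⟨h, hm'1 x h, hL'1 x h⟩
  have mback : ∀ x c, NodeIn U x → m x = Sum.inr (v, c) → m (Sum.inr (v, c)) = x :=
    fun x c hx h => by rw [← h]; exact S2 x (hAsub x hx)
  have mne : ∀ x c, NodeIn U x → m x = Sum.inr (v, c) → m x ≠ x :=
    fun x c hx h h' => hAne x hx c (by rw [← h', h])
  refine ⟨m', L', fun x hx => ?_, fun x hx => ?_, fun x hx hne => ?_, fun x hx hne => ?_,
    fun x hx hne => ?_, fun x hx hne => ?_, fun x y hx hy hxn hyn b hbx hby => ?_, ?_⟩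
  · rcases kinds x hx with ⟨h1, h2, _⟩ | ⟨c, h1, h2, h3⟩ | ⟨c, h1, h2, h3, h4, h5⟩
    · rw [h2]; exact hAof _ (S1 x (hAsub x hx)) h1
    · rwa [h3]
    · rwa [h4]
  · rcases kinds x hx with ⟨h1, h2, _⟩ | ⟨c, h1, h2, h3⟩ | ⟨c, h1, h2, h3, h4, h5⟩
    · rw [h2, hm'1 _ ?_, S2 x (hAsub x hx)]
      intro c; rw [S2 x (hAsub x hx)]; exact hAne x hx c
    · rw [h3, h3]
    · have e1 := S2 _ (hAv (!c))
      rw [h4, hm'3 _ _ e1, Bool.not_not, mback x c hx h1]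
      rw [Bool.not_not, mback x c hx h1]
      exact hAne x hx c
  · rcases kinds x hx with ⟨h1, h2, h3⟩ | ⟨c, h1, h2, h3⟩ | ⟨c, h1, h2, h3, h4, h5⟩
    · rw [h2] at hne ⊢; rw [h3]; exact S3 x (hAsub x hx) hne
    · exact (hne h3).elim
    · rw [h4, h5]
      refine PathOK.append _ _ ?_ (S3 _ (hAv _) h2)
      rw [Bool.not_not, ← h1]
      exact S3 x (hAsub x hx) (mne x c hx h1)
  · rcases kinds x hx with ⟨h1, h2, h3⟩ | ⟨c, h1, h2, h3⟩ | ⟨c, h1, h2, h3, h4, h5⟩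
    · rw [h2] at hne ⊢
      rw [h3, hL'1, S4 x (hAsub x hx) hne]
      intro c; rw [S2 x (hAsub x hx)]; exact hAne x hx c
    · exact (hne h3).elim
    · have e1 := S2 _ (hAv (!c))
      rw [h4, hL'2 _ _ e1, h5, flipRev_append, flipRev_cons, Bool.not_not,
        S4 _ (hAv _) h2, ← h1, S4 x (hAsub x hx) (mne x c hx h1)]
      simp
  · rcases kinds x hx with ⟨h1, h2, h3⟩ | ⟨c, h1, h2, h3⟩ | ⟨c, h1, h2, h3, h4, h5⟩
    · rw [h2] at hne; rw [h3]; exact S5 x (hAsub x hx) hne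
    · exact (hne h3).elim
    · rw [h5, List.map_append, List.map_cons, List.nodup_append, List.nodup_cons]
      have hx' := mne x c hx h1
      refine ⟨S5 x (hAsub x hx) hx', ⟨fun h => ?_, S5 _ (hAv _) h2⟩, ?_⟩
      · exact S6 _ (hAv _) h2 v h (Finset.mem_insert_self v U)
      · rintro b hb b' hb' rfl
        rcases List.mem_cons.1 hb' with h | h
        · dsimp only at h
          subst h
          exact S6 x (hAsub x hx) hx' b hb (Finset.mem_insert_self b U)
        · rcases S7 x _ (hAsub x hx) (hAv _) hx' h2 b hb h with h | h
          · exact hAne x hx _ h.symm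
          · rw [h1] at h; simp at h
  · rcases kinds x hx with ⟨h1, h2, h3⟩ | ⟨c, h1, h2, h3⟩ | ⟨c, h1, h2, h3, h4, h5⟩
    · rw [h2] at hne; rw [h3]
      exact fun b hb hbU => S6 x (hAsub x hx) hne b hb (Finset.mem_insert_of_mem hbU)
    · exact (hne h3).elim
    · rw [h5, List.map_append, List.map_cons]
      have hx' := mne x c hx h1
      intro b hb hbU
      rcases List.mem_append.1 hb with hb | hb
      · exact S6 x (hAsub x hx) hx' b hb (Finset.mem_insert_of_mem hbU)
      · rcases List.mem_cons.1 hb with rfl | hb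
        · exact hv hbU
        · exact S6 _ (hAv _) h2 b hb (Finset.mem_insert_of_mem hbU)
  · -- supports decompose
    have hdec : ∀ x, NodeIn U x → m' x ≠ x → ∀ b ∈ (L' x).map Prod.fst,
        (∃ c, b = v ∧ m x = Sum.inr (v, c) ∧ m' x = m (Sum.inr (v, !c))) ∨
        (∃ z, A' z ∧ m z ≠ z ∧ b ∈ (L z).map Prod.fst ∧
          (z = x ∨ ∃ c, m x = Sum.inr (v, c) ∧ z = Sum.inr (v, !c) ∧
            m' x = m (Sum.inr (v, !c)))) := by
      intro x hx hne b hb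
      rcases kinds x hx with ⟨h1, h2, h3⟩ | ⟨c, h1, h2, h3⟩ | ⟨c, h1, h2, h3, h4, h5⟩
      · rw [h2] at hne; rw [h3] at hb
        exact Or.inr ⟨x, hAsub x hx, hne, hb, Or.inl rfl⟩
      · exact (hne h3).elim
      · rw [h5, List.map_append, List.map_cons] at hb
        rcases List.mem_append.1 hb with hb | hb
        · exact Or.inr ⟨x, hAsub x hx, mne x c hx h1, hb, Or.inl rfl⟩
        · rcases List.mem_cons.1 hb with rfl | hb
          · exact Or.inl ⟨c, rfl, h1, h4⟩
          · exact Or.inr ⟨_, hAv _, h2, hb, Or.inr ⟨c, h1, rfl, h4⟩⟩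
    have hvx : ∀ z, A' z → m z ≠ z → b ∈ (L z).map Prod.fst → b ≠ v := by
      rintro z hz hmz hbz rfl
      exact S6 z hz hmz b hbz (Finset.mem_insert_self b U)
    have htwo : ∀ c c', m x = Sum.inr (v, c) → m' x = m (Sum.inr (v, !c)) →
        m y = Sum.inr (v, c') → y = x ∨ y = m' x := by
      intro c c' h1 h2 h3
      rcases Bool.eq_or_eq_not c' c with rfl | rfl
      · left; rw [← mback y _ hy h3, mback x _ hx h1]
      · right; rw [h2, ← mback y _ hy h3]
    rcases hdec x hx hxn b hbx with ⟨c, h1, h2, h3⟩ | ⟨z, hz, hzn, hbz, hzx⟩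
    · rcases hdec y hy hyn b hby with ⟨c', h1', h2', h3'⟩ | ⟨z', hz', hzn', hbz', hzx'⟩
      · exact htwo c c' h2 h3 h2'
      · exact (hvx z' hz' hzn' hbz' h1).elim
    · rcases hdec y hy hyn b hby with ⟨c', h1', h2', h3'⟩ | ⟨z', hz', hzn', hbz', hzx'⟩
      · exact (hvx z hz hzn hbz h1').elim
      · have hzz := S7 z z' hz hz' hzn hzn' b hbz hbz'
        rcases hzx with rfl | ⟨c, h1, rfl, h3⟩ <;> rcases hzx' with rfl | ⟨c', h1', rfl, h3'⟩
        · rcases hzz with h | h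
          · exact Or.inl h
          · right
            rw [h, hm'1]
            intro c hc
            exact hAne z' hy c (by rw [h, hc])
        · rcases hzz with h | h
          · exact (hAne z hx _ h.symm).elim
          · have h6 : m z = Sum.inr (v, !c') := h.symm
            have h7 : m (Sum.inr (v, c')) = y := mback y c' hy h1'
            right
            rw [hm'3 z _ h6, Bool.not_not, h7]
            rw [Bool.not_not, h7]
            exact hAne y hy c'
        · rcases hzz with h | h
          · exact (hAne z' hy _ h).elim
          · exact Or.inr (h.trans h3.symm)
        · exact htwo c c' h1 h3 h1'
  · refine le_trans (Set.ncard_le_ncard_of_injOn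
      (fun x => if h : ∃ c, m x = Sum.inr (v, c) then Sum.inr (v, !h.choose) else x)
      ?_ ?_ (Set.toFinite _)) S8
    · rintro x ⟨hx, hxx⟩
      rcases kinds x hx with ⟨h1, h2, h3⟩ | ⟨c, h1, h2, h3⟩ | ⟨c, h1, h2, h3, h4, h5⟩
      · rw [dif_neg (by push Not; exact h1)]
        exact ⟨hAsub x hx, h2 ▸ hxx⟩
      · have h : ∃ c, m x = Sum.inr (v, c) := ⟨c, h1⟩
        have hcc : h.choose = c := by
          have := h.choose_spec.symm.trans h1
          simpa using this
        rw [dif_pos h, hcc]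
        exact ⟨hAv _, h2⟩
      · have h6 := S2 _ (hAv (!c))
        rw [← h4, hxx, h1] at h6
        simp at h6
    · rintro x ⟨hx, hxx⟩ y ⟨hy, hyy⟩ hxy
      beta_reduce at hxy
      split_ifs at hxy with h h' h'
      · have h1 := h.choose_spec
        have h2 := h'.choose_spec
        have h3 : h.choose = h'.choose := by simpa using hxy
        rw [← mback x _ hx h1, ← mback y _ hy h2, h3]
      · exact (hAne y hy _ hxy.symm).elim
      · exact (hAne x hx _ hxy).elim
      · exact hxy

end AlternatingPaths
end OddMinor

namespace OddMinor
open scoped Classical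
open Relation

section Extraction

variable {α β : Type*}

lemma PathSystem.exists_empty [Finite α] [Finite β] {D : SimpleGraph (α ⊕ β × Bool)} {d : ℕ}
    (U : Finset β) {m : α ⊕ β × Bool → α ⊕ β × Bool} {L : α ⊕ β × Bool → List (β × Bool)}
    (S : PathSystem D d U m L) : ∃ m' L', PathSystem D d ∅ m' L' := by
  induction U using Finset.induction_on generalizing m L with
  | empty => exact ⟨m, L, S⟩
  | insert v U hv ih =>
    obtain ⟨m', L', S'⟩ := S.remove hv
    exact ih S'

/-- Choosing one element from each orbit of a fixed-point free involution. -/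
lemma exists_orbit_reps {ι : Type*} (σ : ι → ι) (n : ℕ) (F : Finset ι)
    (hmap : ∀ x ∈ F, σ x ∈ F) (hinv : ∀ x ∈ F, σ (σ x) = x) (hfix : ∀ x ∈ F, σ x ≠ x)
    (hn : 2 * n ≤ F.card) :
    ∃ s : Fin n → ι, (∀ i, s i ∈ F) ∧ Function.Injective s ∧ ∀ i j, s i ≠ σ (s j) := by
  induction n generalizing F with
  | zero => exact ⟨fun i => i.elim0, fun i => i.elim0, fun i => i.elim0, fun i => i.elim0⟩
  | succ n ih =>
    obtain ⟨a, ha⟩ : F.Nonempty := Finset.card_pos.1 (by omega)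
    obtain ⟨s, hs, hinj, hne⟩ := ih ((F.erase a).erase (σ a))
      (fun x hx => by
        simp only [Finset.mem_erase] at hx ⊢
        refine ⟨fun h => hx.2.1 ?_, fun h => hx.1 ?_, hmap x hx.2.2⟩
        · rw [← hinv x hx.2.2, h, hinv a ha]
        · rw [← hinv x hx.2.2, h])
      (fun x hx => hinv x (Finset.mem_of_mem_erase (Finset.mem_of_mem_erase hx)))
      (fun x hx => hfix x (Finset.mem_of_mem_erase (Finset.mem_of_mem_erase hx)))
      (by
        rw [Finset.card_erase_of_mem (Finset.mem_erase.2 ⟨hfix a ha, hmap a ha⟩),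
          Finset.card_erase_of_mem ha]
        omega)
    have hsF : ∀ i, s i ≠ a ∧ s i ≠ σ a ∧ s i ∈ F := fun i => by
      have := hs i
      simp only [Finset.mem_erase] at this
      tauto
    refine ⟨Fin.cons a s, fun i => ?_, ?_, fun i j => ?_⟩
    · refine Fin.cases ha (fun i => (hsF i).2.2) i
    · rw [Fin.cons_injective_iff]
      exact ⟨fun ⟨i, hi⟩ => (hsF i).1 hi, hinj⟩
    · refine Fin.cases ?_ (fun i => ?_) i <;> refine Fin.cases ?_ (fun j => ?_) j
      · exact (hfix a ha).symm
      · simp only [Fin.cons_zero, Fin.cons_succ]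
        intro h
        exact (hsF j).2.1 (by rw [h, hinv _ (hsF j).2.2])
      · simp only [Fin.cons_zero, Fin.cons_succ]
        exact (hsF i).2.1
      · exact hne i j

lemma PathSystem.altPaths [Fintype α] [Finite β] {D : SimpleGraph (α ⊕ β × Bool)} {d n : ℕ}
    {m : α ⊕ β × Bool → α ⊕ β × Bool} {L : α ⊕ β × Bool → List (β × Bool)}
    (S : PathSystem D d ∅ m L) (hn : 2 * n + d ≤ Fintype.card α) :
    ∃ s t l, AltPaths D n s t l := by
  have hm : ∀ a : α, ∃ b : α, m (Sum.inl a) = Sum.inl b := by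
    intro a
    have h1 := S.maps (Sum.inl a) trivial
    rcases hma : m (Sum.inl a) with b | ⟨w, c⟩
    · exact ⟨b, rfl⟩
    · rw [hma] at h1; exact absurd h1 (Finset.notMem_empty w)
  choose σ hσ using hm
  have hσσ : ∀ a, σ (σ a) = a := fun a => by
    have := S.invol (Sum.inl a) trivial
    rw [hσ, hσ] at this
    exact Sum.inl_injective this
  have hne : ∀ a, σ a ≠ a → m (Sum.inl a) ≠ Sum.inl a := fun a h h' =>
    h (Sum.inl_injective ((hσ a).symm.trans h'))
  obtain ⟨s, hs, hinj, hst⟩ := exists_orbit_reps σ n (Finset.univ.filter fun a => σ a ≠ a)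
    (fun a ha => by
      simp only [Finset.mem_filter, Finset.mem_univ, true_and] at ha ⊢
      rw [hσσ]; exact ha.symm) (fun a _ => hσσ a) (fun a ha => (Finset.mem_filter.1 ha).2) (by
      have h1 := Finset.card_filter_add_card_filter_not (s := (Finset.univ : Finset α))
        (fun a => σ a ≠ a)
      have h2 : (Finset.univ.filter fun a => ¬ σ a ≠ a).card ≤ d := by
        refine le_trans ?_ S.fixed
        rw [← Set.ncard_coe_finset]
        refine Set.ncard_le_ncard_of_injOn Sum.inl ?_ Sum.inl_injective.injOn (Set.toFinite _)
        intro a ha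
        simp only [Finset.coe_filter, Set.mem_setOf_eq, not_not] at ha
        exact ⟨trivial, by rw [hσ, ha.2]⟩
      rw [Finset.card_univ] at h1
      omega)
  have hs' : ∀ i, σ (s i) ≠ s i := fun i => (Finset.mem_filter.1 (hs i)).2
  refine ⟨s, fun i => σ (s i), fun i => L (Sum.inl (s i)), fun i => ?_, hinj, fun i j h => ?_,
    hst, fun i => ?_, fun i j hij b hb hb' => ?_⟩
  · rw [← hσ]; exact S.path _ trivial (hne _ (hs' i))
  · apply hinj; rw [← hσσ (s i), ← hσσ (s j)]; exact congrArg σ h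
  · exact S.nodup _ trivial (hne _ (hs' i))
  · rcases S.disj (Sum.inl (s i)) (Sum.inl (s j)) trivial trivial (hne _ (hs' i)) (hne _ (hs' j)) b hb hb'
      with h | h
    · exact hij (hinj (Sum.inl_injective h)).symm
    · rw [hσ] at h; exact hst _ _ (Sum.inl_injective h)

/-- The graph obtained by adding `d` vertices adjacent to everything. -/
def addUniversal {N : Type*} (D : SimpleGraph N) (d : ℕ) : SimpleGraph (N ⊕ Fin d) where
  Adj
    | Sum.inl x, Sum.inl y => D.Adj x y
    | x, y => x ≠ y
  symm := ⟨by
    rintro (x | x) (y | y) h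
    · exact SimpleGraph.Adj.symm h
    all_goals exact Ne.symm h⟩
  loopless := ⟨by
    rintro (x | x) h
    · exact D.irrefl h
    · exact h rfl⟩

lemma exists_altPaths_of_perfectMatching [Fintype α] [Fintype β] {D : SimpleGraph (α ⊕ β × Bool)}
    {d n : ℕ} (hn : 2 * n + d ≤ Fintype.card α)
    (M : (addUniversal D d).Subgraph) (hM : M.IsPerfectMatching) :
    ∃ s t l, AltPaths D n s t l := by
  have hM1 : ∀ x, ∃! y, M.Adj x y := fun x => hM.1 (hM.2 x)
  choose μ hμ hμ' using hM1
  have hμμ : ∀ x, μ (μ x) = x := fun x => (hμ' (μ x) x (hμ x).symm).symm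
  obtain ⟨m, hm1, hm2⟩ : ∃ m : α ⊕ β × Bool → α ⊕ β × Bool,
      (∀ x y, μ (Sum.inl x) = Sum.inl y → m x = y) ∧
      (∀ x k, μ (Sum.inl x) = Sum.inr k → m x = x) := by
    refine ⟨fun x => (μ (Sum.inl x)).elim id fun _ => x, fun x y h => ?_, fun x y h => ?_⟩ <;>
      simp [h]
  have hcase : ∀ x, (μ (Sum.inl x) = Sum.inl (m x) ∧ D.Adj x (m x)) ∨
      (m x = x ∧ ∃ k, μ (Sum.inl x) = Sum.inr k) := by
    intro x
    rcases h : μ (Sum.inl x) with y | k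
    · left
      rw [hm1 x y h]
      refine ⟨rfl, ?_⟩
      have := (hμ (Sum.inl x)).adj_sub
      rw [h] at this
      exact this
    · exact Or.inr ⟨hm2 x k h, k, rfl⟩
  have S : PathSystem D d Finset.univ m (fun _ => []) := by
    refine ⟨fun x _ => ?_, fun x _ => ?_, fun x _ hx => ?_, fun _ _ _ => rfl,
      fun _ _ _ => List.nodup_nil, fun _ _ _ _ h => by simp at h,
      fun _ _ _ _ _ _ _ h => by simp at h, ?_⟩
    · rcases m x with a | ⟨w, c⟩
      · trivial
      · exact Finset.mem_univ w
    · rcases hcase x with ⟨h, _⟩ | ⟨h, _⟩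
      · exact hm1 _ _ (by rw [← h, hμμ])
      · rw [h, h]
    · rcases hcase x with ⟨_, h⟩ | ⟨h, _⟩
      · exact h
      · exact (hx h).elim
    · have : ∀ x : {x // NodeIn (Finset.univ : Finset β) x ∧ m x = x}, ∃ k : Fin d,
          μ (Sum.inl x.1) = Sum.inr k := by
        rintro ⟨x, _, hx⟩
        rcases hcase x with ⟨_, h⟩ | ⟨_, h⟩
        · rw [hx] at h; exact (D.irrefl h).elim
        · exact h
      choose k hk using this
      have hinj : Function.Injective k := by
        intro x y hxy
        have : μ (Sum.inl x.1) = μ (Sum.inl y.1) := by rw [hk, hk, hxy]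
        have := congrArg μ this
        rw [hμμ, hμμ] at this
        exact Subtype.ext (Sum.inl_injective this)
      have h1 := Nat.card_le_card_of_injective k hinj
      rw [Nat.card_fin] at h1
      exact h1
  obtain ⟨m', L', S'⟩ := S.exists_empty
  exact S'.altPaths hn

end Extraction
end OddMinor

namespace OddMinor
open scoped Classical
open Relation

section TutteBerge

variable {N : Type*}

lemma exists_odd_components [Fintype N] (D : SimpleGraph N) (d : ℕ)
    (heven : Even (Fintype.card N + d))
    (hno : ¬ ∃ M : (addUniversal D d).Subgraph, M.IsPerfectMatching) :
    ∃ (Y : Finset N) (𝒞 : Finset (Finset N)), Y.card + d + 1 ≤ 𝒞.card ∧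
      ∀ C ∈ 𝒞, Odd C.card ∧ ∃ x, x ∉ Y ∧ (C : Set N) = rcomp D.Adj {y | y ∉ Y} x := by
  rw [SimpleGraph.tutte] at hno
  push Not at hno
  obtain ⟨u, hu⟩ := hno
  unfold SimpleGraph.IsTutteViolator at hu
  obtain ⟨P, hP⟩ : ∃ P : (addUniversal D d).Subgraph,
    P = (⊤ : (addUniversal D d).Subgraph).deleteVerts u := ⟨_, rfl⟩
  rw [← hP] at hu
  have hverts : ∀ x, x ∈ P.verts ↔ x ∉ u := by rw [hP]; simp
  have hadj : ∀ x y : P.verts, P.coe.Adj x y ↔ (addUniversal D d).Adj x.1 y.1 := by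
    intro x y
    have hx := (hverts _).1 x.2
    have hy := (hverts _).1 y.2
    subst hP
    simp [hx, hy]
  have huniv : ∀ k : Fin d, Sum.inr k ∈ u := by
    intro k
    by_contra hk
    have hsub : ∀ c c' : P.coe.ConnectedComponent, c = c' := by
      have hconn : ∀ x : P.verts, P.coe.Reachable ⟨Sum.inr k, (hverts _).2 hk⟩ x := by
        rintro ⟨x, hx⟩
        by_cases hxk : x = Sum.inr k
        · subst hxk; exact SimpleGraph.Reachable.refl _
        · refine SimpleGraph.Adj.reachable ((hadj _ _).2 ?_)
          exact Ne.symm hxk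
      intro c c'
      induction c using SimpleGraph.ConnectedComponent.ind with | _ x
      induction c' using SimpleGraph.ConnectedComponent.ind with | _ y
      exact SimpleGraph.ConnectedComponent.sound ((hconn x).symm.trans (hconn y))
    have hle : P.coe.oddComponents.ncard ≤ 1 :=
      (Set.ncard_le_one_iff (Set.toFinite _)).2 fun _ _ => hsub _ _
    have hu0 : u.ncard = 0 := by omega
    have hu1 : u = ∅ := (Set.ncard_eq_zero (Set.toFinite u)).1 hu0
    have hodd : Odd P.coe.oddComponents.ncard := by
      have : P.coe.oddComponents.ncard = 1 := by omega
      rw [this]; exact odd_one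
    rw [SimpleGraph.odd_ncard_oddComponents] at hodd
    have : P.verts = Set.univ := by
      ext x; simp [hverts, hu1]
    rw [this, Nat.card_coe_set_eq, Set.ncard_univ, Nat.card_eq_fintype_card, Fintype.card_sum,
      Fintype.card_fin] at hodd
    exact Nat.not_even_iff_odd.2 hodd heven
  obtain ⟨Y, hY⟩ : ∃ Y : Finset N, Y = Finset.univ.filter fun x => Sum.inl x ∈ u := ⟨_, rfl⟩
  have hYm : ∀ x, x ∈ Y ↔ Sum.inl x ∈ u := by simp [hY]
  have hucard : Y.card + d ≤ u.ncard := by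
    have h1 : ((Y.image Sum.inl ∪ Finset.univ.image Sum.inr : Finset (N ⊕ Fin d)) : Set _) ⊆ u := by
      intro x hx
      simp only [Finset.coe_union, Finset.coe_image, Set.mem_union, Set.mem_image,
        Finset.mem_coe] at hx
      rcases hx with ⟨y, hy, rfl⟩ | ⟨k, _, rfl⟩
      · exact (hYm y).1 hy
      · exact huniv k
    have h2 := Set.ncard_le_ncard h1 (Set.toFinite u)
    rw [Set.ncard_coe_finset, Finset.card_union_of_disjoint, Finset.card_image_of_injective _
      Sum.inl_injective, Finset.card_image_of_injective _ Sum.inr_injective, Finset.card_univ,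
      Fintype.card_fin] at h2
    · exact h2
    · rw [Finset.disjoint_left]
      intro x hx hx'
      simp only [Finset.mem_image] at hx hx'
      obtain ⟨y, _, rfl⟩ := hx
      obtain ⟨k, _, hk⟩ := hx'
      simp at hk
  have hinl : ∀ x : P.verts, ∃ z, x.1 = Sum.inl z ∧ z ∉ Y := by
    rintro ⟨z | k, hx⟩
    · exact ⟨z, rfl, fun h => (hverts _).1 hx ((hYm z).1 h)⟩
    · exact absurd (huniv k) ((hverts _).1 hx)
  have hvert : ∀ x, x ∉ Y → Sum.inl x ∈ P.verts := fun x hx =>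
    (hverts _).2 fun h => hx ((hYm x).2 h)
  obtain ⟨F, hF⟩ : ∃ F : P.coe.ConnectedComponent → Finset N, ∀ c x, x ∈ F c ↔
      ∃ h : Sum.inl x ∈ P.verts, P.coe.connectedComponentMk ⟨Sum.inl x, h⟩ = c :=
    ⟨fun c => Finset.univ.filter fun x => ∃ h : Sum.inl x ∈ P.verts,
      P.coe.connectedComponentMk ⟨Sum.inl x, h⟩ = c, fun c x => by simp⟩
  have hFne : ∀ c, ∃ x, x ∈ F c ∧ x ∉ Y := by
    intro c
    induction c using SimpleGraph.ConnectedComponent.ind with | _ x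
    obtain ⟨x, hx⟩ := x
    obtain ⟨z, hz, hzY⟩ := hinl ⟨x, hx⟩
    dsimp only at hz
    subst hz
    exact ⟨z, (hF _ _).2 ⟨hx, rfl⟩, hzY⟩
  have hFinj : Function.Injective F := by
    intro c c' hcc
    obtain ⟨x, hx, _⟩ := hFne c
    have hx' := hx
    rw [hcc] at hx'
    obtain ⟨h, h1⟩ := (hF _ _).1 hx
    obtain ⟨h', h2⟩ := (hF _ _).1 hx'
    rw [← h1, ← h2]
  refine ⟨Y, (Set.toFinite P.coe.oddComponents).toFinset.image F, ?_, ?_⟩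
  · rw [Finset.card_image_of_injective _ hFinj, ← Set.ncard_eq_toFinset_card]
    omega
  · intro C hC
    obtain ⟨c, hc, rfl⟩ := Finset.mem_image.1 hC
    rw [Set.Finite.mem_toFinset] at hc
    refine ⟨?_, ?_⟩
    · have : c.supp.ncard = (F c).card := by
        rw [← Set.ncard_coe_finset]
        symm
        refine Set.ncard_congr (fun x hx => ⟨Sum.inl x, ((hF _ _).1 hx).1⟩) ?_ ?_ ?_
        · intro x hx
          exact ((hF _ _).1 hx).2
        · intro x y hx hy hxy
          simpa using hxy
        · intro x hx
          obtain ⟨z, hz, hzY⟩ := hinl x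
          obtain ⟨x, hx'⟩ := x
          dsimp only at hz
          subst hz
          exact ⟨z, (hF _ _).2 ⟨hx', hx⟩, rfl⟩
      rw [← this]; exact hc
    · obtain ⟨x, hx, hxY⟩ := hFne c
      refine ⟨x, hxY, ?_⟩
      obtain ⟨hxv, hxc⟩ := (hF _ _).1 hx
      have key : ∀ z (hz : Sum.inl z ∈ P.verts), P.coe.Reachable ⟨Sum.inl x, hxv⟩ ⟨Sum.inl z, hz⟩ ↔
          z ∈ rcomp D.Adj {y | y ∉ Y} x := by
        intro z hz
        constructor
        · intro h
          rw [SimpleGraph.reachable_iff_reflTransGen] at h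
          have : ∀ w : P.verts, ReflTransGen P.coe.Adj ⟨Sum.inl x, hxv⟩ w → ∀ z, w.1 = Sum.inl z →
              z ∈ rcomp D.Adj {y | y ∉ Y} x := by
            intro w hw
            induction hw with
            | refl => intro z hz; rw [← Sum.inl_injective hz]; exact mem_rcomp_self _
            | @tail b e _ hbe ih =>
              intro z hz
              obtain ⟨y, hy, hyY⟩ := hinl b
              obtain ⟨z', hz', hz'Y⟩ := hinl e
              have hzz : z' = z := Sum.inl_injective (hz'.symm.trans hz)
              subst hzz
              have h1 := (hadj _ _).1 hbe
              rw [hy, hz'] at h1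
              exact rcomp_closed (ih y hy) h1 hz'Y
          exact this _ h z rfl
        · intro h
          rw [SimpleGraph.reachable_iff_reflTransGen]
          have : ∀ z, z ∈ rcomp D.Adj {y | y ∉ Y} x → ∀ hz : Sum.inl z ∈ P.verts,
              ReflTransGen P.coe.Adj ⟨Sum.inl x, hxv⟩ ⟨Sum.inl z, hz⟩ := by
            intro z hz
            induction (show ReflTransGen _ x z from hz) with
            | refl => intro _; exact ReflTransGen.refl
            | @tail b e h1 h2 ih =>
              intro he
              have hb : b ∉ Y := rcomp_subset (S := {y | y ∉ Y}) hxY h1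
              exact (ih h1 (hvert b hb)).tail ((hadj _ _).2 h2.1)
          exact this z h hz
      ext z
      rw [Finset.mem_coe, hF, ← hxc]
      constructor
      · rintro ⟨h, h1⟩
        exact (key z h).1 (SimpleGraph.ConnectedComponent.exact h1.symm)
      · intro h
        have hz := hvert z (rcomp_subset (S := {y | y ∉ Y}) hxY h)
        exact ⟨hz, SimpleGraph.ConnectedComponent.sound ((key z hz).2 h).symm⟩

end TutteBerge
end OddMinor

namespace OddMinor
open scoped Classical
open Relation

section Gallai

variable {α β : Type*}

/-- The dual obstruction to the existence of alternating paths: after deleting the set `X`,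
every terminal in `α` and every half (an element of `β` with a single remaining copy) lies in its
own component, and `κ` records the terminal or half in the component of the other elements. -/
structure GallaiCover (D : SimpleGraph (α ⊕ β × Bool)) (n : ℕ) (X : Finset (α ⊕ β))
    (h : β → Option Bool) (κ : β → Option (α ⊕ β)) : Prop where
  card : X.card ≤ 2 * n
  inl_inl : ∀ a a', Sum.inl a ∉ X → Sum.inl a' ∉ X → ¬ D.Adj (Sum.inl a) (Sum.inl a')
  inl_half : ∀ a v c, Sum.inl a ∉ X → Sum.inr v ∉ X → h v = some c →
    ¬ D.Adj (Sum.inl a) (Sum.inr (v, c))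
  half_half : ∀ v v' c c', Sum.inr v ∉ X → Sum.inr v' ∉ X → h v = some c → h v' = some c' →
    ¬ D.Adj (Sum.inr (v, c)) (Sum.inr (v', c'))
  whole_inl : ∀ w c a, Sum.inr w ∉ X → h w = none → Sum.inl a ∉ X →
    D.Adj (Sum.inr (w, c)) (Sum.inl a) → κ w = some (Sum.inl a)
  whole_half : ∀ w c v c', Sum.inr w ∉ X → h w = none → Sum.inr v ∉ X → h v = some c' →
    D.Adj (Sum.inr (w, c)) (Sum.inr (v, c')) → κ w = some (Sum.inr v)
  whole_whole : ∀ w w' c c', Sum.inr w ∉ X → h w = none → Sum.inr w' ∉ X → h w' = none →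
    D.Adj (Sum.inr (w, c)) (Sum.inr (w', c')) → κ w = κ w'

/-- Forget which copy of an element of `β` a node is. -/
def dropCopy : α ⊕ β × Bool → α ⊕ β := Sum.map id Prod.fst

/-- A Gallai-type min-max theorem for disjoint alternating paths between terminals. -/
theorem exists_altPaths_or_gallaiCover [Fintype α] [Fintype β] (D : SimpleGraph (α ⊕ β × Bool))
    (hD : ∀ v, D.Adj (Sum.inr (v, false)) (Sum.inr (v, true))) (n : ℕ) :
    (∃ s t l, AltPaths D n s t l) ∨ ∃ X h κ, GallaiCover D n X h κ := by
  by_cases hn : 2 * n ≤ Fintype.card α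
  swap
  · right
    refine ⟨Finset.univ.image Sum.inl, fun _ => none, fun _ => none,
      ?_, ?_, ?_, ?_, ?_, ?_, ?_⟩
    · exact Finset.card_image_le.trans (by rw [Finset.card_univ]; omega)
    all_goals simp
  by_cases hM : ∃ M : (addUniversal D (Fintype.card α - 2 * n)).Subgraph, M.IsPerfectMatching
  · obtain ⟨M, hM⟩ := hM
    exact Or.inl (exists_altPaths_of_perfectMatching (by omega) M hM)
  right
  obtain ⟨Y, 𝒞, hcard, h𝒞⟩ := exists_odd_components D _
    ⟨Fintype.card α - n + Fintype.card β, by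
      rw [Fintype.card_sum, Fintype.card_prod, Fintype.card_bool]; omega⟩ hM
  have hsymm : RSymm D.Adj := fun _ _ h => SimpleGraph.Adj.symm h
  obtain ⟨comp, hcomp⟩ : ∃ comp : α ⊕ β × Bool → Set (α ⊕ β × Bool),
    comp = rcomp D.Adj {y | y ∉ Y} := ⟨_, rfl⟩
  have hcself : ∀ x, x ∈ comp x := fun x => hcomp ▸ mem_rcomp_self x
  have hceq : ∀ x y, x ∉ Y → y ∈ comp x → comp y = comp x := by
    subst hcomp
    intro x y hx hy
    refine subset_antisymm ?_ ?_
    · intro z hz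
      exact ReflTransGen.trans hy hz
    · intro z hz
      exact ReflTransGen.trans (reach_symm hsymm hx hy) hz
  have hadj : ∀ x y, x ∉ Y → y ∉ Y → D.Adj x y → comp x = comp y := by
    intro x y hx hy hxy
    refine (hceq x y hx ?_).symm
    rw [hcomp]
    exact rcomp_closed (mem_rcomp_self x) hxy hy
  obtain ⟨T, hT⟩ : ∃ T : α ⊕ β × Bool → Prop,
    T = fun x => x ∉ Y ∧ ∀ v c, x = Sum.inr (v, c) → Sum.inr (v, !c) ∈ Y := ⟨_, rfl⟩
  obtain ⟨pick, hpick1⟩ : ∃ pick : Set (α ⊕ β × Bool) → Option (α ⊕ β × Bool),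
      ∀ S, (∃ x ∈ S, T x) → ∃ x ∈ S, T x ∧ pick S = some x := by
    refine ⟨fun S => if h : ∃ x ∈ S, T x then some h.choose else none, fun S h => ?_⟩
    exact ⟨h.choose, h.choose_spec.1, h.choose_spec.2, dif_pos h⟩
  obtain ⟨K, hK⟩ : ∃ K : Finset (α ⊕ β × Bool),
    ∀ x, x ∈ K ↔ T x ∧ pick (comp x) = some x :=
    ⟨Finset.univ.filter fun x => T x ∧ pick (comp x) = some x, by simp⟩
  have hKY : ∀ x ∈ K, x ∉ Y := fun x hx => by
    have := ((hK x).1 hx).1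
    rw [hT] at this
    exact this.1
  have hKmate : ∀ v c, Sum.inr (v, c) ∈ K → Sum.inr (v, !c) ∈ Y := fun v c hx => by
    have := ((hK _).1 hx).1
    rw [hT] at this
    exact this.2 v c rfl
  have hKcomp : ∀ x ∈ K, ∀ y ∈ K, comp x = comp y → x = y := by
    intro x hx y hy hxy
    have h1 := ((hK x).1 hx).2
    have h2 := ((hK y).1 hy).2
    rw [hxy, h2] at h1
    exact (Option.some_injective _ h1).symm
  have hKadj : ∀ x ∈ K, ∀ y ∈ K, ¬ D.Adj x y := by
    intro x hx y hy hxy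
    have := hKcomp x hx y hy (hadj x y (hKY x hx) (hKY y hy) hxy)
    subst this
    exact D.irrefl hxy
  -- every odd component contributes a chosen terminal
  have hoddT : ∀ C ∈ 𝒞, ∃ x ∈ K, (C : Set (α ⊕ β × Bool)) = comp x := by
    intro C hC
    obtain ⟨hodd, x0, hx0, hCx⟩ := h𝒞 C hC
    rw [← hcomp] at hCx
    have hCY : ∀ x ∈ C, x ∉ Y := by
      intro x hx
      have : x ∈ comp x0 := by rw [← hCx]; exact hx
      rw [hcomp] at this
      exact rcomp_subset (S := {y | y ∉ Y}) hx0 this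
    have hex : ∃ x ∈ (C : Set (α ⊕ β × Bool)), T x := by
      by_contra hcon
      push Not at hcon
      rw [hT] at hcon
      have hnoinl : ∀ x ∈ C, ∃ v c, x = Sum.inr (v, c) ∧ Sum.inr (v, !c) ∈ C := by
        intro x hx
        have h1 := hcon x hx
        push Not at h1
        obtain ⟨v, c, rfl, h2⟩ := h1 (hCY x hx)
        refine ⟨v, c, rfl, ?_⟩
        have h3 : D.Adj (Sum.inr (v, c)) (Sum.inr (v, !c)) := by
          cases c
          · exact hD v
          · exact (hD v).symm
        have h4 : Sum.inr (v, !c) ∈ (C : Set (α ⊕ β × Bool)) := by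
          have hx' : Sum.inr (v, c) ∈ comp x0 := by rw [← hCx]; exact hx
          rw [hCx]
          rw [hcomp] at hx' ⊢
          exact rcomp_closed hx' h3 h2
        exact h4
      have hC2 : C = ((Finset.univ.filter fun v : β => Sum.inr (v, false) ∈ C) ×ˢ
          (Finset.univ : Finset Bool)).image Sum.inr := by
        ext x
        simp only [Finset.mem_image, Finset.mem_product, Finset.mem_filter, Finset.mem_univ,
          true_and, and_true]
        constructor
        · intro hx
          obtain ⟨v, c, rfl, h⟩ := hnoinl x hx
          refine ⟨(v, c), ?_, rfl⟩
          cases c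
          · exact hx
          · exact h
        · rintro ⟨⟨v, c⟩, h, rfl⟩
          cases c
          · exact h
          · obtain ⟨v', c', h1, h2⟩ := hnoinl _ h
            obtain ⟨rfl, rfl⟩ : v = v' ∧ false = c' := by simpa using h1
            exact h2
      rw [hC2, Finset.card_image_of_injective _ Sum.inr_injective, Finset.card_product,
        Finset.card_univ, Fintype.card_bool] at hodd
      exact Nat.not_even_iff_odd.2 hodd (by simp)
    obtain ⟨x, hxC, hxT, hxp⟩ := hpick1 _ hex
    have hxcomp : comp x = C := by
      rw [hCx]
      refine hceq x0 x hx0 ?_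
      rw [← hCx]; exact hxC
    exact ⟨x, (hK x).2 ⟨hxT, by rw [hxcomp]; exact hxp⟩, hxcomp.symm⟩
  have hKcard : 𝒞.card ≤ K.card := by
    refine (Finset.card_le_card (t := K.image fun x => (comp x).toFinset) ?_).trans
      Finset.card_image_le
    intro C hC
    obtain ⟨x, hx, hCx⟩ := hoddT C hC
    refine Finset.mem_image.2 ⟨x, hx, ?_⟩
    apply Finset.coe_injective
    rw [hCx, Set.coe_toFinset]
  have hdrop : Set.InjOn (dropCopy : α ⊕ β × Bool → α ⊕ β) K := by
    rintro (a | ⟨v, c⟩) hx (a' | ⟨v', c'⟩) hy hxy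
    · have : a = a' := by simpa [dropCopy] using hxy
      rw [this]
    · simp [dropCopy] at hxy
    · simp [dropCopy] at hxy
    · have : v = v' := by simpa [dropCopy] using hxy
      subst this
      rcases Bool.eq_or_eq_not c c' with rfl | rfl
      · rfl
      · exact absurd (hKmate v c' hy) (hKY _ hx)
  obtain ⟨S, hS⟩ : ∃ S : Finset (α ⊕ β), S = Finset.univ.image Sum.inl ∪
    (Finset.univ.filter fun v : β => ∃ c, Sum.inr (v, c) ∈ Y).image Sum.inr := ⟨_, rfl⟩
  have hScard : S.card ≤ Fintype.card α + Y.card := by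
    rw [hS]
    refine (Finset.card_union_le _ _).trans (Nat.add_le_add ?_ ?_)
    · exact Finset.card_image_le
    · refine Finset.card_image_le.trans ?_
      have : ∀ v : β, v ∈ (Finset.univ.filter fun v : β => ∃ c, Sum.inr (v, c) ∈ Y) →
          ∃ c, Sum.inr (v, c) ∈ Y := fun v hv => (Finset.mem_filter.1 hv).2
      choose! g hg using this
      refine Finset.card_le_card_of_injOn (fun v => Sum.inr (v, g v)) (fun v hv => hg v hv) ?_
      intro v _ v' _ h
      have : v = v' ∧ g v = g v' := by simpa using h
      exact this.1
  have hKS : K.image dropCopy ⊆ S := by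
    intro y hy
    obtain ⟨x, hx, rfl⟩ := Finset.mem_image.1 hy
    rw [hS]
    rcases x with a | ⟨v, c⟩
    · simp [dropCopy]
    · have := hKmate v c hx
      simp only [dropCopy, Sum.map_inr, Finset.mem_union, Finset.mem_image, Finset.mem_filter,
        Finset.mem_univ, true_and]
      exact Or.inr ⟨v, ⟨_, this⟩, rfl⟩
  have hXinl : ∀ a, Sum.inl a ∉ S \ K.image dropCopy → Sum.inl a ∈ K := by
    intro a ha
    have h1 : (Sum.inl a : α ⊕ β) ∈ S := by rw [hS]; simp
    have h2 : Sum.inl a ∈ K.image dropCopy := by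
      by_contra h; exact ha (Finset.mem_sdiff.2 ⟨h1, h⟩)
    obtain ⟨x, hx, hxa⟩ := Finset.mem_image.1 h2
    rcases x with a' | ⟨v, c⟩
    · have : a' = a := by simpa [dropCopy] using hxa
      exact this ▸ hx
    · simp [dropCopy] at hxa
  obtain ⟨h, hh1, hh2⟩ : ∃ h : β → Option Bool,
      (∀ v, h v = none → ∀ c, Sum.inr (v, c) ∉ Y) ∧
      (∀ v c, h v = some c → Sum.inr (v, !c) ∈ Y) := by
    refine ⟨fun v => if Sum.inr (v, false) ∈ Y then some true else
      if Sum.inr (v, true) ∈ Y then some false else none, fun v hv c => ?_, fun v c hv => ?_⟩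
    · beta_reduce at hv
      split_ifs at hv with h1 h2
      cases c <;> assumption
    · beta_reduce at hv
      split_ifs at hv with h1 h2
      · rw [← Option.some_injective _ hv]; exact h1
      · rw [← Option.some_injective _ hv]; exact h2
  have hXinr : ∀ v c, Sum.inr v ∉ S \ K.image dropCopy → h v = some c → Sum.inr (v, c) ∈ K := by
    intro v c hv hvc
    have h1 : (Sum.inr v : α ⊕ β) ∈ S := by
      rw [hS]
      simp only [Finset.mem_union, Finset.mem_image, Finset.mem_filter, Finset.mem_univ, true_and]
      exact Or.inr ⟨v, ⟨_, hh2 v c hvc⟩, rfl⟩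
    have h2 : Sum.inr v ∈ K.image dropCopy := by
      by_contra h; exact hv (Finset.mem_sdiff.2 ⟨h1, h⟩)
    obtain ⟨x, hx, hxa⟩ := Finset.mem_image.1 h2
    rcases x with a' | ⟨v', c'⟩
    · simp [dropCopy] at hxa
    · have : v' = v := by simpa [dropCopy] using hxa
      subst this
      rcases Bool.eq_or_eq_not c c' with rfl | rfl
      · exact hx
      · have := hh2 v' _ hvc
        rw [Bool.not_not] at this
        exact absurd this (hKY _ hx)
  have hwcomp : ∀ w c, h w = none → comp (Sum.inr (w, c)) = comp (Sum.inr (w, false)) := by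
    intro w c hw
    cases c
    · rfl
    · exact (hadj _ _ (hh1 w hw _) (hh1 w hw _) (hD w)).symm
  have hwK : ∀ w c x, h w = none → x ∈ K → D.Adj (Sum.inr (w, c)) x →
      (pick (comp (Sum.inr (w, false)))).map dropCopy = some (dropCopy x) := by
    intro w c x hw hx hwx
    rw [← hwcomp w c hw, hadj _ _ (hh1 w hw c) (hKY x hx) hwx, ((hK x).1 hx).2]
    rfl
  refine ⟨S \ K.image dropCopy, h, fun w => (pick (comp (Sum.inr (w, false)))).map dropCopy,
    ?_, ?_, ?_, ?_, ?_, ?_, ?_⟩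
  · rw [Finset.card_sdiff_of_subset hKS, Finset.card_image_of_injOn hdrop]
    omega
  · intro a a' ha ha'
    exact hKadj _ (hXinl a ha) _ (hXinl a' ha')
  · intro a v c ha hv hvc
    exact hKadj _ (hXinl a ha) _ (hXinr v c hv hvc)
  · intro v v' c c' hv hv' hvc hvc'
    exact hKadj _ (hXinr v c hv hvc) _ (hXinr v' c' hv' hvc')
  · intro w c a _ hw ha hwa
    exact hwK w c _ hw (hXinl a ha) hwa
  · intro w c v c' _ hw hv hvc hwv
    exact hwK w c _ hw (hXinr v c' hv hvc) hwv
  · intro w w' c c' _ hw _ hw' hww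
    rw [← hwcomp w c hw, ← hwcomp w' c' hw', hadj _ _ (hh1 w hw c) (hh1 w' hw' c') hww]

end Gallai
end OddMinor

namespace OddMinor
open scoped Classical
open Relation

section Menger

variable {V : Type*}

/-- The auxiliary relation whose alternating paths are the `r`-walks from `Y` to `Y'`. -/
def linkAdj (r : V → V → Prop) (Y Y' : Set V) :
    (V × Bool) ⊕ V × Bool → (V × Bool) ⊕ V × Bool → Prop
  | Sum.inl (v, b), Sum.inr (u, c) => v = u ∧ b = c ∧ v ∈ (if b then Y' else Y)
  | Sum.inr (u, c), Sum.inl (v, b) => v = u ∧ b = c ∧ v ∈ (if b then Y' else Y)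
  | Sum.inr (u, c), Sum.inr (v, d) => c ≠ d ∧ (u = v ∨ r u v)
  | Sum.inl _, Sum.inl _ => False

/-- The graph of `linkAdj`. -/
def linkGraph (r : V → V → Prop) (hr : RSymm r) (Y Y' : Set V) :
    SimpleGraph ((V × Bool) ⊕ V × Bool) where
  Adj := linkAdj r Y Y'
  symm := ⟨by
    rintro (⟨v, b⟩ | ⟨v, b⟩) (⟨u, c⟩ | ⟨u, c⟩) h
    · exact h
    · exact h
    · exact h
    · exact ⟨h.1.symm, h.2.imp Eq.symm fun h => hr h⟩⟩
  loopless := ⟨by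
    rintro (⟨v, b⟩ | ⟨v, b⟩) h
    · exact h
    · exact h.1 rfl⟩

lemma linkGraph_path {r : V → V → Prop} {hr : RSymm r} {Y Y' : Set V} {u : V} {b : Bool}
    (l : List (V × Bool)) (v : V) (c : Bool)
    (h : PathOK (linkGraph r hr Y Y') (Sum.inr (v, c)) l (Sum.inl (u, b))) :
    b = c ∧ u ∈ (if b then Y' else Y) ∧ u ∈ (v :: l.map Prod.fst) ∧
      RConn r {x | x ∈ v :: l.map Prod.fst} := by
  induction l generalizing v c with
  | nil =>
    obtain ⟨rfl, rfl, h3⟩ := h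
    refine ⟨rfl, h3, by simp, ?_⟩
    simpa using rconn_singleton r u
  | cons p l ih =>
    obtain ⟨w, e⟩ := p
    obtain ⟨h1, h2⟩ := h
    obtain ⟨rfl, h4, h5, h6⟩ := ih _ _ h2
    obtain ⟨h7, h8⟩ := h1
    have hcb : b = c := by
      cases b <;> cases c <;> simp_all
    refine ⟨hcb, h4, List.mem_cons_of_mem _ h5, ?_⟩
    have hset : {x | x ∈ v :: List.map Prod.fst ((w, b) :: l)} =
        {v} ∪ {x | x ∈ w :: List.map Prod.fst l} := by
      ext x; simp
    rw [hset]
    rcases h8 with rfl | h8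
    · exact RConn.union_inter hr (rconn_singleton r v) h6 (Set.mem_singleton v) (by simp)
    · exact RConn.union hr (rconn_singleton r v) h6 (Set.mem_singleton v) (by simp) h8

/-- A weak form of Menger's theorem. -/
theorem exists_linkage_or_separator [Fintype V] {r : V → V → Prop} (hr : RSymm r) (Y Y' : Set V)
    (k : ℕ) :
    (∃ Q : Fin k → Set V, (∀ i, RConn r (Q i)) ∧ (∀ i j, i ≠ j → Disjoint (Q i) (Q j)) ∧
      (∀ i, ∃ y ∈ Q i, y ∈ Y) ∧ ∀ i, ∃ y ∈ Q i, y ∈ Y') ∨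
    ∃ (X : Finset V) (A : Set V), X.card ≤ 2 * k ∧ (∀ y ∈ Y, y ∉ X → y ∈ A) ∧
      (∀ y ∈ Y', y ∉ A) ∧ (∀ a ∈ A, a ∉ X) ∧ ∀ a ∈ A, ∀ b, r a b → b ∉ X → b ∈ A := by
  rcases exists_altPaths_or_gallaiCover (linkGraph r hr Y Y')
    (fun v => ⟨by simp, Or.inl rfl⟩) k with ⟨s, t, l, h⟩ | ⟨X₀, hf, κ, h⟩
  · left
    refine ⟨fun i => {x | x ∈ (l i).map Prod.fst}, ?_⟩
    have key : ∀ i, RConn r {x | x ∈ (l i).map Prod.fst} ∧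
        ∀ b : Bool, ∃ y ∈ (l i).map Prod.fst, y ∈ (if b then Y' else Y) := by
      intro i
      have hp := h.path i
      generalize s i = p at hp
      generalize t i = q at hp
      generalize l i = L at hp
      obtain ⟨v, b⟩ := p
      obtain ⟨u, b'⟩ := q
      rcases L with _ | ⟨⟨w, e⟩, l'⟩
      · exact False.elim hp
      · obtain ⟨⟨rfl, hbe, h2⟩, h3⟩ := hp
        obtain ⟨rfl, h5, h6, h7⟩ := linkGraph_path _ _ _ h3
        refine ⟨by simpa using h7, fun c => ?_⟩
        rcases Bool.eq_or_eq_not c b' with rfl | rfl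
        · exact ⟨u, by simpa using h6, h5⟩
        · exact ⟨v, by simp, by rw [← hbe]; exact h2⟩
    refine ⟨fun i => (key i).1, fun i j hij => ?_, fun i => ?_, fun i => ?_⟩
    · exact Set.disjoint_left.2 fun x hx hx' => h.disj i j hij x hx hx'
    · simpa using (key i).2 false
    · simpa using (key i).2 true
  · right
    obtain ⟨X, hX⟩ : ∃ X : Finset V, X = X₀.image (Sum.elim Prod.fst id) := ⟨_, rfl⟩
    have hXr : ∀ v, v ∉ X → Sum.inr v ∉ X₀ := fun v hv hv' =>
      hv (by rw [hX]; exact Finset.mem_image.2 ⟨_, hv', rfl⟩)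
    have hXl : ∀ v b, v ∉ X → Sum.inl (v, b) ∉ X₀ := fun v b hv hv' =>
      hv (by rw [hX]; exact Finset.mem_image.2 ⟨_, hv', rfl⟩)
    refine ⟨X, {v | v ∉ X ∧ (hf v = some true ∨ (hf v = none ∧
      ((∃ y, y ∉ X ∧ κ v = some (Sum.inl (y, false))) ∨
        ∃ v', v' ∉ X ∧ hf v' = some true ∧ κ v = some (Sum.inr v'))))}, ?_, ?_, ?_, ?_, ?_⟩
    · rw [hX]; exact Finset.card_image_le.trans h.card
    · intro y hy hyX
      refine ⟨hyX, ?_⟩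
      have hadj : (linkGraph r hr Y Y').Adj (Sum.inl (y, false)) (Sum.inr (y, false)) :=
        ⟨rfl, rfl, by simpa using hy⟩
      rcases hc : hf y with _ | c
      · exact Or.inr ⟨rfl, Or.inl ⟨y, hyX, h.whole_inl y false _ (hXr y hyX) hc (hXl y _ hyX)
          hadj.symm⟩⟩
      · cases c
        · exact (h.inl_half _ _ _ (hXl y _ hyX) (hXr y hyX) hc hadj).elim
        · exact Or.inl rfl
    · rintro y hy ⟨hyX, hA⟩
      have hadj : (linkGraph r hr Y Y').Adj (Sum.inl (y, true)) (Sum.inr (y, true)) :=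
        ⟨rfl, rfl, by simpa using hy⟩
      rcases hA with hA | ⟨hA, hB⟩
      · exact h.inl_half _ _ _ (hXl y _ hyX) (hXr y hyX) hA hadj
      · have := h.whole_inl y true _ (hXr y hyX) hA (hXl y _ hyX) hadj.symm
        rcases hB with ⟨y', _, hB⟩ | ⟨y', _, _, hB⟩
        · rw [this] at hB; simp at hB
        · rw [this] at hB; simp at hB
    · rintro a ⟨ha, -⟩; exact ha
    · rintro a ⟨haX, ha⟩ b hab hbX
      refine ⟨hbX, ?_⟩
      have hadj : ∀ c, (linkGraph r hr Y Y').Adj (Sum.inr (a, c)) (Sum.inr (b, !c)) :=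
        fun c => ⟨by simp, Or.inr hab⟩
      rcases ha with ha | ⟨ha, ha'⟩
      · rcases hc : hf b with _ | c
        · exact Or.inr ⟨rfl, Or.inr ⟨a, haX, ha, h.whole_half b false a true (hXr _ hbX) hc
            (hXr _ haX) ha (hadj true).symm⟩⟩
        · cases c
          · exact (h.half_half _ _ _ _ (hXr _ haX) (hXr _ hbX) ha hc (hadj true)).elim
          · exact Or.inl rfl
      · rcases hc : hf b with _ | c
        · have := h.whole_whole a b true false (hXr _ haX) ha (hXr _ hbX) hc (hadj true)
          rw [this] at ha'
          exact Or.inr ⟨rfl, ha'⟩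
        · have := h.whole_half a (!c) b c (hXr _ haX) ha (hXr _ hbX) hc
            (by simpa using hadj (!c))
          rcases ha' with ⟨y, _, hy⟩ | ⟨v', _, hv', hy⟩
          · rw [this] at hy; simp at hy
          · rw [this] at hy
            have : b = v' := by simpa using hy
            subst this
            rw [hc] at hv'
            exact Or.inl hv'

end Menger
end OddMinor

namespace OddMinor
open scoped Classical
open Relation

section Hubs

/-- If any two families conflict in few pairs, there is a conflict-free transversal. -/
lemma exists_transversal {E : Type*} [Fintype E] (k D : ℕ)
    (cr : E → E → Fin k → Fin k → Prop)
    (h : ∀ e e', e ≠ e' →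
      ((Finset.univ : Finset (Fin k × Fin k)).filter fun p => cr e e' p.1 p.2).card ≤ D * k)
    (hk : Fintype.card E ^ 2 * D < k) :
    ∃ φ : E → Fin k, ∀ e e', e ≠ e' → ¬ cr e e' (φ e) (φ e') := by
  by_contra hcon
  push Not at hcon
  obtain ⟨bad, hbad⟩ : ∃ bad : E × E → Finset (E → Fin k), bad = fun p =>
    Finset.univ.filter fun φ => p.1 ≠ p.2 ∧ cr p.1 p.2 (φ p.1) (φ p.2) := ⟨_, rfl⟩
  have h1 : ∀ p, (bad p).card * k ^ 2 ≤ D * k * k ^ Fintype.card E := by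
    rintro ⟨e, e'⟩
    by_cases hee : e = e'
    · simp [hbad, hee]
    have h2 : ((bad (e, e')) ×ˢ (Finset.univ : Finset (Fin k × Fin k))).card ≤
        (((Finset.univ : Finset (Fin k × Fin k)).filter fun p => cr e e' p.1 p.2) ×ˢ
          (Finset.univ : Finset (E → Fin k))).card := by
      refine Finset.card_le_card_of_injOn (fun x => ((x.1 e, x.1 e'),
        Function.update (Function.update x.1 e x.2.1) e' x.2.2)) ?_ ?_
      · rintro ⟨φ, a, b⟩ hx
        simp only [Finset.coe_product, Set.mem_prod, Finset.mem_coe, hbad, Finset.mem_filter,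
          Finset.mem_univ, true_and, and_true] at hx ⊢
        exact hx.2
      · rintro ⟨φ, a, b⟩ - ⟨φ', a', b'⟩ - hxy
        simp only [Prod.mk.injEq] at hxy
        obtain ⟨⟨h3, h4⟩, h5⟩ := hxy
        have h6 : ∀ x, x ≠ e → x ≠ e' → φ x = φ' x := by
          intro x hx hx'
          have := congrFun h5 x
          simpa [hx, hx'] using this
        have h7 : a = a' := by
          have := congrFun h5 e
          simpa [hee] using this
        have h8 : b = b' := by
          have := congrFun h5 e'
          simpa using this
        have h9 : φ = φ' := by
          funext x
          by_cases hx : x = e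
          · rw [hx]; exact h3
          · by_cases hx' : x = e'
            · rw [hx']; exact h4
            · exact h6 x hx hx'
        rw [h7, h8, h9]
    rw [Finset.card_product, Finset.card_product, Finset.card_univ, Finset.card_univ,
      Fintype.card_prod, Fintype.card_fun, Fintype.card_fin, ← sq] at h2
    exact h2.trans (Nat.mul_le_mul_right _ (h e e' hee))
  have h2 : k ^ Fintype.card E ≤ ∑ p, (bad p).card := by
    have h3 : (Finset.univ : Finset (E → Fin k)) ⊆ Finset.univ.biUnion bad := by
      intro φ _
      obtain ⟨e, e', hee, hc⟩ := hcon φ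
      refine Finset.mem_biUnion.2 ⟨(e, e'), Finset.mem_univ _, ?_⟩
      rw [hbad]
      exact Finset.mem_filter.2 ⟨Finset.mem_univ _, hee, hc⟩
    have h4 := (Finset.card_le_card h3).trans Finset.card_biUnion_le
    simpa using h4
  have hkpos : 0 < k := by omega
  have h3 : k ^ Fintype.card E * k ^ 2 ≤
      Fintype.card E ^ 2 * (D * k * k ^ Fintype.card E) := by
    calc k ^ Fintype.card E * k ^ 2 ≤ (∑ p, (bad p).card) * k ^ 2 := Nat.mul_le_mul_right _ h2
      _ = ∑ p, (bad p).card * k ^ 2 := Finset.sum_mul _ _ _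
      _ ≤ ∑ _p : E × E, D * k * k ^ Fintype.card E := Finset.sum_le_sum fun p _ => h1 p
      _ = _ := by
        rw [Finset.sum_const, Finset.card_univ, Fintype.card_prod, smul_eq_mul, sq]
  have hpos : 0 < k ^ Fintype.card E * k := by positivity
  have h4 : (k ^ Fintype.card E * k) * k ≤
      (k ^ Fintype.card E * k) * (Fintype.card E ^ 2 * D) := by
    calc _ = k ^ Fintype.card E * k ^ 2 := by ring
      _ ≤ _ := h3
      _ = _ := by ring
  have := Nat.le_of_mul_le_mul_left h4 hpos
  omega

/-- If many disjoint connected sets `T j` each attach to many of the few disjoint connected sets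
`P a`, then there is a model of a complete graph all of whose branch sets contain some `P a`. -/
lemma exists_model_of_attached {V : Type*} {r : V → V → Prop} (hr : RSymm r) (s M k : ℕ)
    (hk : 0 < k) (T : Fin M → Set V) (P : Fin k → Set V) (hT : ∀ i, RConn r (T i))
    (hTne : ∀ i, (T i).Nonempty) (hTd : ∀ i j, i ≠ j → Disjoint (T i) (T j))
    (hP : ∀ i, RConn r (P i))
    (hPne : ∀ i, (P i).Nonempty) (hPd : ∀ i j, i ≠ j → Disjoint (P i) (P j))
    (hTP : ∀ i j, Disjoint (T i) (P j)) (J : Finset (Fin M)) (hJ : J.card = k)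
    (hdeg : ∀ j ∈ J, 2 ^ (s + 2) ≤ (Finset.univ.filter fun a =>
      ∃ x ∈ T j, ∃ y ∈ P a, r x y).card) :
    ∃ B : Fin s → Set V, CliqueModel r s B ∧ ∀ i, ∃ a, P a ⊆ B i := by
  obtain ⟨at', hat⟩ : ∃ at' : Fin M → Fin k → Prop,
    at' = fun j a => ∃ x ∈ T j, ∃ y ∈ P a, r x y := ⟨_, rfl⟩
  obtain ⟨q, hq⟩ : ∃ q : Fin M ⊕ Fin k → Fin M ⊕ Fin k → Prop, q = fun x y =>
    (∃ j a, x = Sum.inl j ∧ y = Sum.inr a ∧ at' j a) ∨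
      ∃ j a, y = Sum.inl j ∧ x = Sum.inr a ∧ at' j a := ⟨_, rfl⟩
  have hqs : RSymm q := by
    subst hq
    rintro x y (⟨j, a, h1, h2, h3⟩ | ⟨j, a, h1, h2, h3⟩)
    · exact Or.inr ⟨j, a, h1, h2, h3⟩
    · exact Or.inl ⟨j, a, h1, h2, h3⟩
  have hqi : ∀ x, ¬ q x x := by
    subst hq
    rintro x (⟨j, a, h1, h2, h3⟩ | ⟨j, a, h1, h2, h3⟩) <;> (rw [h1] at h2; simp at h2)
  obtain ⟨R, hR⟩ : ∃ R : Finset (Fin M ⊕ Fin k), R = J.disjSum Finset.univ := ⟨_, rfl⟩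
  have hRc : R.card = 2 * k := by
    rw [hR, Finset.card_disjSum, hJ]; simp; ring
  have hpair : 2 ^ (s + 2) * R.card ≤ pairCount q R := by
    obtain ⟨E, hE⟩ : ∃ E : Finset (Fin M × Fin k), E = J.biUnion fun j =>
      (Finset.univ.filter fun a => at' j a).image fun a => (j, a) := ⟨_, rfl⟩
    have hE1 : k * 2 ^ (s + 2) ≤ E.card := by
      rw [hE, Finset.card_biUnion]
      · have h1 := Finset.card_nsmul_le_sum J (fun j =>
          ((Finset.univ.filter fun a => at' j a).image fun a => (j, a)).card) (2 ^ (s + 2))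
          (fun j hj => by
            rw [Finset.card_image_of_injective _ (Prod.mk_right_injective j)]
            subst hat
            exact hdeg j hj)
        rwa [hJ, smul_eq_mul] at h1
      · intro j _ j' _ hjj
        rw [Function.onFun, Finset.disjoint_left]
        rintro ⟨x, a⟩ h1 h2
        simp only [Finset.mem_image, Prod.mk.injEq] at h1 h2
        obtain ⟨_, _, rfl, _⟩ := h1
        obtain ⟨_, _, h, _⟩ := h2
        exact hjj h.symm
    have hE2 : ∀ j a, (j, a) ∈ E → j ∈ J ∧ at' j a := by
      intro j a h
      rw [hE] at h
      simp only [Finset.mem_biUnion, Finset.mem_image, Finset.mem_filter, Finset.mem_univ,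
        true_and, Prod.mk.injEq] at h
      obtain ⟨j', h1, a', h2, rfl, rfl⟩ := h
      exact ⟨h1, h2⟩
    have h3 : E.image (fun p => ((Sum.inl p.1, Sum.inr p.2) :
        (Fin M ⊕ Fin k) × (Fin M ⊕ Fin k))) ∪ E.image (fun p => (Sum.inr p.2, Sum.inl p.1)) ⊆
        (R ×ˢ R).filter fun p => q p.1 p.2 := by
      intro p hp
      rw [Finset.mem_filter, Finset.mem_product, hR, hq]
      rcases Finset.mem_union.1 hp with hp | hp
      · obtain ⟨⟨j, a⟩, h4, rfl⟩ := Finset.mem_image.1 hp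
        obtain ⟨h5, h6⟩ := hE2 j a h4
        refine ⟨⟨?_, ?_⟩, Or.inl ⟨j, a, rfl, rfl, h6⟩⟩ <;> simp [h5]
      · obtain ⟨⟨j, a⟩, h4, rfl⟩ := Finset.mem_image.1 hp
        obtain ⟨h5, h6⟩ := hE2 j a h4
        refine ⟨⟨?_, ?_⟩, Or.inr ⟨j, a, rfl, rfl, h6⟩⟩ <;> simp [h5]
    have h4 := Finset.card_le_card h3
    rw [Finset.card_union_of_disjoint, Finset.card_image_of_injective,
      Finset.card_image_of_injective] at h4
    · have h5 : pairCount q R = ((R ×ˢ R).filter fun p => q p.1 p.2).card := by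
        rw [pairCount, Finset.card_filter, Finset.sum_product]
      rw [h5, hRc]
      nlinarith
    · rintro ⟨j, a⟩ ⟨j', a'⟩ h
      simp only [Prod.mk.injEq, Sum.inl.injEq, Sum.inr.injEq] at h
      rw [h.1, h.2]
    · rintro ⟨j, a⟩ ⟨j', a'⟩ h
      simp only [Prod.mk.injEq, Sum.inl.injEq, Sum.inr.injEq] at h
      rw [h.1, h.2]
    · rw [Finset.disjoint_left]
      intro p hp hp'
      obtain ⟨x, _, rfl⟩ := Finset.mem_image.1 hp
      obtain ⟨y, _, h⟩ := Finset.mem_image.1 hp'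
      simp at h
  obtain ⟨B, hB, -⟩ := exists_cliqueModel_of_pairCount (s + 1) _ R q rfl hqs hqi
    (Finset.card_pos.1 (by omega)) hpair
  have hlift := hB.lift (r := r) hr (Z := Set.univ) (fun _ => Set.subset_univ _)
    (D := Sum.elim T P)
    (by rintro (i | i) -; exacts [hT i, hP i])
    (by rintro (i | i) -; exacts [hTne i, hPne i])
    (by
      rintro (i | i) - (j | j) - hij
      · exact hTd i j (fun h => hij (by rw [h]))
      · exact hTP i j
      · exact (hTP j i).symm
      · exact hPd i j (fun h => hij (by rw [h])))
    (by
      rintro x - y - hxy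
      rw [hq, hat] at hxy
      rcases hxy with ⟨j, a, rfl, rfl, u, hu, v, hv, huv⟩ | ⟨j, a, rfl, rfl, u, hu, v, hv, huv⟩
      · exact ⟨u, hu, v, hv, huv⟩
      · exact ⟨v, hv, u, hu, hr huv⟩)
  -- at most one branch set consists only of sets `T j`
  have hbadT : ∀ i, (∀ a, Sum.inr a ∉ B i) → ∃ j, B i = {Sum.inl j} := by
    intro i hi
    obtain ⟨x, hx⟩ := hB.nonempty i
    rcases x with j | a
    · refine ⟨j, Set.eq_singleton_iff_unique_mem.2 ⟨hx, ?_⟩⟩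
      refine (hB.conn i).induct (P := fun y => y = Sum.inl j) hx rfl ?_
      rintro a ha b hb hab rfl
      rw [hq] at hab
      rcases hab with ⟨j', a', h1, h2, _⟩ | ⟨j', a', h1, h2, _⟩
      · exact absurd hb (h2 ▸ hi a')
      · simp at h2
    · exact absurd hx (hi a)
  have hbad2 : ∀ i i', i ≠ i' → (∀ a, Sum.inr a ∉ B i) → (∀ a, Sum.inr a ∉ B i') → False := by
    intro i i' hii hi hi'
    obtain ⟨x, hx, y, hy, hxy⟩ := hB.adj i i' hii
    rw [hq] at hxy
    rcases hxy with ⟨j', a', h1, h2, _⟩ | ⟨j', a', h1, h2, _⟩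
    · exact hi' a' (h2 ▸ hy)
    · exact hi a' (h2 ▸ hx)
  obtain ⟨g, hg, hgood⟩ : ∃ g : Fin s → Fin (s + 1), Function.Injective g ∧
      ∀ i, ∃ a, Sum.inr a ∈ B (g i) := by
    by_cases hb : ∃ i, ∀ a, Sum.inr a ∉ B i
    · obtain ⟨i₀, hi₀⟩ := hb
      refine ⟨i₀.succAbove, Fin.succAbove_right_injective, fun i => ?_⟩
      by_contra hcon
      push Not at hcon
      exact hbad2 _ _ (Fin.succAbove_ne i₀ i) hcon hi₀
    · push Not at hb
      exact ⟨Fin.castSucc, Fin.castSucc_injective s, fun i => hb _⟩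
  refine ⟨_, hlift.comp g hg, fun i => ?_⟩
  obtain ⟨a, ha⟩ := hgood i
  exact ⟨a, fun x hx => Set.mem_biUnion ha hx⟩

end Hubs
end OddMinor

namespace OddMinor
open scoped Classical
open Relation

section HubCore

/-- No separation of order at most `k` splits `S` into two parts that are both large compared to
its order. -/
def Unsplit {V : Type*} (r : V → V → Prop) (S : Finset V) (k f : ℕ) : Prop :=
  ∀ (X : Finset V) (A : Set V), X.card ≤ k → (∀ a ∈ A, a ∉ X) →
    (∀ a ∈ A, ∀ b, r a b → b ∉ X → b ∈ A) →
    (∀ F ⊆ S, (∀ v ∈ F, v ∈ A) → F.card ≤ f * X.card) ∨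
      ∀ F ⊆ S, (∀ v ∈ F, v ∉ A ∧ v ∉ X) → F.card ≤ f * X.card

/-- Two disjoint relations joined along the attachment map `p`. -/
def sumRel {U ι : Type*} (r : U → U → Prop) (q : ι → ι → Prop) (p : ι → U) :
    U ⊕ ι → U ⊕ ι → Prop
  | Sum.inl u, Sum.inl u' => r u u'
  | Sum.inr z, Sum.inr z' => q z z'
  | Sum.inl u, Sum.inr z => p z = u
  | Sum.inr z, Sum.inl u => p z = u

lemma sumRel_symm {U ι : Type*} {r : U → U → Prop} {q : ι → ι → Prop} {p : ι → U}
    (hr : RSymm r) (hq : RSymm q) : RSymm (sumRel r q p) := by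
  rintro (a | a) (b | b) h
  · exact hr h
  · exact h
  · exact h
  · exact hq h

lemma RConn.image {V V' : Type*} {r : V → V → Prop} {r' : V' → V' → Prop} {B : Set V}
    (h : RConn r B) (f : V → V') (hf : ∀ a ∈ B, ∀ b ∈ B, r a b → r' (f a) (f b)) :
    RConn r' (f '' B) := by
  rintro _ ⟨x, hx, rfl⟩ _ ⟨y, hy, rfl⟩
  refine h.induct (P := fun y => ReflTransGen (fun a b => r' a b ∧ b ∈ f '' B) (f x) (f y)) hx
    ReflTransGen.refl ?_ y hy
  intro a ha b hb hab h1
  exact h1.tail ⟨hf a ha b hb hab, b, hb, rfl⟩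

lemma card_filter_le_of_closed {ι : Type*} {q : ι → ι → Prop} {S : Finset ι} {k f : ℕ}
    (hS : Unsplit q S k f) {X Y Y' : Finset ι} {A : Set ι} (hX : X.card ≤ k) (hY : Y ⊆ S)
    (hY' : Y' ⊆ S) (h1 : ∀ y ∈ Y, y ∉ X → y ∈ A) (h2 : ∀ y ∈ Y', y ∉ A) (h3 : ∀ a ∈ A, a ∉ X)
    (h4 : ∀ a ∈ A, ∀ b, q a b → b ∉ X → b ∈ A) :
    Y.card ≤ (f + 1) * X.card ∨ Y'.card ≤ (f + 1) * X.card := by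
  rcases hS X A hX h3 h4 with h | h
  · left
    have h6 := h _ (Finset.filter_subset (fun v => v ∈ A) S)
      fun v hv => (Finset.mem_filter.1 hv).2
    have h5 : Y ⊆ (S.filter fun v => v ∈ A) ∪ X := by
      intro y hy
      by_cases hyX : y ∈ X
      · exact Finset.mem_union_right _ hyX
      · exact Finset.mem_union_left _ (Finset.mem_filter.2 ⟨hY hy, h1 y hy hyX⟩)
    have := (Finset.card_le_card h5).trans (Finset.card_union_le _ _)
    nlinarith
  · right
    have h6 := h _ (Finset.filter_subset (fun v => v ∉ A ∧ v ∉ X) S)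
      fun v hv => (Finset.mem_filter.1 hv).2
    have h5 : Y' ⊆ (S.filter fun v => v ∉ A ∧ v ∉ X) ∪ X := by
      intro y hy
      by_cases hyX : y ∈ X
      · exact Finset.mem_union_right _ hyX
      · exact Finset.mem_union_left _ (Finset.mem_filter.2 ⟨hY' hy, h2 y hy, hyX⟩)
    have := (Finset.card_le_card h5).trans (Finset.card_union_le _ _)
    nlinarith

/-- Cut a connected set of bounded degree into many connected pieces, each attached to many
elements of `S`. -/
lemma exists_chunks_attached {U ι : Type*} [Fintype U] {r : U → U → Prop} (hr : RSymm r)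
    (hU : RConn r Set.univ) (Δ : ℕ) (hdeg : ∀ u, (Finset.univ.filter (r u)).card ≤ Δ) (p : ι → U)
    (S : Finset ι) (hp : ∀ u, (S.filter fun z => p z = u).card ≤ Δ) (q M : ℕ)
    (h : M * (Δ + q * Δ) + q ≤ S.card) :
    ∃ T : Fin M → Finset U, (∀ i, RConn r (T i : Set U)) ∧
      (∀ i j, i ≠ j → Disjoint (T i) (T j)) ∧
      ∀ i, q ≤ (S.filter fun z => p z ∈ T i).card := by
  have hsum : ∀ T : Finset U, ∑ v ∈ T, (S.filter fun z => p z = v).card =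
      (S.filter fun z => p z ∈ T).card := by
    intro T
    rw [Finset.card_eq_sum_card_fiberwise (s := S.filter fun z => p z ∈ T) (f := p) (t := T)
      (fun z hz => (Finset.mem_filter.1 (Finset.mem_coe.1 hz)).2)]
    refine Finset.sum_congr rfl fun v hv => ?_
    congr 1
    ext z
    simp only [Finset.mem_filter]
    constructor
    · rintro ⟨h1, rfl⟩; exact ⟨⟨h1, hv⟩, rfl⟩
    · rintro ⟨⟨h1, _⟩, h2⟩; exact ⟨h1, h2⟩
  obtain ⟨T, -, h2, h3, h4⟩ := exists_chunks hr q (Δ + q * Δ) _ Finset.univ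
    (fun v => (S.filter fun z => p z = v).card) M rfl (by rwa [Finset.coe_univ])
    (fun v _ => Nat.add_le_add (hp v) (Nat.mul_le_mul_left _ (hdeg v)))
    (by rw [hsum]; simpa using h)
  refine ⟨T, h2, h3, fun i => ?_⟩
  rw [← hsum]
  exact h4 i

/-- Hubs that are pairwise joined by disjoint connected sets form a model of a complete graph. -/
lemma exists_model_of_hubs {U ι : Type*} {r : U → U → Prop} (hr : RSymm r) {q : ι → ι → Prop}
    (hq : RSymm q) (p : ι → U) (S : Finset ι) (s : ℕ) (T : Fin (s + 1) → Finset U)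
    (hT : ∀ i, RConn r (T i : Set U)) (hTd : ∀ i j, i ≠ j → Disjoint (T i) (T j))
    (Q : {e : Fin (s + 1) × Fin (s + 1) // e.1 < e.2} → Set ι) (hQ : ∀ e, RConn q (Q e))
    (hQd : ∀ e e', e ≠ e' → Disjoint (Q e) (Q e'))
    (hQ1 : ∀ e, ∃ z ∈ Q e, z ∈ S ∧ p z ∈ T e.1.1) (hQ2 : ∀ e, ∃ z ∈ Q e, p z ∈ T e.1.2) :
    ∃ B : Fin s → Set (U ⊕ ι), CliqueModel (sumRel r q p) s B ∧
      ∀ i, ∃ z ∈ S, Sum.inr z ∈ B i := by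
  have hsymm := sumRel_symm (p := p) hr hq
  obtain ⟨B, hB⟩ : ∃ B : Fin s → Set (U ⊕ ι), B = fun i => Sum.inl '' (T i.castSucc : Set U) ∪
    ⋃ j : {j : Fin (s + 1) // i.castSucc < j}, Sum.inr '' (Q ⟨(i.castSucc, j.1), j.2⟩) :=
    ⟨_, rfl⟩
  have hBinl : ∀ i u, Sum.inl u ∈ B i ↔ u ∈ T i.castSucc := by
    intro i u; rw [hB]; simp
  have hBinr : ∀ i z, Sum.inr z ∈ B i ↔
      ∃ j : {j : Fin (s + 1) // i.castSucc < j}, z ∈ Q ⟨(i.castSucc, j.1), j.2⟩ := by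
    intro i z; rw [hB]; simp
  have hmeet : ∀ i, ∃ z ∈ S, Sum.inr z ∈ B i := by
    intro i
    obtain ⟨z, hz, hzS, hzT⟩ := hQ1 ⟨(i.castSucc, Fin.last s), Fin.castSucc_lt_last i⟩
    exact ⟨z, hzS, (hBinr i z).2 ⟨⟨Fin.last s, Fin.castSucc_lt_last i⟩, hz⟩⟩
  refine ⟨B, ⟨fun i => ?_, fun i => ?_, fun i j hij => ?_, ?_⟩, hmeet⟩
  · obtain ⟨z, _, hz⟩ := hmeet i
    exact ⟨_, hz⟩
  · rw [hB]
    refine RConn.union_iUnion hsymm ((hT _).image _ fun _ _ _ _ h => h)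
      (fun j => (hQ _).image _ fun _ _ _ _ h => h) ?_ ?_
    · rintro ⟨j, hj⟩
      obtain ⟨z, hz, -, hzT⟩ := hQ1 ⟨(i.castSucc, j), hj⟩
      exact ⟨Sum.inl (p z), ⟨_, hzT, rfl⟩, Sum.inr z, ⟨z, hz, rfl⟩, Or.inr rfl⟩
    · obtain ⟨z, hz, -, hzT⟩ := hQ1 ⟨(i.castSucc, Fin.last s), Fin.castSucc_lt_last i⟩
      exact ⟨_, _, hzT, rfl⟩
  · rw [Set.disjoint_left]
    rintro (u | z) h1 h2
    · rw [hBinl] at h1 h2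
      exact Finset.disjoint_left.1
        (hTd i.castSucc j.castSucc fun e => hij (Fin.castSucc_injective s e)) h1 h2
    · rw [hBinr] at h1 h2
      obtain ⟨a, ha⟩ := h1
      obtain ⟨b, hb⟩ := h2
      refine Set.disjoint_left.1 (hQd _ _ ?_) ha hb
      intro e
      have := congrArg (fun e => e.1.1) e
      exact hij (Fin.castSucc_injective s this)
  · have key : ∀ i j : Fin s, i < j → ∃ x ∈ B i, ∃ y ∈ B j, sumRel r q p x y := by
      intro i j hij
      have hij' : i.castSucc < j.castSucc := by simpa using hij
      obtain ⟨z, hz, hzT⟩ := hQ2 ⟨(i.castSucc, j.castSucc), hij'⟩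
      exact ⟨Sum.inr z, (hBinr i z).2 ⟨⟨_, hij'⟩, hz⟩, Sum.inl (p z), (hBinl j _).2 hzT, rfl⟩
    intro i j hij
    rcases lt_or_gt_of_ne hij with h | h
    · exact key i j h
    · obtain ⟨x, hx, y, hy, hxy⟩ := key j i h
      exact ⟨y, hy, x, hx, hsymm hxy⟩

/-- Two linkages that cross often give a model of a complete graph. -/
lemma exists_model_of_crossings {U ι : Type*} [Fintype U] {r : U → U → Prop}
    (hr : RSymm r) (hU : RConn r Set.univ) (Δ : ℕ)
    (hdeg : ∀ u, (Finset.univ.filter (r u)).card ≤ Δ) {q : ι → ι → Prop} (hq : RSymm q)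
    (p : ι → U) (hp : ∀ u (S : Finset ι), (S.filter fun z => p z = u).card ≤ Δ) (S : Finset ι)
    (s k d D : ℕ) (hk : 0 < k) (hd : d = 2 ^ (s + 2)) (hD : D = 2 * (Δ + d ^ 2 * Δ) + d ^ 2)
    (P P' : Fin k → Set ι) (hP : ∀ i, RConn q (P i)) (hP' : ∀ i, RConn q (P' i))
    (hPd : ∀ i j, i ≠ j → Disjoint (P i) (P j)) (hPd' : ∀ i j, i ≠ j → Disjoint (P' i) (P' j))
    (hPS : ∀ i, ∃ z ∈ P i, z ∈ S) (hPS' : ∀ i, ∃ z ∈ P' i, z ∈ S)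
    (hcr : D * k ≤ ((Finset.univ : Finset (Fin k × Fin k)).filter fun x =>
      ¬ Disjoint (P x.1) (P' x.2)).card) :
    ∃ B : Fin s → Set (U ⊕ ι), CliqueModel (sumRel r q p) s B ∧
      ∀ i, ∃ z ∈ S, Sum.inr z ∈ B i := by
  have hsymm := sumRel_symm (p := p) hr hq
  obtain ⟨E, hE⟩ : ∃ E : Finset (Fin k × Fin k), E = Finset.univ.filter fun x =>
      ¬ Disjoint (P x.1) (P' x.2) := ⟨_, rfl⟩
  rw [← hE] at hcr
  have hEz : ∀ x : E, ∃ z, z ∈ P x.1.1 ∧ z ∈ P' x.1.2 := by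
    rintro ⟨x, hx⟩
    rw [hE, Finset.mem_filter] at hx
    exact Set.not_disjoint_iff.1 hx.2
  choose z hz hz' using hEz
  have hPuniq : ∀ i j y, y ∈ P i → y ∈ P j → i = j := fun i j y h1 h2 => by
    by_contra h; exact Set.disjoint_left.1 (hPd i j h) h1 h2
  have hPuniq' : ∀ i j y, y ∈ P' i → y ∈ P' j → i = j := fun i j y h1 h2 => by
    by_contra h; exact Set.disjoint_left.1 (hPd' i j h) h1 h2
  have hzinj : Function.Injective z := by
    intro x y hxy
    have h1 := hPuniq _ _ _ (hz x) (hxy ▸ hz y)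
    have h2 := hPuniq' _ _ _ (hz' x) (hxy ▸ hz' y)
    exact Subtype.ext (Prod.ext h1 h2)
  obtain ⟨M, hM⟩ : ∃ M : Finset ι, M = Finset.univ.image z := ⟨_, rfl⟩
  have hMc : M.card = E.card := by
    rw [hM, Finset.card_image_of_injective _ hzinj, Finset.card_univ, Fintype.card_coe]
  have hdpos : 0 < d := by rw [hd]; positivity
  obtain ⟨T, hT1, hT2, hT3⟩ := exists_chunks_attached hr hU Δ hdeg p M (fun u => hp u M)
    (d ^ 2) (2 * k) (by
      rw [hMc]
      refine le_trans ?_ hcr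
      rw [hD]
      nlinarith [Nat.zero_le (d ^ 2)])
  obtain ⟨sees, hsees⟩ : ∃ sees : (Fin k → Set ι) → Fin (2 * k) → Fin k → Prop,
    sees = fun P i a => ∃ y ∈ P a, p y ∈ T i := ⟨_, rfl⟩
  have hmany : ∀ i, d ≤ (Finset.univ.filter (sees P i)).card ∨
      d ≤ (Finset.univ.filter (sees P' i)).card := by
    intro i
    by_contra hcon
    push Not at hcon
    have h1 : (M.filter fun z => p z ∈ T i).card ≤
        ((Finset.univ.filter (sees P i)) ×ˢ (Finset.univ.filter (sees P' i))).card := by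
      refine (Finset.card_le_card (t := ((Finset.univ : Finset E).filter
        fun x => p (z x) ∈ T i).image z) ?_).trans (Finset.card_image_le.trans ?_)
      · intro y hy
        rw [Finset.mem_filter, hM] at hy
        obtain ⟨hy1, hy2⟩ := hy
        obtain ⟨x, _, rfl⟩ := Finset.mem_image.1 hy1
        exact Finset.mem_image_of_mem _ (Finset.mem_filter.2 ⟨Finset.mem_univ _, hy2⟩)
      · refine Finset.card_le_card_of_injOn Subtype.val ?_ (Subtype.val_injective.injOn)
        intro x hx
        have hx2 := (Finset.mem_filter.1 (Finset.mem_coe.1 hx)).2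
        rw [Finset.mem_coe, Finset.mem_product, Finset.mem_filter, Finset.mem_filter, hsees]
        exact ⟨⟨Finset.mem_univ _, _, hz x, hx2⟩, ⟨Finset.mem_univ _, _, hz' x, hx2⟩⟩
    have h2 := (hT3 i).trans h1
    rw [Finset.card_product] at h2
    nlinarith [hcon.1, hcon.2]
  have main : ∀ P : Fin k → Set ι, (∀ i, RConn q (P i)) →
      (∀ i j, i ≠ j → Disjoint (P i) (P j)) → (∀ i, ∃ z ∈ P i, z ∈ S) →
      k ≤ (Finset.univ.filter fun i => d ≤ (Finset.univ.filter (sees P i)).card).card →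
      ∃ B : Fin s → Set (U ⊕ ι), CliqueModel (sumRel r q p) s B ∧
        ∀ i, ∃ z ∈ S, Sum.inr z ∈ B i := by
    intro P hP hPd hPS hcard
    obtain ⟨J, hJ, hJc⟩ := Finset.exists_subset_card_eq hcard
    obtain ⟨B, hB, hBP⟩ := exists_model_of_attached hsymm s (2 * k) k hk
      (fun i => Sum.inl '' (T i : Set U)) (fun a => Sum.inr '' P a)
      (fun i => (hT1 i).image _ fun _ _ _ _ h => h) (fun i => by
        have h1 : 0 < (M.filter fun z => p z ∈ T i).card :=
          lt_of_lt_of_le (by positivity) (hT3 i)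
        obtain ⟨y, hy⟩ := Finset.card_pos.1 h1
        exact ⟨_, _, (Finset.mem_filter.1 hy).2, rfl⟩)
      (fun i j hij => by
        rw [Set.disjoint_left]
        rintro _ ⟨x, hx, rfl⟩ ⟨y, hy, hxy⟩
        rw [Sum.inl_injective hxy] at hy
        exact Finset.disjoint_left.1 (hT2 i j hij) hx hy)
      (fun a => (hP a).image _ fun _ _ _ _ h => h)
      (fun a => by
        obtain ⟨y, hy, _⟩ := hPS a
        exact ⟨_, y, hy, rfl⟩)
      (fun i j hij => by
        rw [Set.disjoint_left]
        rintro _ ⟨x, hx, rfl⟩ ⟨y, hy, hxy⟩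
        rw [Sum.inr_injective hxy] at hy
        exact Set.disjoint_left.1 (hPd i j hij) hx hy)
      (fun i j => by
        rw [Set.disjoint_left]
        rintro _ ⟨x, hx, rfl⟩ ⟨y, hy, hxy⟩
        simp at hxy)
      J hJc (fun j hj => by
        have h1 := (Finset.mem_filter.1 (hJ hj)).2
        rw [hd] at h1
        refine h1.trans (Finset.card_le_card ?_)
        intro a ha
        rw [Finset.mem_filter, hsees] at ha
        obtain ⟨_, y, hy, hyT⟩ := ha
        exact Finset.mem_filter.2 ⟨Finset.mem_univ _, Sum.inl (p y), ⟨_, hyT, rfl⟩, Sum.inr y,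
          ⟨y, hy, rfl⟩, rfl⟩)
    refine ⟨B, hB, fun i => ?_⟩
    obtain ⟨a, ha⟩ := hBP i
    obtain ⟨y, hy, hyS⟩ := hPS a
    exact ⟨y, hyS, ha ⟨y, hy, rfl⟩⟩
  by_cases hc : k ≤ (Finset.univ.filter fun i => d ≤ (Finset.univ.filter (sees P i)).card).card
  · exact main P hP hPd hPS hc
  · refine main P' hP' hPd' hPS' ?_
    have h1 : (Finset.univ : Finset (Fin (2 * k))) ⊆
        (Finset.univ.filter fun i => d ≤ (Finset.univ.filter (sees P i)).card) ∪
        (Finset.univ.filter fun i => d ≤ (Finset.univ.filter (sees P' i)).card) := by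
      intro i _
      rcases hmany i with h | h
      · exact Finset.mem_union_left _ (Finset.mem_filter.2 ⟨Finset.mem_univ _, h⟩)
      · exact Finset.mem_union_right _ (Finset.mem_filter.2 ⟨Finset.mem_univ _, h⟩)
    have h2 := (Finset.card_le_card h1).trans (Finset.card_union_le _ _)
    rw [Finset.card_univ, Fintype.card_fin] at h2
    omega

/-- A large unsplittable set attached to a connected set of bounded degree yields a model of a
complete graph all of whose branch sets meet it. -/
theorem exists_model_of_unsplit (s Δ f : ℕ) : ∃ k θ : ℕ, ∀ {U ι : Type*} [Fintype U] [Fintype ι]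
    (r : U → U → Prop) (q : ι → ι → Prop) (p : ι → U) (S : Finset ι), RSymm r → RSymm q →
    RConn r Set.univ → (∀ u, (Finset.univ.filter (r u)).card ≤ Δ) →
    (∀ u (S : Finset ι), (S.filter fun z => p z = u).card ≤ Δ) → Unsplit q S k f → θ ≤ S.card →
    ∃ B : Fin s → Set (U ⊕ ι), CliqueModel (sumRel r q p) s B ∧
      ∀ i, ∃ z ∈ S, Sum.inr z ∈ B i := by
  obtain ⟨d, hd⟩ : ∃ d, d = 2 ^ (s + 2) := ⟨_, rfl⟩
  obtain ⟨D, hD⟩ : ∃ D, D = 2 * (Δ + d ^ 2 * Δ) + d ^ 2 := ⟨_, rfl⟩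
  obtain ⟨k, hk⟩ : ∃ k, k = Fintype.card {e : Fin (s + 1) × Fin (s + 1) // e.1 < e.2} ^ 2 * D + 1 :=
    ⟨_, rfl⟩
  obtain ⟨m, hm⟩ : ∃ m, m = (f + 1) * (2 * k) + 1 := ⟨_, rfl⟩
  refine ⟨2 * k, (s + 1) * (Δ + m * Δ) + m, ?_⟩
  intro U ι _ _ r q p S hr hq hU hdeg hp hS hθ
  obtain ⟨T, hT1, hT2, hT3⟩ := exists_chunks_attached hr hU Δ hdeg p S (fun u => hp u S) m (s + 1)
    hθ
  have hlink : ∀ e : {e : Fin (s + 1) × Fin (s + 1) // e.1 < e.2}, ∃ Q : Fin k → Set ι,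
      (∀ i, RConn q (Q i)) ∧ (∀ i j, i ≠ j → Disjoint (Q i) (Q j)) ∧
      (∀ i, ∃ y ∈ Q i, y ∈ {z | z ∈ S ∧ p z ∈ T e.1.1}) ∧
      ∀ i, ∃ y ∈ Q i, y ∈ {z | z ∈ S ∧ p z ∈ T e.1.2} := by
    intro e
    rcases exists_linkage_or_separator hq {z | z ∈ S ∧ p z ∈ T e.1.1} {z | z ∈ S ∧ p z ∈ T e.1.2} k
      with h | ⟨X, A, hX, h1, h2, h3, h4⟩
    · exact h
    · exfalso
      have h5 := card_filter_le_of_closed hS hX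
        (Y := S.filter fun z => p z ∈ T e.1.1) (Y' := S.filter fun z => p z ∈ T e.1.2)
        (Finset.filter_subset _ _) (Finset.filter_subset _ _)
        (fun y hy => h1 y (Finset.mem_filter.1 hy)) (fun y hy => h2 y (Finset.mem_filter.1 hy))
        h3 h4
      have h6 := hT3 e.1.1
      have h7 := hT3 e.1.2
      have h8 := Nat.mul_le_mul_left (f + 1) hX
      omega
  choose Q hQ1 hQ2 hQ3 hQ4 using hlink
  by_cases hcr : ∀ e e', e ≠ e' → ((Finset.univ : Finset (Fin k × Fin k)).filter fun x =>
      ¬ Disjoint (Q e x.1) (Q e' x.2)).card ≤ D * k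
  · obtain ⟨φ, hφ⟩ := exists_transversal k D (fun e e' a b => ¬ Disjoint (Q e a) (Q e' b))
      (fun e e' hee => by convert hcr e e' hee)
      (by omega)
    refine exists_model_of_hubs hr hq p S s T hT1 hT2 (fun e => Q e (φ e)) (fun e => hQ1 e _)
      (fun e e' hee => not_not.1 (hφ e e' hee)) (fun e => hQ3 e _) (fun e => ?_)
    obtain ⟨y, hy, hy'⟩ := hQ4 e (φ e)
    exact ⟨y, hy, hy'.2⟩
  · push Not at hcr
    obtain ⟨e, e', -, hcr⟩ := hcr
    refine exists_model_of_crossings hr hU Δ hdeg hq p hp S s k d D (by omega) hd hD (Q e) (Q e')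
      (hQ1 e) (hQ1 e') (hQ2 e) (hQ2 e') (fun i => ?_) (fun i => ?_) hcr.le
    · obtain ⟨y, hy, hy'⟩ := hQ3 e i
      exact ⟨y, hy, hy'.1⟩
    · obtain ⟨y, hy, hy'⟩ := hQ3 e' i
      exact ⟨y, hy, hy'.1⟩

end HubCore
end OddMinor

namespace OddMinor
open scoped Classical
open Relation

section Bands

/-- `ℓ` is a breadth-first layering of `G` from the root `x₀`. -/
structure Layering {V : Type*} (G : SimpleGraph V) (x₀ : V) (ℓ : V → ℕ) : Prop where
  root : ∀ v, ℓ v = 0 → v = x₀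
  parent : ∀ v, ℓ v ≠ 0 → ∃ u, G.Adj v u ∧ ℓ u + 1 = ℓ v
  lip : ∀ u v, G.Adj u v → ℓ v ≤ ℓ u + 1

/-- Every vertex has at most `Δ` neighbours in `r`. -/
def DegLE {V : Type*} [Fintype V] (r : V → V → Prop) (Δ : ℕ) : Prop :=
  ∀ v, (Finset.univ.filter (r v)).card ≤ Δ

/-- The edges of `G` inside `C`. -/
def bandRel {V : Type*} (G : SimpleGraph V) (C : Set V) (a b : V) : Prop :=
  G.Adj a b ∧ a ∈ C ∧ b ∈ C

lemma adj_rsymm {V : Type*} (G : SimpleGraph V) : RSymm G.Adj := fun _ _ h => h.symm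

variable {V : Type*} {G : SimpleGraph V} {x₀ : V} {ℓ : V → ℕ}

lemma Layering.exists_ancestor (h : Layering G x₀ ℓ) (a : ℕ) :
    ∃ anc : V → V, (∀ v, a ≤ ℓ v → ℓ (anc v) = a) ∧ (∀ v, ℓ v = a → anc v = v) ∧
      ∀ v, a < ℓ v → ∃ u, G.Adj v u ∧ ℓ u + 1 = ℓ v ∧ anc u = anc v := by
  have hpar : ∀ v, ∃ u, ℓ v ≠ 0 → G.Adj v u ∧ ℓ u + 1 = ℓ v := by
    intro v
    by_cases hv : ℓ v = 0
    · exact ⟨v, fun h => absurd hv h⟩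
    · obtain ⟨u, hu⟩ := h.parent v hv
      exact ⟨u, fun _ => hu⟩
  choose par hpar using hpar
  have key : ∀ i v, ℓ v = a + i → ℓ (par^[i] v) = a := by
    intro i
    induction i with
    | zero => intro v hv; simpa using hv
    | succ i ih =>
      intro v hv
      rw [Function.iterate_succ_apply]
      have := (hpar v (by omega)).2
      exact ih _ (by omega)
  refine ⟨fun v => par^[ℓ v - a] v, fun v hv => key _ v (by omega), fun v hv => ?_,
    fun v hv => ?_⟩
  · simp [hv]
  · have h1 := hpar v (by omega)
    refine ⟨par v, h1.1, h1.2, ?_⟩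
    have h2 : ℓ v - a = (ℓ (par v) - a) + 1 := by omega
    beta_reduce
    rw [h2, Function.iterate_succ_apply]

lemma card_descendants_le [Fintype V] {Δ : ℕ} (hdeg : DegLE G.Adj Δ) {a : ℕ} {anc : V → V}
    (h0 : ∀ v, ℓ v = a → anc v = v)
    (h1 : ∀ v, a < ℓ v → ∃ u, G.Adj v u ∧ ℓ u + 1 = ℓ v ∧ anc u = anc v) (w : ℕ) (z : V) :
    (Finset.univ.filter fun v => (a ≤ ℓ v ∧ ℓ v < a + w) ∧ anc v = z).card ≤
      w * (Δ + 1) ^ w := by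
  obtain ⟨N, hN⟩ : ∃ N : ℕ → Finset V, N = fun i =>
    Finset.univ.filter fun v => ℓ v = a + i ∧ anc v = z := ⟨_, rfl⟩
  have hNm : ∀ i v, v ∈ N i ↔ ℓ v = a + i ∧ anc v = z := by intro i v; rw [hN]; simp
  have hNc : ∀ i, (N i).card ≤ Δ ^ i := by
    intro i
    induction i with
    | zero =>
      refine Finset.card_le_one.2 fun u hu v hv => ?_
      rw [hNm] at hu hv
      rw [← h0 u hu.1, ← h0 v hv.1, hu.2, hv.2]
    | succ i ih =>
      have h2 : N (i + 1) ⊆ (N i).biUnion fun u => Finset.univ.filter (G.Adj u) := by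
        intro v hv
        rw [hNm] at hv
        obtain ⟨u, hu1, hu2, hu3⟩ := h1 v (by omega)
        refine Finset.mem_biUnion.2 ⟨u, (hNm _ _).2 ⟨by omega, hu3.trans hv.2⟩, ?_⟩
        simpa using hu1.symm
      refine (Finset.card_le_card h2).trans
        ((Finset.card_biUnion_le_card_mul _ _ Δ fun u _ => hdeg u).trans ?_)
      rw [pow_succ]
      exact Nat.mul_le_mul_right _ ih
  have h2 : (Finset.univ.filter fun v => (a ≤ ℓ v ∧ ℓ v < a + w) ∧ anc v = z) ⊆
      (Finset.range w).biUnion N := by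
    intro v hv
    simp only [Finset.mem_filter, Finset.mem_univ, true_and] at hv
    exact Finset.mem_biUnion.2 ⟨ℓ v - a, Finset.mem_range.2 (by omega),
      (hNm _ _).2 ⟨by omega, hv.2⟩⟩
  refine (Finset.card_le_card h2).trans
    ((Finset.card_biUnion_le_card_mul _ _ ((Δ + 1) ^ w) fun i hi => (hNc i).trans ?_).trans ?_)
  · exact (Nat.pow_le_pow_left (Nat.le_succ Δ) i).trans
      (Nat.pow_le_pow_right (Nat.succ_pos Δ) (Finset.mem_range.1 hi).le)
  · rw [Finset.card_range]

lemma Layering.rconn_below (h : Layering G x₀ ℓ) (a : ℕ) :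
    RConn G.Adj {v | ℓ v < a} := by
  by_cases hne : ∃ v, ℓ v < a
  swap
  · intro x hx
    exact absurd ⟨x, hx⟩ hne
  have hreach : ∀ n v, ℓ v = n → n < a →
      ReflTransGen (fun u b => G.Adj u b ∧ b ∈ {v | ℓ v < a}) x₀ v := by
    intro n
    induction n with
    | zero =>
      intro v hv _
      rw [h.root v hv]
    | succ n ih =>
      intro v hv hn
      obtain ⟨u, hu, hu'⟩ := h.parent v (by omega)
      exact (ih u (by omega) (by omega)).tail ⟨hu.symm, show ℓ v < a by omega⟩
  have hx₀ : ∃ v, ℓ v = 0 := by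
    by_contra hcon
    push Not at hcon
    obtain ⟨v, hv⟩ := hne
    have : ∀ n v, ℓ v = n → False := by
      intro n
      induction n with
      | zero => exact fun v hv => hcon v hv
      | succ n ih =>
        intro v hv
        obtain ⟨u, _, hu⟩ := h.parent v (by omega)
        exact ih u (by omega)
    exact this _ v rfl
  obtain ⟨v, hv⟩ := hx₀
  have hva := h.root v hv
  subst hva
  refine rconn_of_root (adj_rsymm G) (x := v) ?_ fun y hy => hreach _ y rfl hy
  obtain ⟨u, hu⟩ := hne
  show ℓ v < a
  omega

/-- A large unsplittable subset of a band of layers yields a model of a complete graph all of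
whose branch sets meet it. -/
theorem exists_model_of_unsplit_band (s Δ f w : ℕ) : ∃ k θ : ℕ, ∀ {V : Type*} [Fintype V]
    {G : SimpleGraph V} {x₀ : V} {ℓ : V → ℕ} (_ : Layering G x₀ ℓ) (_ : DegLE G.Adj Δ) (a : ℕ)
    (C : Set V) (_ : C = {v | a ≤ ℓ v ∧ ℓ v < a + w}) (S : Finset V), (∀ v ∈ S, v ∈ C) →
    Unsplit (bandRel G C) S k f → θ ≤ S.card →
    ∃ B : Fin s → Set V, CliqueModel G.Adj s B ∧ ∀ i, ∃ z ∈ S, z ∈ B i := by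
  obtain ⟨m, hm⟩ : ∃ m, m = w * (Δ + 1) ^ w + 1 := ⟨_, rfl⟩
  obtain ⟨k, θ, hcore⟩ := exists_model_of_unsplit s Δ (f * m)
  refine ⟨k * m, (θ + 1) * m, ?_⟩
  intro V _ G x₀ ℓ hℓ hdeg a C hC S hSC hS hθ
  obtain ⟨anc, hanc1, hanc2, hanc3⟩ := hℓ.exists_ancestor a
  have hcard := card_descendants_le hdeg hanc2 hanc3 w
  have hmpos : 0 < m := by omega
  rcases Nat.eq_zero_or_pos a with ha | ha
  · exfalso
    have h1 : S ⊆ Finset.univ.filter fun v => (a ≤ ℓ v ∧ ℓ v < a + w) ∧ anc v = x₀ := by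
      intro v hv
      have h2 := hSC v hv
      rw [hC] at h2
      refine Finset.mem_filter.2 ⟨Finset.mem_univ _, h2, hℓ.root _ ?_⟩
      rw [hanc1 v h2.1, ha]
    have h2 := (Finset.card_le_card h1).trans (hcard x₀)
    nlinarith
  obtain ⟨cell, hcell⟩ : ∃ cell : {z // ℓ z = a} → Finset V, cell = fun z =>
    Finset.univ.filter fun v => (a ≤ ℓ v ∧ ℓ v < a + w) ∧ anc v = z.1 := ⟨_, rfl⟩
  have hcm : ∀ z v, v ∈ cell z ↔ v ∈ C ∧ anc v = z.1 := by
    intro z v; rw [hcell, hC]; simp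
  have hcc : ∀ z, (cell z).card ≤ m := by
    intro z; rw [hcell]; exact (hcard z.1).trans (by omega)
  obtain ⟨π, hπ⟩ : ∃ π : {v // v ∈ C} → {z // ℓ z = a}, ∀ v, v.1 ∈ cell (π v) := by
    have hmem : ∀ v ∈ C, a ≤ ℓ v := fun v hv => by rw [hC] at hv; exact hv.1
    exact ⟨fun v => ⟨anc v.1, hanc1 _ (hmem _ v.2)⟩, fun v => (hcm _ _).2 ⟨v.2, rfl⟩⟩
  have hcell_eq : ∀ z z' v, v ∈ cell z → v ∈ cell z' → z = z' := by
    intro z z' v h1 h2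
    rw [hcm] at h1 h2
    exact Subtype.ext (h1.2.symm.trans h2.2)
  rcases Nat.eq_zero_or_pos w with hw | hw
  · exfalso
    have : S = ∅ := by
      rw [Finset.eq_empty_iff_forall_notMem]
      intro v hv
      have := hSC v hv
      rw [hC] at this
      have h2 := this.1
      have h3 := this.2
      omega
    rw [this, Finset.card_empty] at hθ
    nlinarith
  have hself : ∀ z, z.1 ∈ cell z := by
    intro z
    rw [hcm, hC]
    exact ⟨⟨z.2.ge, by rw [z.2]; omega⟩, hanc2 _ z.2⟩
  have hconn : ∀ z, RConn G.Adj (cell z : Set V) := by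
    intro z
    have hreach : ∀ n v, v ∈ cell z → ℓ v = a + n →
        ReflTransGen (fun u b => G.Adj u b ∧ b ∈ (cell z : Set V)) z.1 v := by
      intro n
      induction n with
      | zero =>
        intro v hv hn
        have h1 := ((hcm z v).1 hv).2
        rw [hanc2 v hn] at h1
        rw [h1]
      | succ n ih =>
        intro v hv hn
        obtain ⟨u, hu1, hu2, hu3⟩ := hanc3 v (by omega)
        have h1 := (hcm z v).1 hv
        have h2 := h1.1
        rw [hC] at h2
        have h3 : u ∈ cell z := by
          rw [hcm, hC]
          exact ⟨⟨by omega, by have := h2.2; omega⟩, hu3.trans h1.2⟩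
        exact (ih u h3 (by omega)).tail ⟨hu1.symm, hv⟩
    refine rconn_of_root (adj_rsymm G) (hself z) fun v hv => ?_
    have h2 := ((hcm z v).1 hv).1
    rw [hC] at h2
    exact hreach (ℓ v - a) v hv (by have := h2.1; omega)
  have hp : ∀ z : {z // ℓ z = a}, ∃ u : {u // ℓ u < a}, G.Adj z.1 u.1 := by
    intro z
    obtain ⟨u, hu, hu'⟩ := hℓ.parent z.1 (by rw [z.2]; omega)
    exact ⟨⟨u, by have := z.2; omega⟩, hu⟩
  choose p hp using hp
  obtain ⟨q, hq⟩ : ∃ q : {z // ℓ z = a} → {z // ℓ z = a} → Prop,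
    q = fun z z' => ∃ x ∈ cell z, ∃ y ∈ cell z', G.Adj x y := ⟨_, rfl⟩
  have hqs : RSymm q := by
    subst hq
    rintro z z' ⟨x, hx, y, hy, hxy⟩
    exact ⟨y, hy, x, hx, hxy.symm⟩
  obtain ⟨S', hS'⟩ : ∃ S' : Finset {z // ℓ z = a},
    S' = Finset.univ.filter fun z => ∃ v ∈ S, v ∈ cell z := ⟨_, rfl⟩
  have hS'c : S.card ≤ m * S'.card := by
    have h1 : S ⊆ S'.biUnion cell := by
      intro v hv
      have h2 := hπ ⟨v, hSC v hv⟩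
      refine Finset.mem_biUnion.2 ⟨_, ?_, h2⟩
      rw [hS']
      exact Finset.mem_filter.2 ⟨Finset.mem_univ _, v, hv, h2⟩
    refine (Finset.card_le_card h1).trans
      ((Finset.card_biUnion_le_card_mul _ _ m fun z _ => hcc z).trans ?_)
    rw [mul_comm]
  have hUn : Unsplit q S' k (f * m) := by
    intro X A hX hA1 hA2
    obtain ⟨Y, hY⟩ : ∃ Y : Finset V, Y = X.biUnion cell := ⟨_, rfl⟩
    have hYc : Y.card ≤ X.card * m := by
      rw [hY]; exact Finset.card_biUnion_le_card_mul _ _ m fun z _ => hcc z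
    have hfib : ∀ (F : Finset {z // ℓ z = a}) (F' : Finset V),
        (∀ z ∈ F, ∃ v ∈ F', v ∈ cell z) → F.card ≤ F'.card := by
      intro F F' hF
      choose g hg1 hg2 using hF
      have h1 : (F.attach.image fun z => g z.1 z.2) ⊆ F' := by
        intro v hv
        obtain ⟨z, _, rfl⟩ := Finset.mem_image.1 hv
        exact hg1 _ _
      have h2 := Finset.card_le_card h1
      rw [Finset.card_image_of_injective, Finset.card_attach] at h2
      · exact h2
      · intro z z' hzz
        have h3 := hg2 z.1 z.2
        beta_reduce at hzz
        rw [hzz] at h3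
        exact Subtype.ext (hcell_eq _ _ _ h3 (hg2 z'.1 z'.2))
    have hYX : ∀ z v, v ∈ cell z → (v ∈ Y ↔ z ∈ X) := by
      intro z v hv
      rw [hY, Finset.mem_biUnion]
      exact ⟨fun ⟨z', hz', h⟩ => hcell_eq _ _ _ h hv ▸ hz', fun h => ⟨z, h, hv⟩⟩
    have key := hS Y {v | ∃ z ∈ A, v ∈ cell z} (hYc.trans (Nat.mul_le_mul_right _ hX)) ?_ ?_
    · have hle : f * Y.card ≤ f * m * X.card := by
        have := Nat.mul_le_mul_left f hYc
        nlinarith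
      have hpick : ∀ F ⊆ S', ∃ F' ⊆ S, F.card ≤ F'.card ∧ ∀ v ∈ F', ∃ z ∈ F, v ∈ cell z := by
        intro F hF
        refine ⟨S.filter fun v => ∃ z ∈ F, v ∈ cell z, Finset.filter_subset _ _,
          hfib _ _ fun z hz => ?_, fun v hv => (Finset.mem_filter.1 hv).2⟩
        have h1 := hF hz
        rw [hS', Finset.mem_filter] at h1
        obtain ⟨_, v, hv, hvz⟩ := h1
        exact ⟨v, Finset.mem_filter.2 ⟨hv, z, hz, hvz⟩, hvz⟩
      rcases key with h | h
      · left
        intro F hF hFA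
        obtain ⟨F', hF', hle', hmem⟩ := hpick F hF
        refine hle'.trans ((h F' hF' fun v hv => ?_).trans hle)
        obtain ⟨z, hz, hvz⟩ := hmem v hv
        exact ⟨z, hFA z hz, hvz⟩
      · right
        intro F hF hFA
        obtain ⟨F', hF', hle', hmem⟩ := hpick F hF
        refine hle'.trans ((h F' hF' fun v hv => ?_).trans hle)
        obtain ⟨z, hz, hvz⟩ := hmem v hv
        refine ⟨?_, ?_⟩
        · rintro ⟨z', hz', hvz'⟩
          exact (hFA z hz).1 (hcell_eq _ _ _ hvz' hvz ▸ hz')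
        · rw [hYX z v hvz]; exact (hFA z hz).2
    · rintro v ⟨z, hz, hv⟩
      rw [hYX z v hv]
      exact hA1 z hz
    · rintro v ⟨z, hz, hv⟩ u ⟨huv, _, huC⟩ huY
      have h1 := hπ ⟨u, huC⟩
      refine ⟨_, hA2 z hz _ ?_ ?_, h1⟩
      · rw [hq]; exact ⟨v, hv, u, h1, huv⟩
      · rw [← hYX _ _ h1]; exact huY
  have hU1 : RConn (fun u v : {u // ℓ u < a} => G.Adj u.1 v.1) Set.univ := by
    have h1 := hℓ.rconn_below a
    rintro x - y -
    refine h1.induct (P := fun v => ∀ hv : ℓ v < a, ReflTransGen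
      (fun u v : {u // ℓ u < a} => G.Adj u.1 v.1 ∧ v ∈ Set.univ) x ⟨v, hv⟩)
      (x := x.1) x.2 (fun _ => ReflTransGen.refl) ?_ y.1 y.2 y.2
    intro u hu v hv huv ih hv'
    exact (ih hu).tail ⟨huv, trivial⟩
  have hU2 : ∀ u : {u // ℓ u < a},
      (Finset.univ.filter fun v : {u // ℓ u < a} => G.Adj u.1 v.1).card ≤ Δ := by
    intro u
    rw [← Finset.card_map (Function.Embedding.subtype _)]
    refine (Finset.card_le_card ?_).trans (hdeg u.1)
    intro v hv
    obtain ⟨v', hv', rfl⟩ := Finset.mem_map.1 hv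
    exact Finset.mem_filter.2 ⟨Finset.mem_univ _, (Finset.mem_filter.1 hv').2⟩
  have hU3 : ∀ (u : {u // ℓ u < a}) (S : Finset {z // ℓ z = a}),
      (S.filter fun z => p z = u).card ≤ Δ := by
    intro u S₀
    rw [← Finset.card_map (Function.Embedding.subtype _)]
    refine (Finset.card_le_card ?_).trans (hdeg u.1)
    intro v hv
    obtain ⟨v', hv', rfl⟩ := Finset.mem_map.1 hv
    have h1 := (Finset.mem_filter.1 hv').2
    exact Finset.mem_filter.2 ⟨Finset.mem_univ _, h1 ▸ (hp v').symm⟩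
  have hU4 : θ ≤ S'.card := by
    by_contra hcon
    push Not at hcon
    nlinarith
  obtain ⟨B, hB, hBS⟩ := hcore (fun u v : {u // ℓ u < a} => G.Adj u.1 v.1) q p S'
    (fun _ _ h => h.symm) hqs hU1 hU2 (fun u S => by convert hU3 u S) hUn hU4
  have hlift := hB.lift (r := G.Adj) (adj_rsymm G) (Z := Set.univ) (fun _ => Set.subset_univ _)
    (D := Sum.elim (fun u => {u.1}) fun z => (cell z : Set V))
    (by rintro (u | z) -; exacts [rconn_singleton _ _, hconn z])
    (by rintro (u | z) -; exacts [Set.singleton_nonempty _, ⟨z.1, hself z⟩])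
    (by
      have hlow : ∀ (u : {u // ℓ u < a}) z, u.1 ∉ cell z := by
        intro u z h
        have h2 := ((hcm z _).1 h).1
        rw [hC] at h2
        have h3 := h2.1
        have h4 := u.2
        omega
      rintro (i | i) - (j | j) - hij <;> rw [Set.disjoint_left]
      · rintro x hx hy
        have hx : x = i.1 := hx
        have hy : x = j.1 := hy
        exact hij (by rw [Subtype.ext (hx.symm.trans hy)])
      · rintro x hx hy
        have hx : x = i.1 := hx
        exact hlow i j (hx ▸ hy)
      · rintro x hx hy
        have hy : x = j.1 := hy
        exact hlow j i (hy ▸ hx)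
      · exact fun x hx hy => hij (by rw [hcell_eq _ _ x hx hy]))
    (by
      rintro (i | i) - (j | j) - hij
      · exact ⟨i.1, rfl, j.1, rfl, hij⟩
      · have hij : p j = i := hij
        exact ⟨i.1, rfl, j.1, hself j, hij ▸ (hp j).symm⟩
      · have hij : p i = j := hij
        exact ⟨i.1, hself i, j.1, rfl, hij ▸ hp i⟩
      · have hij : q i j := hij
        rw [hq] at hij
        exact hij)
  refine ⟨_, hlift, fun i => ?_⟩
  obtain ⟨z, hz, hzB⟩ := hBS i
  rw [hS', Finset.mem_filter] at hz
  obtain ⟨_, v, hv, hvz⟩ := hz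
  exact ⟨v, hv, Set.mem_biUnion hzB hvz⟩

end Bands
end OddMinor

namespace OddMinor
open scoped Classical
open Relation

section OddCliques

variable {V : Type*} {G : SimpleGraph V}

/-- The bichromatic edges of `G`. -/
def bich (G : SimpleGraph V) (col : V → Bool) (a b : V) : Prop := G.Adj a b ∧ col a ≠ col b

lemma bich_rsymm (G : SimpleGraph V) (col : V → Bool) : RSymm (bich G col) :=
  fun _ _ h => ⟨h.1.symm, h.2.symm⟩

/-- `G` contains an odd model of the complete graph on `t` vertices. -/
def HasOddClique (G : SimpleGraph V) (t : ℕ) : Prop :=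
  ∃ (B : Fin t → Set V) (col : V → Bool), (∀ i, (B i).Nonempty) ∧
    (∀ i, RConn (bich G col) (B i)) ∧ (∀ i j, i ≠ j → Disjoint (B i) (B j)) ∧
    ∀ i j, i ≠ j → ∃ x ∈ B i, ∃ y ∈ B j, G.Adj x y ∧ col x = col y

/-- A connected set has a colouring for which it is connected by bichromatic edges. -/
lemma exists_bich_coloring [Finite V] {B : Set V} (hB : RConn G.Adj B) :
    ∃ col : V → Bool, RConn (bich G col) B := by
  rcases B.eq_empty_or_nonempty with rfl | ⟨x, hx⟩
  · exact ⟨fun _ => true, rconn_empty _⟩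
  have key : ∀ n, n < B.ncard → ∃ (A : Set V) (col : V → Bool), A ⊆ B ∧ x ∈ A ∧
      A.ncard = n + 1 ∧ RConn (bich G col) A := by
    intro n
    induction n with
    | zero =>
      intro _
      exact ⟨{x}, fun _ => true, by simpa using hx, rfl, by simp, rconn_singleton _ _⟩
    | succ n ih =>
      intro hn
      obtain ⟨A, col, hAB, hxA, hA, hconn⟩ := ih (by omega)
      obtain ⟨y, hyB, hyA⟩ : ∃ y ∈ B, y ∉ A := by
        by_contra hcon
        push Not at hcon
        have : B = A := subset_antisymm hcon hAB
        rw [this] at hn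
        omega
      obtain ⟨a, haB, b, hbB, hab, haA, hbA⟩ := hB.exists_cross hx hxA hyB hyA
      refine ⟨A ∪ {b}, Function.update col b (!col a), Set.union_subset hAB (by simpa using hbB),
        Or.inl hxA, ?_, ?_⟩
      · rw [Set.union_singleton, Set.ncard_insert_of_notMem hbA (Set.toFinite _), hA]
      · have hne : ∀ u ∈ A, u ≠ b := fun u hu h => hbA (h ▸ hu)
        refine RConn.union (bich_rsymm G _) (x := a) (y := b) (hconn.mono' ?_)
          (rconn_singleton _ _) haA rfl ⟨hab, ?_⟩
        · intro u hu v hv huv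
          refine ⟨huv.1, ?_⟩
          rw [Function.update_of_ne (hne u hu), Function.update_of_ne (hne v hv)]
          exact huv.2
        · rw [Function.update_of_ne (hne a haA), Function.update_self]
          cases col a <;> simp
  have hpos : 0 < B.ncard := (Set.ncard_pos (Set.toFinite _)).2 ⟨x, hx⟩
  obtain ⟨A, col, hAB, -, hA, hconn⟩ := key (B.ncard - 1) (by omega)
  have : A = B := Set.eq_of_subset_of_ncard_le hAB (by omega) (Set.toFinite _)
  exact ⟨col, this ▸ hconn⟩

/-- A large clique model contains an odd clique model or a large even clique model. -/
theorem exists_even_model (t s : ℕ) : ∃ s₀ : ℕ, ∀ {V : Type*} [Finite V] {G : SimpleGraph V}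
    {B : Fin s₀ → Set V}, CliqueModel G.Adj s₀ B → ¬ HasOddClique G t →
    ∃ (col : V → Bool) (f : Fin s → Fin s₀), Function.Injective f ∧
      CliqueModel (bich G col) s (B ∘ f) := by
  obtain ⟨s₀, hs₀⟩ := exists_ramsey t s
  refine ⟨s₀, fun {V} _ {G} {B} hB hodd => ?_⟩
  choose d hd using fun i => exists_bich_coloring (hB.conn i)
  obtain ⟨col, hcol⟩ : ∃ col : V → Bool, ∀ i, ∀ v ∈ B i, col v = d i v := by
    refine ⟨fun v => if h : ∃ i, v ∈ B i then d h.choose v else true, fun i v hv => ?_⟩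
    have h : ∃ i, v ∈ B i := ⟨i, hv⟩
    have h2 : h.choose = i := by
      by_contra hne
      exact Set.disjoint_left.1 (hB.disj _ _ hne) h.choose_spec hv
    simp only [dif_pos h]
    rw [h2]
  have hconn : ∀ i, RConn (bich G col) (B i) := by
    intro i
    refine (hd i).mono' fun u hu v hv huv => ⟨huv.1, ?_⟩
    rw [hcol i u hu, hcol i v hv]
    exact huv.2
  rcases hs₀ (fun i j => ∃ x ∈ B i, ∃ y ∈ B j, G.Adj x y ∧ col x = col y)
    (fun i j ⟨x, hx, y, hy, h1, h2⟩ => ⟨y, hy, x, hx, h1.symm, h2.symm⟩) Finset.univ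
    (by simp) with ⟨A, -, hA, hA2⟩ | ⟨A, -, hA, hA2⟩
  · exfalso
    apply hodd
    have hinj := (A.orderEmbOfFin hA).injective
    exact ⟨fun i => B (A.orderEmbOfFin hA i), col, fun i => hB.nonempty _, fun i => hconn _,
      fun i j hij => hB.disj _ _ (hinj.ne hij),
      fun i j hij => hA2 _ (A.orderEmbOfFin_mem hA i) _ (A.orderEmbOfFin_mem hA j) (hinj.ne hij)⟩
  · have hinj := (A.orderEmbOfFin hA).injective
    refine ⟨col, A.orderEmbOfFin hA, hinj, fun i => hB.nonempty _, fun i => hconn _,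
      fun i j hij => hB.disj _ _ (hinj.ne hij), fun i j hij => ?_⟩
    obtain ⟨x, hx, y, hy, hxy⟩ := hB.adj _ _ (hinj.ne hij)
    refine ⟨x, hx, y, hy, hxy, fun hc => ?_⟩
    exact hA2 _ (A.orderEmbOfFin_mem hA i) _ (A.orderEmbOfFin_mem hA j) (hinj.ne hij)
      ⟨x, hx, y, hy, hxy, hc⟩

end OddCliques
end OddMinor

namespace OddMinor
open scoped Classical
open Relation

section HeavyPoints

variable {V : Type*} [Finite V] {r : V → V → Prop} {s : ℕ} {B : Fin s → Set V}

/-- Every branch set of a large clique model contains a vertex whose component stays adjacent to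
many branch sets when any other vertex is deleted. -/
lemma CliqueModel.exists_heavy (hr : RSymm r) (hB : CliqueModel r s B) {m : ℕ}
    (hm : 2 * m + 2 ≤ s) (i : Fin s) : ∃ a ∈ B i, ∀ Y : Set V, Y.Subsingleton → a ∉ Y →
      ∃ J : Finset (Fin s), m < J.card ∧
        ∀ j ∈ J, j ≠ i ∧ ∃ x ∈ rcomp r (B i \ Y) a, ∃ z ∈ B j, r x z := by
  obtain ⟨ex, hex⟩ : ∃ ex : Set V → Finset (Fin s),
      ∀ Q j, j ∈ ex Q ↔ j ≠ i ∧ ∃ x ∈ Q, ∃ z ∈ B j, r x z :=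
    ⟨fun Q => Finset.univ.filter fun j => j ≠ i ∧ ∃ x ∈ Q, ∃ z ∈ B j, r x z,
      fun Q j => by simp⟩
  have hall : ∀ Q : Set V, B i ⊆ Q → s ≤ (ex Q).card + 1 := by
    intro Q hQ
    have : (Finset.univ.erase i) ⊆ ex Q := by
      intro j hj
      have hji : j ≠ i := Finset.ne_of_mem_erase hj
      obtain ⟨x, hx, y, hy, hxy⟩ := hB.adj i j hji.symm
      exact (hex Q j).2 ⟨hji, x, hQ hx, y, hy, hxy⟩
    have := Finset.card_le_card this
    rw [Finset.card_erase_of_mem (Finset.mem_univ _), Finset.card_univ, Fintype.card_fin] at this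
    omega
  by_contra hcon
  push Not at hcon
  have hlight : ∀ a ∈ B i, ∃ y ∈ B i, y ≠ a ∧ (ex (rcomp r (B i \ {y}) a)).card ≤ m := by
    intro a ha
    obtain ⟨Y, hY, haY, hJ⟩ := hcon a ha
    have hle : (ex (rcomp r (B i \ Y) a)).card ≤ m := by
      by_contra hlt
      obtain ⟨j, hj, hj'⟩ := hJ _ (not_le.1 hlt)
      obtain ⟨h1, x, hx, z, hz, hxz⟩ := (hex _ _).1 hj
      exact hj' h1 x hx z hz hxz
    by_cases hYB : ∃ y ∈ Y, y ∈ B i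
    · obtain ⟨y, hyY, hyB⟩ := hYB
      have : Y = {y} := hY.eq_singleton_of_mem hyY
      subst this
      exact ⟨y, hyB, fun h => haY h.symm, hle⟩
    · exfalso
      push Not at hYB
      have := hall (rcomp r (B i \ Y) a)
        ((hB.conn i).subset_rcomp (show B i ⊆ B i \ Y from
          fun x hx => ⟨hx, fun hxY => hYB x hxY hx⟩) ha)
      omega
  obtain ⟨a₀, ha₀⟩ := hB.nonempty i
  obtain ⟨y₀, hy₀⟩ := hlight a₀ ha₀
  have hfin : (Set.univ : Set (V × V)).Finite := Set.toFinite _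
  obtain ⟨⟨a, y⟩, ⟨ha, hy, hya, hm1⟩, hmax⟩ := Set.exists_max_image
    {p : V × V | p.1 ∈ B i ∧ p.2 ∈ B i ∧ p.2 ≠ p.1 ∧ (ex (rcomp r (B i \ {p.2}) p.1)).card ≤ m}
    (fun p => (rcomp r (B i \ {p.2}) p.1).ncard) (Set.toFinite _) ⟨(a₀, y₀), ha₀, hy₀⟩
  dsimp only at ha hy hya hm1 hmax
  obtain ⟨y', hy', hyy', hm2⟩ := hlight y hy
  have hmax' := hmax (y, y') ⟨hy, hy', hyy', hm2⟩
  dsimp only at hmax'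
  obtain ⟨Q, hQ⟩ : ∃ Q, Q = rcomp r (B i \ {y}) a := ⟨_, rfl⟩
  obtain ⟨Q', hQ'⟩ : ∃ Q', Q' = rcomp r (B i \ {y'}) y := ⟨_, rfl⟩
  have haS : a ∈ B i \ {y} := ⟨ha, fun h => hya h.symm⟩
  have hQsub : Q ⊆ B i \ {y} := hQ ▸ rcomp_subset haS
  have haQ : a ∈ Q := hQ ▸ mem_rcomp_self a
  have hyQ : y ∉ Q := fun h => (hQsub h).2 rfl
  have hyS : y ∈ B i \ {y'} := ⟨hy, fun h => hyy' h.symm⟩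
  have hQconn : RConn r Q := hQ ▸ rconn_rcomp hr
  have hclosed : ∀ u ∈ Q, ∀ v ∈ B i, r u v → v ≠ y → v ∈ Q := by
    intro u hu v hv huv hvy
    rw [hQ] at hu ⊢
    exact rcomp_closed hu huv ⟨hv, hvy⟩
  have hy'Q : y' ∈ Q := by
    by_contra hn
    obtain ⟨u, hu, v, hv, huv, huQ, hvQ⟩ := (hB.conn i).exists_cross ha haQ hy hyQ
    have hvy : v = y := by
      by_contra hne
      exact hvQ (hclosed u huQ v hv huv hne)
    subst hvy
    have hsub : insert v Q ⊆ Q' := by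
      have hc : RConn r ({v} ∪ Q) := RConn.union hr (rconn_singleton _ _) hQconn rfl huQ (hr huv)
      rw [hQ', Set.insert_eq]
      refine hc.subset_rcomp ?_ (Or.inl rfl)
      rintro z (rfl | hz)
      · exact hyS
      · exact ⟨(hQsub hz).1, fun h => hn (h ▸ hz)⟩
    have := Set.ncard_le_ncard hsub (Set.toFinite _)
    rw [Set.ncard_insert_of_notMem hyQ (Set.toFinite _), hQ, hQ'] at this
    omega
  have hcov : B i ⊆ Q ∪ Q' := by
    intro z hz
    by_cases hzQ : z ∈ Q
    · exact Or.inl hzQ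
    right
    have hzS : z ∈ B i \ Q := ⟨hz, hzQ⟩
    have hyC : y ∈ rcomp r (B i \ Q) z := by
      by_contra hn
      obtain ⟨u, hu, v, hv, huv, huC, hvC⟩ := (hB.conn i).exists_cross hz
        (mem_rcomp_self (S := B i \ Q) z) hy hn
      have hvQ : v ∈ Q := by
        by_contra hvQ
        exact hvC (rcomp_closed huC huv ⟨hv, hvQ⟩)
      exact (rcomp_subset hzS huC).2 (hclosed v hvQ u hu (hr huv) fun h => hn (h ▸ huC))
    have h1 := reach_symm hr hzS hyC
    rw [hQ']
    exact reach_mono h1 (fun _ _ h => h) fun w hw => ⟨hw.1, fun h => hw.2 (by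
      rw [Set.mem_singleton_iff] at h
      exact h ▸ hy'Q)⟩
  have h1 := hall _ hcov
  have h2 : ex (Q ∪ Q') ⊆ ex Q ∪ ex Q' := by
    intro j hj
    obtain ⟨h1, x, hx, z, hz, hxz⟩ := (hex _ _).1 hj
    rcases hx with hx | hx
    · exact Finset.mem_union_left _ ((hex _ _).2 ⟨h1, x, hx, z, hz, hxz⟩)
    · exact Finset.mem_union_right _ ((hex _ _).2 ⟨h1, x, hx, z, hz, hxz⟩)
  have h3 := (Finset.card_le_card h2).trans (Finset.card_union_le _ _)
  rw [← hQ] at hm1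
  rw [← hQ'] at hm2
  omega

end HeavyPoints

section Chains

variable {α V : Type*}

/-- Consecutive entries of an alternating chain. -/
def altStep (r : V → V → Prop) (p q : V × Bool) : Prop := r p.1 q.1 ∧ q.2 = !p.2

/-- The auxiliary graph on two copies of `V` and a set of terminals. -/
def auxRel (m : α → α → Prop) (e : α → V × Bool → Prop) (r : V → V → Prop) :
    α ⊕ V × Bool → α ⊕ V × Bool → Prop
  | Sum.inl a, Sum.inl a' => m a a'
  | Sum.inl a, Sum.inr p => e a p
  | Sum.inr p, Sum.inl a => e a p
  | Sum.inr p, Sum.inr q => (p.2 = q.2 ∧ r p.1 q.1) ∨ (p.1 = q.1 ∧ p.2 ≠ q.2)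

/-- `auxRel` as a graph. -/
def auxGraph (m : α → α → Prop) (e : α → V × Bool → Prop) (r : V → V → Prop)
    (hm : RSymm m) (hm' : ∀ a, ¬ m a a) (hr : RSymm r) (hr' : ∀ a, ¬ r a a) :
    SimpleGraph (α ⊕ V × Bool) where
  Adj := auxRel m e r
  symm := ⟨by
    rintro (a | p) (a' | q) h
    · exact hm h
    · exact h
    · exact h
    · rcases h with ⟨h1, h2⟩ | ⟨h1, h2⟩
      · exact Or.inl ⟨h1.symm, hr h2⟩
      · exact Or.inr ⟨h1.symm, h2.symm⟩⟩
  loopless := ⟨by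
    rintro (a | p) h
    · exact hm' a h
    · rcases h with ⟨-, h2⟩ | ⟨-, h2⟩
      · exact hr' _ h2
      · exact h2 rfl⟩

variable {m : α → α → Prop} {e : α → V × Bool → Prop} {r : V → V → Prop}
    {hm : RSymm m} {hm' : ∀ a, ¬ m a a} {hr : RSymm r} {hr' : ∀ a, ¬ r a a}

lemma PathOK.isChain_of_inr {t : α} (l : List (V × Bool)) (p : V × Bool)
    (h : PathOK (auxGraph m e r hm hm' hr hr') (Sum.inr p) l (Sum.inl t))
    (hnd : ((p :: l).map Prod.fst).Nodup) :
    (p :: l).IsChain (altStep r) ∧ ∃ q, (p :: l).getLast? = some q ∧ e t q := by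
  induction l generalizing p with
  | nil => exact ⟨List.isChain_singleton _, p, rfl, h⟩
  | cons q l ih =>
    obtain ⟨w, d⟩ := q
    obtain ⟨h1, h2⟩ := h
    have hnd' := hnd
    rw [List.map_cons, List.nodup_cons] at hnd
    obtain ⟨hc, q, hq, heq⟩ := ih _ h2 hnd.2
    refine ⟨List.isChain_cons_cons.2 ⟨?_, hc⟩, q, ?_, heq⟩
    · rcases h1 with ⟨h3, h4⟩ | ⟨h3, -⟩
      · exact ⟨h4, by simp only at h3 ⊢; rw [h3]; simp⟩
      · exact absurd (by simp [h3]) hnd.1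
    · rw [List.getLast?_cons_cons]; exact hq

lemma PathOK.isChain_of_inl {s t : α} (l : List (V × Bool))
    (h : PathOK (auxGraph m e r hm hm' hr hr') (Sum.inl s) l (Sum.inl t))
    (hnd : (l.map Prod.fst).Nodup) :
    (l = [] ∧ m s t) ∨ ∃ p q, l.head? = some p ∧ l.getLast? = some q ∧ e s (p.1, !p.2) ∧ e t q ∧
      l.IsChain (altStep r) := by
  rcases l with _ | ⟨⟨v, c⟩, l⟩
  · exact Or.inl ⟨rfl, h⟩
  · right
    obtain ⟨hc, q, hq, heq⟩ := PathOK.isChain_of_inr l (v, c) h.2 hnd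
    exact ⟨(v, c), q, rfl, hq, h.1, heq, hc⟩

/-- The number of consecutive pairs of a list that are not related by `T`. -/
noncomputable def jumps (T : V → V → Prop) : List V → ℕ
  | [] => 0
  | [_] => 0
  | u :: v :: l => (if T u v then 0 else 1) + jumps T (v :: l)

lemma jumps_append (T : V → V → Prop) (L : List V) (x : V) (L' : List V) :
    jumps T (L ++ x :: L') = jumps T (L ++ [x]) + jumps T (x :: L') := by
  induction L with
  | nil => simp [jumps]
  | cons u L ih =>
    rcases L with _ | ⟨v, L⟩
    · simp [jumps]
    · simp only [List.cons_append, jumps] at ih ⊢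
      rw [ih]; ring

lemma jumps_eq_zero {T : V → V → Prop} (L : List V) (h : L.IsChain T) : jumps T L = 0 := by
  induction L with
  | nil => rfl
  | cons u L ih =>
    rcases L with _ | ⟨v, L⟩
    · rfl
    · rw [List.isChain_cons_cons] at h
      simp [jumps, h.1, ih h.2]

lemma isChain_of_jumps_eq_zero {T : V → V → Prop} (L : List V) (h : jumps T L = 0) :
    L.IsChain T := by
  induction L with
  | nil => exact List.isChain_nil
  | cons u L ih =>
    rcases L with _ | ⟨v, L⟩
    · exact List.isChain_singleton _
    · simp only [jumps] at h
      refine List.isChain_cons_cons.2 ⟨?_, ih (by omega)⟩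
      by_contra hn
      rw [if_neg hn] at h
      omega

lemma jumps_reverse {T : V → V → Prop} (hT : RSymm T) (L : List V) :
    jumps T L.reverse = jumps T L := by
  induction L with
  | nil => rfl
  | cons u L ih =>
    rcases L with _ | ⟨v, L⟩
    · rfl
    · rw [List.reverse_cons, List.reverse_cons, List.append_assoc, List.singleton_append,
        jumps_append, ← List.reverse_cons, ih]
      have : T v u ↔ T u v := ⟨fun h => hT h, fun h => hT h⟩
      simp [jumps, this, add_comm]

lemma isChain_forall_mem {T : V → V → Prop} {A : Set V} (hA : ∀ u v, u ∈ A → T u v → v ∈ A)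
    (L : List V) (h : L.IsChain T) {x : V} (hx : L.head? = some x) (hxA : x ∈ A) :
    ∀ y ∈ L, y ∈ A := by
  induction L generalizing x with
  | nil => simp
  | cons u L ih =>
    simp only [List.head?_cons, Option.some.injEq] at hx
    subst hx
    intro y hy
    rcases List.mem_cons.1 hy with rfl | hy
    · exact hxA
    · rw [List.isChain_cons] at h
      rcases L with _ | ⟨v, L⟩
      · simp at hy
      · exact ih h.2 rfl (hA _ _ hxA (h.1 v rfl)) y hy

lemma RConn.exists_path_to {B S : Set V} (hB : RConn r B) (hr : RSymm r) {x y : V} (hx : x ∈ B)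
    (hxS : x ∈ S) (hy : y ∈ B) : ∃ (L : List V) (z : V), z ∈ S ∧ z ∈ B ∧
      (∀ u ∈ L, u ∈ B ∧ u ∉ S) ∧ L.Nodup ∧ (L ++ [z]).IsChain r ∧ (L ++ [z]).head? = some y := by
  refine hB.induct (P := fun y => ∃ (L : List V) (z : V), z ∈ S ∧ z ∈ B ∧
      (∀ u ∈ L, u ∈ B ∧ u ∉ S) ∧ L.Nodup ∧ (L ++ [z]).IsChain r ∧ (L ++ [z]).head? = some y)
    hx ⟨[], x, hxS, hx, by simp, by simp, by simp, by simp⟩ ?_ y hy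
  rintro a ha b hb hab ⟨L, z, hzS, hzB, hL, hnd, hch, hhead⟩
  by_cases hbS : b ∈ S
  · exact ⟨[], b, hbS, hb, by simp, by simp, by simp, by simp⟩
  by_cases hbL : b ∈ L
  · obtain ⟨L1, L2, rfl⟩ := List.append_of_mem hbL
    refine ⟨b :: L2, z, hzS, hzB, fun u hu => hL u (List.mem_append_right _ hu),
      (List.nodup_append.1 hnd).2.1, ?_, rfl⟩
    rw [List.append_assoc] at hch
    exact hch.right_of_append
  · refine ⟨b :: L, z, hzS, hzB, ?_, List.nodup_cons.2 ⟨hbL, hnd⟩, ?_, rfl⟩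
    · intro u hu
      rcases List.mem_cons.1 hu with rfl | hu
      · exact ⟨hb, hbS⟩
      · exact hL u hu
    · rw [List.cons_append, List.isChain_cons]
      refine ⟨?_, hch⟩
      intro c hc
      rw [hhead] at hc
      obtain rfl := Option.some.inj hc
      exact hr hab

end Chains
end OddMinor

namespace OddMinor
open scoped Classical
open Relation

section Linkages

variable {V : Type*} {G : SimpleGraph V} {col : V → Bool} {s n : ℕ} {B : Fin s → Set V}
  {a : Fin s → V} {σ τ : Fin n → Fin s} {l : Fin n → List (V × Bool)}

/-- A family of disjoint paths between branch sets whose parity differs from the colouring. -/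
structure Linkage (G : SimpleGraph V) (col : V → Bool) {s : ℕ} (a : Fin s → V) (n : ℕ)
    (σ τ : Fin n → Fin s) (l : Fin n → List (V × Bool)) : Prop where
  σ_inj : Function.Injective σ
  τ_inj : Function.Injective τ
  σ_ne_τ : ∀ i j, σ i ≠ τ j
  head : ∀ i, (l i).head? = some (a (σ i), col (a (σ i)))
  last : ∀ i, (l i).getLast? = some (a (τ i), !col (a (τ i)))
  chain : ∀ i, (l i).IsChain (altStep G.Adj)
  nodup : ∀ i, ((l i).map Prod.fst).Nodup
  disj : ∀ i j, i ≠ j → ∀ b ∈ (l i).map Prod.fst, b ∉ (l j).map Prod.fst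

lemma isChain_flipRev {r : V → V → Prop} (hr : RSymm r) {L : List (V × Bool)}
    (h : L.IsChain (altStep r)) : (flipRev L).IsChain (altStep r) := by
  rw [flipRev, List.isChain_reverse, List.isChain_map]
  refine h.imp ?_
  rintro ⟨u, c⟩ ⟨v, d⟩ ⟨h1, h2⟩
  refine ⟨hr h1, ?_⟩
  simp only at h2 ⊢
  rw [h2]; simp

lemma head?_flipRev (L : List (V × Bool)) :
    (flipRev L).head? = L.getLast?.map fun p => (p.1, !p.2) := by
  simp [flipRev]

lemma getLast?_flipRev (L : List (V × Bool)) :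
    (flipRev L).getLast? = L.head?.map fun p => (p.1, !p.2) := by
  simp [flipRev]

lemma map_fst_flipRev (L : List (V × Bool)) :
    (flipRev L).map Prod.fst = (L.map Prod.fst).reverse := by
  simp [flipRev, List.map_reverse, Function.comp_def]

lemma Linkage.flip (h : Linkage G col a n σ τ l) :
    Linkage G col a n τ σ fun i => flipRev (l i) where
  σ_inj := h.τ_inj
  τ_inj := h.σ_inj
  σ_ne_τ i j := (h.σ_ne_τ j i).symm
  head i := by rw [head?_flipRev, h.last]; simp
  last i := by rw [getLast?_flipRev, h.head]; simp
  chain i := isChain_flipRev (adj_rsymm G) (h.chain i)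
  nodup i := by rw [map_fst_flipRev]; exact List.nodup_reverse.2 (h.nodup i)
  disj i j hij b hb := by
    rw [mem_map_fst_flipRev] at hb ⊢
    exact h.disj i j hij b hb

/-- Bichromatic adjacency or not, inside a common branch set. -/
def treeStep (col : V → Bool) (B : Fin s → Set V) (u v : V) : Prop :=
  ∃ j, u ∈ B j ∧ v ∈ B j ∧ col u ≠ col v

lemma treeStep_rsymm (col : V → Bool) (B : Fin s → Set V) : RSymm (treeStep col B) :=
  fun _ _ ⟨j, h1, h2, h3⟩ => ⟨j, h2, h1, h3.symm⟩

/-- The number of steps of a family of paths which leave a branch set or are monochromatic. -/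
noncomputable def cost (col : V → Bool) (B : Fin s → Set V) (l : Fin n → List (V × Bool)) : ℕ :=
  ∑ i, jumps (treeStep col B) ((l i).map Prod.fst)

lemma Linkage.cost_flip (col : V → Bool) (B : Fin s → Set V) (l : Fin n → List (V × Bool)) :
    cost col B (fun i => flipRev (l i)) = cost col B l := by
  unfold cost
  refine Finset.sum_congr rfl fun i _ => ?_
  rw [map_fst_flipRev, jumps_reverse (treeStep_rsymm col B)]

lemma Linkage.reroute (h : Linkage G col a n σ τ l) (hB : CliqueModel (bich G col) s B)
    (ha : ∀ i, a i ∈ B i) {v : Fin s} (hσ : ∀ i, σ i ≠ v) (hτ : ∀ i, τ i ≠ v)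
    {i : Fin n} {L : List V} {x : V} (hx : (x, col x) ∈ l i) (hxB : x ∈ B v)
    (hL : ∀ u ∈ L, u ∈ B v ∧ ∀ j, u ∉ (l j).map Prod.fst) (hnd : L.Nodup)
    (hch : (L ++ [x]).IsChain (bich G col)) (hhead : (L ++ [x]).head? = some (a v)) :
    ∃ σ' τ' l', Linkage G col a n σ' τ' l' ∧ cost col B l' < cost col B l := by
  obtain ⟨P1, P2, hP⟩ := List.append_of_mem hx
  obtain ⟨N, hN⟩ : ∃ N : List (V × Bool), N = L.map (fun u => (u, col u)) ++ (x, col x) :: P2 :=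
    ⟨_, rfl⟩
  have hTclosed : ∀ j u w, u ∈ B j → treeStep col B u w → w ∈ B j := by
    rintro j u w hu ⟨k, h1, h2, -⟩
    by_cases hjk : j = k
    · exact hjk ▸ h2
    · exact absurd h1 (Set.disjoint_left.1 (hB.disj j k hjk) hu)
  have hNfst : N.map Prod.fst = L ++ x :: P2.map Prod.fst := by
    rw [hN]; simp [Function.comp_def]
  have hPfst : (l i).map Prod.fst = P1.map Prod.fst ++ x :: P2.map Prod.fst := by
    rw [hP]; simp
  have hmem : ∀ b ∈ N.map Prod.fst, b ∈ L ∨ b ∈ (l i).map Prod.fst := by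
    intro b hb
    rw [hNfst] at hb
    rcases List.mem_append.1 hb with hb | hb
    · exact Or.inl hb
    · right
      rw [hPfst]
      exact List.mem_append_right _ hb
  refine ⟨Function.update σ i v, τ, Function.update l i N, ⟨?_, h.τ_inj, ?_, ?_, ?_, ?_, ?_, ?_⟩, ?_⟩
  · intro j k hjk
    by_cases hj : j = i
    · by_cases hk : k = i
      · rw [hj, hk]
      · subst hj
        rw [Function.update_self, Function.update_of_ne hk] at hjk
        exact absurd hjk.symm (hσ k)
    · by_cases hk : k = i
      · subst hk
        rw [Function.update_self, Function.update_of_ne hj] at hjk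
        exact absurd hjk (hσ j)
      · rw [Function.update_of_ne hj, Function.update_of_ne hk] at hjk
        exact h.σ_inj hjk
  · intro j k
    by_cases hj : j = i
    · subst hj
      rw [Function.update_self]
      exact (hτ k).symm
    · rw [Function.update_of_ne hj]
      exact h.σ_ne_τ j k
  · intro j
    by_cases hj : j = i
    · subst hj
      rw [Function.update_self, Function.update_self, hN]
      rcases L with _ | ⟨u, L⟩
      · simp at hhead
        simp [hhead]
      · simp at hhead
        simp [hhead]
    · rw [Function.update_of_ne hj, Function.update_of_ne hj]
      exact h.head j
  · intro j
    by_cases hj : j = i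
    · subst hj
      rw [Function.update_self, ← h.last j, hN, hP]
      rw [List.getLast?_append, List.getLast?_append, List.getLast?_cons]
      rfl
    · rw [Function.update_of_ne hj]
      exact h.last j
  · intro j
    by_cases hj : j = i
    · subst hj
      rw [Function.update_self, hN, List.isChain_split]
      refine ⟨?_, ?_⟩
      · have : L.map (fun u => (u, col u)) ++ [(x, col x)]
            = (L ++ [x]).map fun u => (u, col u) := by simp
        rw [this, List.isChain_map]
        refine hch.imp ?_
        rintro u w ⟨h1, h2⟩
        refine ⟨h1, ?_⟩
        rcases Bool.eq_or_eq_not (col w) (col u) with h3 | h3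
        · exact absurd h3.symm h2
        · exact h3
      · have := h.chain j
        rw [hP] at this
        exact this.right_of_append
    · rw [Function.update_of_ne hj]
      exact h.chain j
  · intro j
    by_cases hj : j = i
    · subst hj
      rw [Function.update_self, hNfst, List.nodup_append]
      have h1 := h.nodup j
      rw [hPfst, List.nodup_append] at h1
      refine ⟨hnd, h1.2.1, ?_⟩
      rintro u hu w hw rfl
      refine (hL u hu).2 j ?_
      rw [hPfst]
      exact List.mem_append_right _ hw
    · rw [Function.update_of_ne hj]
      exact h.nodup j
  · intro j k hjk b hb
    by_cases hj : j = i
    · subst hj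
      rw [Function.update_self] at hb
      rw [Function.update_of_ne hjk.symm]
      rcases hmem b hb with hb | hb
      · exact (hL b hb).2 k
      · exact h.disj j k hjk b hb
    · rw [Function.update_of_ne hj] at hb
      by_cases hk : k = i
      · subst hk
        rw [Function.update_self]
        intro hb'
        rcases hmem b hb' with hb' | hb'
        · exact (hL b hb').2 j hb
        · exact h.disj j k hjk b hb hb'
      · rw [Function.update_of_ne hk]
        exact h.disj j k hjk b hb
  · refine Finset.sum_lt_sum ?_ ⟨i, Finset.mem_univ _, ?_⟩
    · intro j _
      by_cases hj : j = i
      · subst hj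
        rw [Function.update_self, hNfst, hPfst, jumps_append, jumps_append _ (P1.map Prod.fst)]
        have : jumps (treeStep col B) (L ++ [x]) = 0 := by
          refine jumps_eq_zero _ ?_
          have hall : ∀ u ∈ L ++ [x], u ∈ B v := by
            intro u hu
            rcases List.mem_append.1 hu with hu | hu
            · exact (hL u hu).1
            · rw [List.mem_singleton.1 hu]; exact hxB
          exact hch.imp_of_mem_imp fun u w hu hw huw => ⟨v, hall u hu, hall w hw, huw.2⟩
        omega
      · rw [Function.update_of_ne hj]
    · rw [Function.update_self, hNfst, hPfst, jumps_append, jumps_append _ (P1.map Prod.fst)]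
      have h1 : jumps (treeStep col B) (L ++ [x]) = 0 := by
        refine jumps_eq_zero _ ?_
        have hall : ∀ u ∈ L ++ [x], u ∈ B v := by
          intro u hu
          rcases List.mem_append.1 hu with hu | hu
          · exact (hL u hu).1
          · rw [List.mem_singleton.1 hu]; exact hxB
        exact hch.imp_of_mem_imp fun u w hu hw huw => ⟨v, hall u hu, hall w hw, huw.2⟩
      have h2 : jumps (treeStep col B) (P1.map Prod.fst ++ [x]) ≠ 0 := by
        intro h0
        have h3 := isChain_of_jumps_eq_zero _ h0
        have h4 : (P1.map Prod.fst ++ [x]).head? = some (a (σ i)) := by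
          have := h.head i
          rw [hP] at this
          rcases P1 with _ | ⟨p, P1⟩
          · simp at this
            simp [this.1]
          · simp at this
            simp [this]
        have h5 := isChain_forall_mem (A := B (σ i)) (fun u w => hTclosed _ u w) _ h3 h4
          (ha _) x (by simp)
        exact Set.disjoint_left.1 (hB.disj _ _ (hσ i)) h5 hxB
      omega

/-- A linkage of minimum cost avoids the branch sets not containing its ends. -/
lemma Linkage.exists_avoiding (h : Linkage G col a n σ τ l) (hB : CliqueModel (bich G col) s B)
    (ha : ∀ i, a i ∈ B i) : ∃ σ τ l, Linkage G col a n σ τ l ∧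
      ∀ v, (∀ i, σ i ≠ v) → (∀ i, τ i ≠ v) → ∀ i, ∀ p ∈ l i, p.1 ∉ B v := by
  obtain ⟨k, hk⟩ : ∃ k, ∃ σ τ l, Linkage G col a n σ τ l ∧ cost col B l = k :=
    ⟨_, σ, τ, l, h, rfl⟩
  clear h
  induction k using Nat.strong_induction_on with
  | _ k ih =>
    obtain ⟨σ, τ, l, h, hc⟩ := hk
    by_cases hgood : ∀ v, (∀ i, σ i ≠ v) → (∀ i, τ i ≠ v) → ∀ i, ∀ p ∈ l i, p.1 ∉ B v
    · exact ⟨σ, τ, l, h, hgood⟩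
    push Not at hgood
    obtain ⟨v, hσ, hτ, i, p, hp, hpB⟩ := hgood
    obtain ⟨L, x, ⟨j, hxS⟩, hxB, hL, hnd, hch, hhead⟩ := (hB.conn v).exists_path_to
      (S := {u | ∃ j, u ∈ (l j).map Prod.fst}) (bich_rsymm G col) hpB
      ⟨i, List.mem_map_of_mem hp⟩ (ha v)
    obtain ⟨⟨x', c⟩, hxl, hx'⟩ := List.mem_map.1 hxS
    simp only at hx'
    subst hx'
    have hL' : ∀ u ∈ L, u ∈ B v ∧ ∀ j, u ∉ (l j).map Prod.fst :=
      fun u hu => ⟨(hL u hu).1, fun j hj => (hL u hu).2 ⟨j, hj⟩⟩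
    rcases Bool.eq_or_eq_not c (col x') with hc' | hc'
    · rw [hc'] at hxl
      obtain ⟨σ', τ', l', h', hlt⟩ := h.reroute hB ha hσ hτ hxl hxB hL' hnd hch hhead
      exact ih _ (hc ▸ hlt) ⟨σ', τ', l', h', rfl⟩
    · have hxl' : (x', col x') ∈ flipRev (l j) := by
        rw [flipRev, List.mem_reverse, List.mem_map]
        exact ⟨_, hxl, by simp [hc']⟩
      have hL'' : ∀ u ∈ L, u ∈ B v ∧ ∀ j, u ∉ (flipRev (l j)).map Prod.fst :=
        fun u hu => ⟨(hL' u hu).1, fun j hj => (hL' u hu).2 j (mem_map_fst_flipRev.1 hj)⟩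
      obtain ⟨σ', τ', l', h', hlt⟩ := h.flip.reroute hB ha hτ hσ hxl' hxB hL'' hnd hch hhead
      rw [Linkage.cost_flip] at hlt
      exact ih _ (hc ▸ hlt) ⟨σ', τ', l', h', rfl⟩

end Linkages

section Covers

variable {V : Type*} {G : SimpleGraph V}

/-- Outside `X`, the bipartite graph of the half vertices is attached at single vertices to the
whole parts. -/
structure HalfCover (G : SimpleGraph V) (X : Finset V) (h : V → Option Bool)
    (κ : V → Option V) : Prop where
  half_half : ∀ v v' c c', v ∉ X → v' ∉ X → h v = some c → h v' = some c' → G.Adj v v' → c ≠ c'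
  whole_half : ∀ w v c, w ∉ X → v ∉ X → h w = none → h v = some c → G.Adj w v → κ w = some v
  whole_whole : ∀ w w', w ∉ X → w' ∉ X → h w = none → h w' = none → G.Adj w w' → κ w = κ w'

lemma card_touched_le {s : ℕ} {B : Fin s → Set V} (hd : ∀ i j, i ≠ j → Disjoint (B i) (B j))
    (X : Finset (Fin s ⊕ V)) : ∃ J : Finset (Fin s), s - X.card ≤ J.card ∧
      ∀ i ∈ J, Sum.inl i ∉ X ∧ ∀ v ∈ B i, Sum.inr v ∉ X := by
  obtain ⟨T, hT⟩ : ∃ T : Finset (Fin s), ∀ i, i ∈ T ↔ ∃ y ∈ X, y = Sum.inl i ∨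
      ∃ v ∈ B i, y = Sum.inr v :=
    ⟨Finset.univ.filter fun i => ∃ y ∈ X, y = Sum.inl i ∨ ∃ v ∈ B i, y = Sum.inr v,
      fun i => by simp⟩
  choose f hf1 hf2 using fun i (hi : i ∈ T) => (hT i).1 hi
  refine ⟨Finset.univ \ T, ?_, ?_⟩
  · have : T.card ≤ X.card := by
      refine Finset.card_le_card_of_injOn (fun i => if hi : i ∈ T then f i hi else Sum.inl i) ?_ ?_
      · intro i hi
        simp only [Finset.mem_coe] at hi
        simp only [hi, dif_pos, Finset.mem_coe]
        exact hf1 i hi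
      · intro i hi j hj hij
        simp only [Finset.mem_coe] at hi hj
        simp only [hi, hj, dif_pos] at hij
        by_contra hne
        rcases hf2 i hi with h1 | ⟨v, hv, h1⟩ <;> rcases hf2 j hj with h2 | ⟨w, hw, h2⟩
        · rw [h1, h2] at hij
          exact hne (Sum.inl.inj hij)
        · rw [h1, h2] at hij
          cases hij
        · rw [h1, h2] at hij
          cases hij
        · rw [h1, h2] at hij
          obtain rfl := Sum.inr.inj hij
          exact Set.disjoint_left.1 (hd i j hne) hv hw
    rw [Finset.card_sdiff_of_subset (Finset.subset_univ _), Finset.card_univ, Fintype.card_fin]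
    omega
  · intro i hi
    have hi' := (Finset.mem_sdiff.1 hi).2
    rw [hT] at hi'
    push Not at hi'
    exact ⟨fun h => (hi' _ h).1 rfl, fun v hv h => (hi' _ h).2 v hv rfl⟩

/-- Either there are many disjoint parity breaking paths between the branch sets, or they are
covered by few vertices. -/
lemma exists_linkage_or_halfCover [Fintype V] {col : V → Bool} {s n : ℕ} {B : Fin s → Set V}
    (hB : CliqueModel (bich G col) s B) (hs : 2 * n + 2 ≤ s) {a : Fin s → V}
    (ha : ∀ i, a i ∈ B i) :
    (∃ σ τ l, Linkage G col a n σ τ l) ∨ ∃ X h κ, HalfCover G X h κ ∧ X.card ≤ 2 * n ∧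
      ∃ J : Finset (Fin s), s - 2 * n ≤ J.card ∧
        ∀ i ∈ J, (∀ v ∈ B i, v ∉ X) ∧ ∃ v ∈ B i, h v ≠ none := by
  obtain ⟨D, hD⟩ : ∃ D, D = auxGraph (fun _ _ : Fin s => False)
    (fun i p => p = (a i, !col (a i))) G.Adj (fun _ _ h => h) (fun _ h => h) (adj_rsymm G)
    (fun _ => G.irrefl) := ⟨_, rfl⟩
  have hDe : ∀ i p, D.Adj (Sum.inl i) (Sum.inr p) ↔ p = (a i, !col (a i)) := by
    intro i p; subst hD; exact Iff.rfl
  have hDr : ∀ u v c, G.Adj u v → D.Adj (Sum.inr (u, c)) (Sum.inr (v, c)) := by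
    intro u v c h; subst hD; exact Or.inl ⟨rfl, h⟩
  rcases exists_altPaths_or_gallaiCover D (by
    intro v; subst hD; exact Or.inr ⟨rfl, by simp⟩) n with ⟨σ, τ, l, h⟩ | ⟨X₀, h, κ, hX⟩
  · left
    subst hD
    have key := fun i => PathOK.isChain_of_inl (l i) (h.path i) (h.nodup i)
    refine ⟨σ, τ, l, h.s_inj, h.t_inj, h.s_ne_t, ?_, ?_, ?_, h.nodup, h.disj⟩
    · intro i
      rcases key i with ⟨-, h0⟩ | ⟨⟨p, c⟩, q, h1, h2, h3, h4, h5⟩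
      · exact h0.elim
      · rw [h1]
        simp only [Prod.mk.injEq] at h3
        rw [h3.1, Bool.not_inj h3.2]
    · intro i
      rcases key i with ⟨-, h0⟩ | ⟨⟨p, c⟩, q, h1, h2, h3, h4, h5⟩
      · exact h0.elim
      · rw [h2, h4]
    · intro i
      rcases key i with ⟨-, h0⟩ | ⟨⟨p, c⟩, q, h1, h2, h3, h4, h5⟩
      · exact h0.elim
      · exact h5
  · right
    obtain ⟨J, hJ, hJ'⟩ := card_touched_le hB.disj X₀
    have hX0 := hX.card
    obtain ⟨X, hXm, hXc⟩ : ∃ X : Finset V, (∀ v, v ∈ X ↔ Sum.inr v ∈ X₀) ∧ X.card ≤ X₀.card := by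
      refine ⟨Finset.univ.filter fun v => Sum.inr v ∈ X₀, fun v => by simp, ?_⟩
      refine Finset.card_le_card_of_injOn Sum.inr ?_ (Sum.inr_injective.injOn)
      intro v hv
      simpa using hv
    refine ⟨X, h, fun w => (κ w).bind (Sum.elim (fun _ => none) some), ⟨?_, ?_, ?_⟩, by omega,
      J, by omega, ?_⟩
    · intro v v' c c' hv hv' hc hc' hadj hcc
      rw [hXm] at hv hv'
      subst hcc
      exact hX.half_half v v' c c hv hv' hc hc' (hDr _ _ _ hadj)
    · intro w v c hw hv hc hc' hadj
      rw [hXm] at hv hw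
      simp [hX.whole_half w c v c hw hc hv hc' (hDr _ _ _ hadj)]
    · intro w w' hw hw' hc hc' hadj
      rw [hXm] at hw' hw
      simp only [hX.whole_whole w w' true true hw hc hw' hc' (hDr _ _ _ hadj)]
    · intro i hi
      refine ⟨fun v hv => by rw [hXm]; exact (hJ' i hi).2 v hv, ?_⟩
      by_contra hcon
      push Not at hcon
      have hstart : ∀ i ∈ J, h (a i) = none → κ (a i) = some (Sum.inl i) := by
        intro i hi hn
        exact hX.whole_inl (a i) (!col (a i)) i ((hJ' i hi).2 _ (ha i)) hn (hJ' i hi).1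
          (((hDe i _).2 rfl).symm)
      have hprop : ∀ j ∈ J, ∀ x ∈ B j, h x = none → κ x = some (Sum.inl i) →
          ∀ y ∈ B j, h y = none ∧ κ y = some (Sum.inl i) := by
        intro j hj x hx hx1 hx2
        refine (hB.conn j).induct (P := fun y => h y = none ∧ κ y = some (Sum.inl i)) hx
          ⟨hx1, hx2⟩ ?_
        rintro u hu v hv huv ⟨h1, h2⟩
        have hu' := (hJ' j hj).2 u hu
        have hv' := (hJ' j hj).2 v hv
        rcases hhv : h v with _ | c
        · exact ⟨rfl, by rw [← hX.whole_whole u v true true hu' h1 hv' hhv (hDr _ _ _ huv.1), h2]⟩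
        · have := hX.whole_half u c v c hu' h1 hv' hhv (hDr _ _ _ huv.1)
          rw [h2] at this
          cases this
      obtain ⟨j, hj, hji⟩ : ∃ j ∈ J, j ≠ i := by
        by_contra hc
        push Not at hc
        have := Finset.card_le_card (show J ⊆ {i} from fun j hj => by simpa using hc j hj)
        simp at this
        omega
      obtain ⟨x, hx, y, hy, hxy⟩ := hB.adj i j hji.symm
      have hxn := hprop i hi (a i) (ha i) (hcon _ (ha i)) (hstart i hi (hcon _ (ha i))) x hx
      have hx' := (hJ' i hi).2 x hx
      have hy' := (hJ' j hj).2 y hy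
      have hyn : h y = none := by
        rcases hhy : h y with _ | c
        · rfl
        · have := hX.whole_half x c y c hx' hxn.1 hy' hhy (hDr _ _ _ hxy.1)
          rw [hxn.2] at this
          cases this
      have hyk : κ y = some (Sum.inl i) := by
        rw [← hX.whole_whole x y true true hx' hxn.1 hy' hyn (hDr _ _ _ hxy.1), hxn.2]
      have hfin := hprop j hj y hy hyn hyk (a j) (ha j)
      have := hstart j hj hfin.1
      rw [hfin.2] at this
      exact hji (Sum.inl.inj (Option.some.inj this)).symm

end Covers
end OddMinor

namespace OddMinor
open scoped Classical
open Relation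

section Relays

variable {V : Type*} {G : SimpleGraph V} {col : V → Bool} {s t : ℕ} {B : Fin s → Set V}
  {F : Fin s → Prop}

/-- The vertices outside the branch sets selected by `F`. -/
def Outside (B : Fin s → Set V) (F : Fin s → Prop) (v : V) : Prop := ∀ j, F j → v ∉ B j

/-- The auxiliary graph whose alternating paths join selected branch sets with broken parity. -/
def relayGraph (G : SimpleGraph V) (col : V → Bool) (B : Fin s → Set V) (F : Fin s → Prop) :
    SimpleGraph (Fin s ⊕ V × Bool) :=
  auxGraph (fun i j => i ≠ j ∧ F i ∧ F j ∧ ∃ x ∈ B i, ∃ y ∈ B j, G.Adj x y ∧ col x = col y)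
    (fun j p => F j ∧ Outside B F p.1 ∧ ∃ f ∈ B j, G.Adj f p.1 ∧ col f = p.2)
    (fun u v => G.Adj u v ∧ Outside B F u ∧ Outside B F v)
    (fun _ _ ⟨h1, h2, h3, x, hx, y, hy, h4, h5⟩ =>
      ⟨h1.symm, h3, h2, y, hy, x, hx, h4.symm, h5.symm⟩)
    (fun _ h => h.1 rfl) (fun _ _ h => ⟨h.1.symm, h.2.2, h.2.1⟩) (fun _ h => G.irrefl h.1)

lemma rconn_of_isChain {r : V → V → Prop} (hr : RSymm r) (L : List V) (h : L.IsChain r) :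
    RConn r {v | v ∈ L} := by
  induction L with
  | nil =>
    intro x hx
    simp at hx
  | cons u L ih =>
    rw [List.isChain_cons] at h
    rcases L with _ | ⟨v, L⟩
    · have : {w | w ∈ [u]} = {u} := by ext; simp
      rw [this]
      exact rconn_singleton r u
    · have : {w | w ∈ u :: v :: L} = {u} ∪ {w | w ∈ v :: L} := by ext; simp
      rw [this]
      exact RConn.union hr (rconn_singleton r u) (ih h.2) rfl
        (List.mem_cons_self) (h.1 v rfl)

lemma outside_of_isChain (L : List (V × Bool)) {p : V × Bool} (hp : L.head? = some p)
    (hpO : Outside B F p.1)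
    (h : L.IsChain (altStep fun u v => G.Adj u v ∧ Outside B F u ∧ Outside B F v)) :
    ∀ q ∈ L, Outside B F q.1 := by
  induction L generalizing p with
  | nil => simp
  | cons u L ih =>
    obtain rfl := Option.some.inj hp
    intro q hq
    rcases List.mem_cons.1 hq with rfl | hq
    · exact hpO
    · rw [List.isChain_cons] at h
      rcases L with _ | ⟨v, L⟩
      · simp at hq
      · exact ih rfl (h.1 v rfl).1.2.2 h.2 q hq

lemma eq_of_nodup_fst {L : List (V × Bool)} (h : (L.map Prod.fst).Nodup) {v : V} {c d : Bool}
    (hc : (v, c) ∈ L) (hd : (v, d) ∈ L) : c = d := by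
  have := List.inj_on_of_nodup_map h hc hd rfl
  exact (Prod.mk.inj this).2

/-- Alternating paths in the relay graph produce an odd clique model. -/
lemma hasOddClique_of_altPaths (hB : CliqueModel (bich G col) s B) {S T : Fin t → Fin s}
    {l : Fin t → List (V × Bool)} (h : AltPaths (relayGraph G col B F) t S T l) :
    HasOddClique G t := by
  have key := fun p => PathOK.isChain_of_inl (l p) (h.path p) (h.nodup p)
  have hout : ∀ p, ∀ q ∈ l p, Outside B F q.1 := by
    intro p q hq
    rcases key p with ⟨h0, -⟩ | ⟨x, y, h1, h2, h3, h4, h5⟩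
    · rw [h0] at hq; simp at hq
    · exact outside_of_isChain (l p) h1 h3.2.1 h5 q hq
  have hS : ∀ p, F (S p) := by
    intro p
    rcases key p with ⟨-, h0⟩ | ⟨x, y, h1, h2, h3, h4, h5⟩
    · exact h0.2.1
    · exact h3.1
  have hT : ∀ p, F (T p) := by
    intro p
    rcases key p with ⟨-, h0⟩ | ⟨x, y, h1, h2, h3, h4, h5⟩
    · exact h0.2.2.1
    · exact h4.1
  have hdis : ∀ {i j v}, v ∈ B i → v ∈ B j → i = j := by
    intro i j v hi hj
    by_contra hne
    exact Set.disjoint_left.1 (hB.disj i j hne) hi hj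
  obtain ⟨nc, hnc⟩ : ∃ nc : V → Bool, nc = fun v => if ∃ p, v ∈ B (T p) then !col v else
    if ∃ p, v ∈ B (S p) then col v else if ∃ p, (v, true) ∈ l p then true else false := ⟨_, rfl⟩
  have hncT : ∀ p, ∀ v ∈ B (T p), nc v = !col v := by
    intro p v hv
    rw [hnc]; beta_reduce
    rw [if_pos ⟨p, hv⟩]
  have hncS : ∀ p, ∀ v ∈ B (S p), nc v = col v := by
    intro p v hv
    rw [hnc]; beta_reduce
    rw [if_neg, if_pos ⟨p, hv⟩]
    rintro ⟨q, hq⟩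
    exact h.s_ne_t _ _ (hdis hv hq)
  have hncl : ∀ p v c, (v, c) ∈ l p → nc v = c := by
    intro p v c hv
    have ho := hout p _ hv
    rw [hnc]; beta_reduce
    rw [if_neg (by rintro ⟨q, hq⟩; exact ho _ (hT q) hq),
      if_neg (by rintro ⟨q, hq⟩; exact ho _ (hS q) hq)]
    cases c
    · rw [if_neg]
      rintro ⟨q, hq⟩
      by_cases hpq : p = q
      · subst hpq
        have := eq_of_nodup_fst (h.nodup p) hv hq
        simp at this
      · exact h.disj p q hpq v (List.mem_map.2 ⟨_, hv, rfl⟩) (List.mem_map.2 ⟨_, hq, rfl⟩)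
    · rw [if_pos ⟨p, hv⟩]
  have hr := bich_rsymm G nc
  have hcS : ∀ p, RConn (bich G nc) (B (S p)) := fun p => (hB.conn _).mono' fun u hu v hv huv =>
    ⟨huv.1, by rw [hncS p u hu, hncS p v hv]; exact huv.2⟩
  have hcT : ∀ p, RConn (bich G nc) (B (T p)) := fun p => (hB.conn _).mono' fun u hu v hv huv =>
    ⟨huv.1, by
      rw [hncT p u hu, hncT p v hv]
      exact fun h => huv.2 (Bool.not_inj h)⟩
  refine ⟨fun p => B (S p) ∪ {v | v ∈ (l p).map Prod.fst} ∪ B (T p), nc, ?_, ?_, ?_, ?_⟩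
  · intro p
    obtain ⟨x, hx⟩ := hB.nonempty (S p)
    exact ⟨x, Or.inl (Or.inl hx)⟩
  · intro p
    rcases key p with ⟨h0, h1, h2, h3, x, hx, y, hy, hxy, hc⟩ | ⟨x, y, h1, h2, h3, h4, h5⟩
    · have he : B (S p) ∪ {v | v ∈ (l p).map Prod.fst} ∪ B (T p) = B (S p) ∪ B (T p) := by
        rw [h0]; simp
      beta_reduce
      rw [he]
      refine RConn.union hr (hcS p) (hcT p) hx hy ⟨hxy, ?_⟩
      rw [hncS p x hx, hncT p y hy, hc]
      simp
    · have hpath : RConn (bich G nc) {v | v ∈ (l p).map Prod.fst} := by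
        refine rconn_of_isChain hr _ ?_
        rw [List.isChain_map]
        refine h5.imp_of_mem_imp ?_
        rintro ⟨u, c⟩ ⟨v, d⟩ hu hv huv
        refine ⟨huv.1.1, ?_⟩
        have h6 : d = !c := huv.2
        rw [hncl p u c hu, hncl p v d hv, h6]
        simp
      have hx : x ∈ l p := List.mem_of_head? h1
      have hy : y ∈ l p := List.mem_of_getLast? h2
      obtain ⟨x, cx⟩ := x
      obtain ⟨y, cy⟩ := y
      obtain ⟨-, -, f, hf, hfx, hfc⟩ := h3
      obtain ⟨-, -, g, hg, hgy, hgc⟩ := h4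
      have hxm : x ∈ {v | v ∈ (l p).map Prod.fst} := List.mem_map.2 ⟨_, hx, rfl⟩
      have hym : y ∈ {v | v ∈ (l p).map Prod.fst} := List.mem_map.2 ⟨_, hy, rfl⟩
      refine RConn.union (x := y) (y := g) hr (RConn.union (x := f) (y := x) hr (hcS p) hpath hf hxm ⟨hfx, ?_⟩) (hcT p)
        (Or.inr hym) hg ⟨hgy.symm, ?_⟩
      · rw [hncS p f hf, hncl p x cx hx, hfc]
        simp
      · rw [hncT p g hg, hncl p y cy hy, hgc]
        simp
  · intro p q hpq
    rw [Set.disjoint_left]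
    rintro v ((hv | hv) | hv) ((hw | hw) | hw)
    · exact hpq (h.s_inj (hdis hv hw))
    · obtain ⟨z, hz, rfl⟩ := List.mem_map.1 hw
      exact hout q z hz _ (hS p) hv
    · exact h.s_ne_t _ _ (hdis hv hw)
    · obtain ⟨z, hz, rfl⟩ := List.mem_map.1 hv
      exact hout p z hz _ (hS q) hw
    · exact h.disj p q hpq v hv hw
    · obtain ⟨z, hz, rfl⟩ := List.mem_map.1 hv
      exact hout p z hz _ (hT q) hw
    · exact h.s_ne_t _ _ (hdis hw hv)
    · obtain ⟨z, hz, rfl⟩ := List.mem_map.1 hw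
      exact hout q z hz _ (hT p) hv
    · exact hpq (h.t_inj (hdis hv hw))
  · intro p q hpq
    obtain ⟨x, hx, y, hy, hxy, hc⟩ := hB.adj (S p) (T q) (h.s_ne_t p q)
    refine ⟨x, Or.inl (Or.inl hx), y, Or.inr hy, hxy, ?_⟩
    rw [hncS p x hx, hncT q y hy]
    cases hcx : col x <;> cases hcy : col y <;> simp_all

lemma GallaiCover.chain_end {X : Finset (Fin s ⊕ V)} {h : V → Option Bool}
    {κ : V → Option (Fin s ⊕ V)} (hX : GallaiCover (relayGraph G col B F) t X h κ)
    (L : List (V × Bool)) (p : V × Bool) (hL : ∀ q ∈ p :: L, Outside B F q.1 ∧ Sum.inr q.1 ∉ X)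
    (hnd : ((p :: L).map Prod.fst).Nodup) (hch : (p :: L).IsChain (altStep G.Adj))
    (hp : h p.1 = some p.2 ∨ h p.1 = none ∧ ∃ x, κ p.1 = some (Sum.inr x) ∧
      x ∉ (p :: L).map Prod.fst) :
    ∃ q, (p :: L).getLast? = some q ∧ (h q.1 = none ∨ h q.1 = some q.2) := by
  induction L generalizing p with
  | nil => exact ⟨p, rfl, hp.symm.imp (fun h => h.1) id⟩
  | cons q L ih =>
    obtain ⟨v, ν⟩ := p
    obtain ⟨w, ν'⟩ := q
    rw [List.isChain_cons_cons] at hch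
    obtain ⟨⟨hadj, hν⟩, hch⟩ := hch
    simp only at hadj hν
    have hv := hL _ (List.mem_cons_self)
    have hw := hL (w, ν') (List.mem_cons_of_mem _ List.mem_cons_self)
    have hD : ∀ c, (relayGraph G col B F).Adj (Sum.inr (v, c)) (Sum.inr (w, c)) :=
      fun c => Or.inl ⟨rfl, hadj, hv.1, hw.1⟩
    have hnd' := hnd
    rw [List.map_cons, List.nodup_cons] at hnd'
    rw [List.getLast?_cons_cons]
    refine ih (w, ν') (fun q hq => hL q (List.mem_cons_of_mem _ hq)) hnd'.2 hch ?_
    simp only at hp ⊢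
    rcases hp with hp | ⟨hp, x, hx, hxL⟩
    · rcases hw' : h w with _ | c
      · exact Or.inr ⟨rfl, v, hX.whole_half w ν v ν hw.2 hw' hv.2 hp (hD ν).symm, hnd'.1⟩
      · left
        congr 1
        by_contra hne
        have hcν : c = ν := by
          rcases Bool.eq_or_eq_not c ν with h1 | h1
          · exact h1
          · exact absurd (h1.trans hν.symm) hne
        subst hcν
        exact hX.half_half v w c c hv.2 hw.2 hp hw' (hD c)
    · rcases hw' : h w with _ | c
      · refine Or.inr ⟨rfl, x, ?_, fun hm => hxL (List.mem_cons_of_mem _ hm)⟩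
        rw [← hX.whole_whole v w true true hv.2 hp hw.2 hw' (hD true), hx]
      · exfalso
        have := hX.whole_half v c w c hv.2 hp hw.2 hw' (hD c)
        rw [hx] at this
        obtain rfl := Sum.inr.inj (Option.some.inj this)
        exact hxL (by simp)

/-- In the presence of a large bichromatic clique model but no odd clique, few vertices break all
parity changes between branch sets. -/
theorem exists_halfCover [Fintype V] (hB : CliqueModel (bich G col) s B) (hs : 20 * t + 8 ≤ s)
    (hodd : ¬ HasOddClique G t) : ∃ X h κ, HalfCover G X h κ ∧ X.card ≤ 8 * t + 2 ∧
      ∃ J : Finset (Fin s), s - (8 * t + 2) ≤ J.card ∧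
        ∀ i ∈ J, (∀ v ∈ B i, v ∉ X) ∧ ∃ v ∈ B i, h v ≠ none := by
  choose a ha hheavy using hB.exists_heavy (bich_rsymm G col) (m := 10 * t + 3) (by omega)
  rcases exists_linkage_or_halfCover (n := 4 * t + 1) hB (by omega) ha with
    ⟨σ, τ, l, hlink⟩ | ⟨X, h, κ, h1, h2, J, h3, h4⟩
  swap
  · exact ⟨X, h, κ, h1, by omega, J, by omega, h4⟩
  exfalso
  obtain ⟨σ, τ, l, hlink, hav⟩ := hlink.exists_avoiding hB ha
  obtain ⟨F, hF⟩ : ∃ F : Fin s → Prop, F = fun j => (∀ i, σ i ≠ j) ∧ (∀ i, τ i ≠ j) := ⟨_, rfl⟩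
  rcases exists_altPaths_or_gallaiCover (relayGraph G col B F)
    (fun v => Or.inr ⟨rfl, by simp⟩) t with ⟨S, T, l', h⟩ | ⟨X, h, κ, hX⟩
  · exact hodd (hasOddClique_of_altPaths hB h)
  have hXc := hX.card
  obtain ⟨J, hJ, hJ'⟩ := card_touched_le hB.disj X
  obtain ⟨K, hK, hKF, hKX⟩ : ∃ K : Finset (Fin s), s ≤ K.card + (10 * t + 2) ∧ (∀ j ∈ K, F j) ∧
      ∀ j ∈ K, Sum.inl j ∉ X := by
    refine ⟨J \ (Finset.univ.image σ ∪ Finset.univ.image τ), ?_, ?_, ?_⟩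
    · have h1 := Finset.le_card_sdiff (Finset.univ.image σ ∪ Finset.univ.image τ) J
      have h2 := Finset.card_union_le (Finset.univ.image σ) (Finset.univ.image τ)
      have h3 : (Finset.univ.image σ).card ≤ 4 * t + 1 := by
        simpa using Finset.card_image_le (s := Finset.univ) (f := σ)
      have h4 : (Finset.univ.image τ).card ≤ 4 * t + 1 := by
        simpa using Finset.card_image_le (s := Finset.univ) (f := τ)
      omega
    · intro j hj
      have := (Finset.mem_sdiff.1 hj).2
      rw [hF]
      simpa using this
    · intro j hj
      exact (hJ' j (Finset.mem_sdiff.1 hj).1).1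
  have hdis : ∀ {i j v}, v ∈ B i → v ∈ B j → i = j := by
    intro i j v hi hj
    by_contra hne
    exact Set.disjoint_left.1 (hB.disj i j hne) hi hj
  obtain ⟨i, hi1, hi2, hi3⟩ : ∃ i, (∀ p ∈ l i, Sum.inr p.1 ∉ X) ∧
      (∀ v ∈ B (σ i), Sum.inr v ∉ X) ∧ ∀ v ∈ B (τ i), Sum.inr v ∉ X := by
    by_contra hcon
    have : ∀ i, ∃ y : (Fin s ⊕ V) × Bool, y.1 ∈ X ∧ ∃ v, y.1 = Sum.inr v ∧
        ((y.2 = true ∧ v ∈ (l i).map Prod.fst) ∨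
          (y.2 = false ∧ (v ∈ B (σ i) ∨ v ∈ B (τ i)))) := by
      intro i
      by_contra hc
      apply hcon
      refine ⟨i, fun p hp hpX => hc ?_, fun v hv hvX => hc ?_, fun v hv hvX => hc ?_⟩
      · exact ⟨(Sum.inr p.1, true), hpX, p.1, rfl, Or.inl ⟨rfl, List.mem_map_of_mem hp⟩⟩
      · exact ⟨(Sum.inr v, false), hvX, v, rfl, Or.inr ⟨rfl, Or.inl hv⟩⟩
      · exact ⟨(Sum.inr v, false), hvX, v, rfl, Or.inr ⟨rfl, Or.inr hv⟩⟩
    choose y hy1 w hw1 hw2 using this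
    have hcard : (Finset.univ : Finset (Fin (4 * t + 1))).card ≤
        (X ×ˢ (Finset.univ : Finset Bool)).card := by
      refine Finset.card_le_card_of_injOn y ?_ ?_
      · intro i _
        simpa using hy1 i
      · intro i _ j _ hij
        by_contra hne
        have hw : w i = w j := by
          have := hw1 i
          rw [hij, hw1 j] at this
          exact (Sum.inr.inj this).symm
        rcases hw2 i with ⟨h1, h2⟩ | ⟨h1, h2⟩ <;> rcases hw2 j with ⟨h3, h4⟩ | ⟨h3, h4⟩
        · rw [hw] at h2
          exact hlink.disj i j hne _ h2 h4
        · rw [hij, h3] at h1; simp at h1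
        · rw [hij, h3] at h1; simp at h1
        · rw [hw] at h2
          rcases h2 with h2 | h2 <;> rcases h4 with h4 | h4
          · exact hne (hlink.σ_inj (hdis h2 h4))
          · exact hlink.σ_ne_τ _ _ (hdis h2 h4)
          · exact hlink.σ_ne_τ _ _ (hdis h4 h2)
          · exact hne (hlink.τ_inj (hdis h2 h4))
    simp at hcard
    omega
  have hOB : ∀ u, ¬ F u → ∀ v ∈ B u, Outside B F v := by
    intro u hu v hv j hj hvj
    exact hu ((hdis hv hvj) ▸ hj)
  have hOl : ∀ p ∈ l i, Outside B F p.1 := by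
    intro p hp j hj
    rw [hF] at hj
    exact hav j hj.1 hj.2 i p hp
  have hDr : ∀ u v c, G.Adj u v → Outside B F u → Outside B F v →
      (relayGraph G col B F).Adj (Sum.inr (u, c)) (Sum.inr (v, c)) :=
    fun u v c h1 h2 h3 => Or.inl ⟨rfl, h1, h2, h3⟩
  have hDe : ∀ j f x, F j → f ∈ B j → Outside B F x → G.Adj x f →
      (relayGraph G col B F).Adj (Sum.inl j) (Sum.inr (x, col f)) :=
    fun j f x h1 h2 h3 h4 => ⟨h1, h3, f, h2, h4.symm, rfl⟩
  have claimA : ∀ u, ¬ F u → (∀ v ∈ B u, Sum.inr v ∉ X) → h (a u) ≠ none := by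
    intro u hu huX hn
    obtain ⟨Y, hY⟩ : ∃ Y : Set V, Y = {y | κ (a u) = some (Sum.inr y) ∧ y ≠ a u} := ⟨_, rfl⟩
    have hYs : Y.Subsingleton := by
      intro y hy z hz
      rw [hY] at hy hz
      have := hy.1.symm.trans hz.1
      exact Sum.inr.inj (Option.some.inj this)
    have haY : a u ∉ Y := by
      rw [hY]; exact fun h => h.2 rfl
    obtain ⟨J₁, hJ₁, hJ₂⟩ := hheavy u Y hYs haY
    have hQ : ∀ v ∈ rcomp (bich G col) (B u \ Y) (a u), h v = none ∧ κ v = κ (a u) := by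
      have haS : a u ∈ B u \ Y := ⟨ha u, haY⟩
      refine (rconn_rcomp (bich_rsymm G col)).induct (P := fun v => h v = none ∧ κ v = κ (a u))
        (mem_rcomp_self _) ⟨hn, rfl⟩ ?_
      rintro v hv w hw hvw ⟨h1, h2⟩
      have hv' := rcomp_subset haS hv
      have hw' := rcomp_subset haS hw
      have hD := fun c => hDr v w c hvw.1 (hOB u hu v hv'.1) (hOB u hu w hw'.1)
      rcases hhw : h w with _ | c
      · exact ⟨rfl, by
          rw [← hX.whole_whole v w true true (huX _ hv'.1) h1 (huX _ hw'.1) hhw (hD true), h2]⟩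
      · exfalso
        have h3 := hX.whole_half v c w c (huX _ hv'.1) h1 (huX _ hw'.1) hhw (hD c)
        apply hw'.2
        rw [hY]
        refine ⟨h2 ▸ h3, ?_⟩
        rintro rfl
        rw [hn] at hhw
        cases hhw
    have hinl : ∀ j ∈ J₁ ∩ K, κ (a u) = some (Sum.inl j) := by
      intro j hj
      obtain ⟨hj1, hj2⟩ := Finset.mem_inter.1 hj
      obtain ⟨-, x, hx, z, hz, hxz⟩ := hJ₂ j hj1
      obtain ⟨h1, h2⟩ := hQ x hx
      have hx' := (rcomp_subset (show a u ∈ B u \ Y from ⟨ha u, haY⟩) hx).1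
      rw [← h2]
      exact hX.whole_inl x (col z) j (huX x hx') h1 (hKX j hj2)
        (hDe j z x (hKF j hj2) hz (hOB u hu x hx') hxz.1).symm
    have h1 : 1 < (J₁ ∩ K).card := by
      have h2 := Finset.card_union_add_card_inter J₁ K
      have h3 := Finset.card_le_univ (J₁ ∪ K)
      rw [Fintype.card_fin] at h3
      omega
    obtain ⟨j, hj, j', hj', hne⟩ := Finset.one_lt_card.1 h1
    have := (hinl j hj).symm.trans (hinl j' hj')
    exact hne (Sum.inl.inj (Option.some.inj this))
  have claimB : ∀ u, ¬ F u → (∀ v ∈ B u, Sum.inr v ∉ X) → h (a u) = some (col (a u)) := by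
    intro u hu huX
    have hA := claimA u hu huX
    obtain ⟨j, hj⟩ : K.Nonempty := by
      rw [← Finset.card_pos]; omega
    have hju : u ≠ j := fun h => hu (h ▸ hKF j hj)
    obtain ⟨x, hx, f, hf, hxf⟩ := hB.adj u j hju
    have hD := fun v (hv : v ∈ B u) w (hw : w ∈ B u) (hvw : bich G col v w) c =>
      hDr v w c hvw.1 (hOB u hu v hv) (hOB u hu w hw)
    have hDx := hDe j f x (hKF j hj) hf (hOB u hu x hx) hxf.1
    have hxh : h x = some (col x) := by
      rcases hhx : h x with _ | c
      · exfalso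
        have h1 := hX.whole_inl x _ j (huX x hx) hhx (hKX j hj) hDx.symm
        refine hA ((hB.conn u).induct (P := fun v => h v = none ∧ κ v = some (Sum.inl j)) hx
          ⟨hhx, h1⟩ ?_ (a u) (ha u)).1
        rintro v hv w hw hvw ⟨h2, h3⟩
        rcases hhw : h w with _ | c
        · exact ⟨rfl, by
            rw [← hX.whole_whole v w true true (huX v hv) h2 (huX w hw) hhw (hD v hv w hw hvw _),
              h3]⟩
        · exfalso
          have := hX.whole_half v c w c (huX v hv) h2 (huX w hw) hhw (hD v hv w hw hvw _)
          rw [h3] at this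
          cases this
      · congr 1
        by_contra hne
        have : c = col f := by
          rcases Bool.eq_or_eq_not (col f) (col x) with h1 | h1
          · exact absurd h1.symm hxf.2
          · rcases Bool.eq_or_eq_not c (col x) with h2 | h2
            · exact absurd h2 hne
            · rw [h1, h2]
        subst this
        exact hX.inl_half j x _ (hKX j hj) (huX x hx) hhx hDx
    have := (hB.conn u).induct (P := fun v => h v = some (col v) ∨ (h v = none ∧
      ∃ y, κ v = some (Sum.inr y) ∧ h y = some (col y))) hx (Or.inl hxh) (by
        rintro v hv w hw hvw (h1 | ⟨h1, y, h2, h3⟩)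
        · rcases hhw : h w with _ | c
          · exact Or.inr ⟨rfl, v, hX.whole_half w (col v) v (col v) (huX w hw) hhw (huX v hv) h1
              (hD v hv w hw hvw _).symm, h1⟩
          · left
            congr 1
            by_contra hne
            have : c = col v := by
              rcases Bool.eq_or_eq_not (col v) (col w) with h4 | h4
              · exact absurd h4 hvw.2
              · rcases Bool.eq_or_eq_not c (col w) with h5 | h5
                · exact absurd h5 hne
                · rw [h4, h5]
            subst this
            exact hX.half_half v w _ _ (huX v hv) (huX w hw) h1 hhw (hD v hv w hw hvw _)
        · rcases hhw : h w with _ | c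
          · refine Or.inr ⟨rfl, y, ?_, h3⟩
            rw [← hX.whole_whole v w true true (huX v hv) h1 (huX w hw) hhw (hD v hv w hw hvw _),
              h2]
          · left
            have := hX.whole_half v c w c (huX v hv) h1 (huX w hw) hhw (hD v hv w hw hvw _)
            rw [h2] at this
            obtain rfl := Sum.inr.inj (Option.some.inj this)
            rw [← hhw, h3]) (a u) (ha u)
    rcases this with h1 | h1
    · exact h1
    · exact absurd h1.1 hA
  have hFσ : ¬ F (σ i) := by rw [hF]; exact fun h => h.1 i rfl
  have hFτ : ¬ F (τ i) := by rw [hF]; exact fun h => h.2 i rfl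
  have hBσ := claimB _ hFσ hi2
  have hBτ := claimB _ hFτ hi3
  have hhead := hlink.head i
  have hlast := hlink.last i
  have hchain := hlink.chain i
  have hnd := hlink.nodup i
  generalize l i = L at hi1 hOl hhead hlast hchain hnd
  rcases L with _ | ⟨p, L⟩
  · simp at hhead
  · obtain rfl := Option.some.inj hhead
    obtain ⟨q, hq1, hq2⟩ := hX.chain_end L _ (fun q hq => ⟨hOl q hq, hi1 q hq⟩) hnd hchain
      (Or.inl hBσ)
    rw [hlast] at hq1
    obtain rfl := Option.some.inj hq1
    rw [hBτ] at hq2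
    simp at hq2

end Relays
end OddMinor

namespace OddMinor
open scoped Classical
open Relation

section BandCovers

/-- The whole vertices outside `X` attached at `τ`, apart from `τ` itself. -/
def wholeAt {V : Type*} (X : Finset V) (h : V → Option Bool) (κ : V → Option V) (τ : Option V) :
    Set V :=
  {w | w ∉ X ∧ h w = none ∧ κ w = τ ∧ some w ≠ τ}

/-- The attachment vertices of a half cover may be assumed to be half vertices. -/
lemma HalfCover.normalize {V : Type*} {G : SimpleGraph V} {X : Finset V}
    {h : V → Option Bool} {κ : V → Option V} (hX : HalfCover G X h κ) :
    ∃ κ', HalfCover G X h κ' ∧ ∀ w v, κ' w = some v → h v ≠ none := by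
  refine ⟨fun w => (κ w).bind fun v => if h v = none then none else some v,
    ⟨hX.half_half, ?_, ?_⟩, ?_⟩
  · intro w v c hw hv hhw hhv hwv
    simp [hX.whole_half w v c hw hv hhw hhv hwv, hhv]
  · intro w w' hw hw' hhw hhw' hww
    simp only [hX.whole_whole w w' hw hw' hhw hhw' hww]
  · intro w v hwv
    rcases hκ : κ w with _ | u
    · simp [hκ] at hwv
    · by_cases hu : h u = none
      · simp [hκ, hu] at hwv
      · simp [hκ, hu] at hwv
        exact hwv ▸ hu

lemma HalfCover.wholeAt_closed {V : Type*} {G : SimpleGraph V} {X : Finset V}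
    {h : V → Option Bool} {κ : V → Option V} (hX : HalfCover G X h κ) {τ : Option V} {a b : V}
    (ha : a ∈ wholeAt X h κ τ) (hab : G.Adj a b) (hbX : b ∉ X) (hb : some b ≠ τ) :
    b ∈ wholeAt X h κ τ := by
  obtain ⟨h1, h2, h3, h4⟩ := ha
  rcases hhb : h b with _ | c
  · exact ⟨hbX, hhb, by rw [← hX.whole_whole a b h1 hbX h2 hhb hab, h3], hb⟩
  · have := hX.whole_half a b c h1 hbX h2 hhb hab
    rw [h3] at this
    exact absurd this.symm hb

/-- A large unsplittable set of a band in a bounded degree graph without odd clique models has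
a half cover whose whole parts contain few of its vertices. -/
theorem exists_halfCover_of_unsplit_band (t Δ f w : ℕ) : ∃ k θ : ℕ, ∀ {V : Type*} [Fintype V]
    {G : SimpleGraph V} {x₀ : V} {ℓ : V → ℕ} (_ : Layering G x₀ ℓ) (_ : DegLE G.Adj Δ)
    (_ : ¬ HasOddClique G t) (a : ℕ) (C : Set V) (_ : C = {v | a ≤ ℓ v ∧ ℓ v < a + w})
    (S : Finset V), (∀ v ∈ S, v ∈ C) → Unsplit (bandRel G C) S k f → θ ≤ S.card →
    ∃ X h κ, HalfCover G X h κ ∧ (∀ w v, κ w = some v → h v ≠ none) ∧ X.card ≤ 8 * t + 2 ∧ ∀ τ, ∀ F ⊆ S,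
      (∀ v ∈ F, v ∈ wholeAt X h κ τ) → F.card ≤ f * (8 * t + 3) := by
  obtain ⟨s, hs⟩ : ∃ s, s = 20 * t + 8 + f * (8 * t + 3) + 2 := ⟨_, rfl⟩
  obtain ⟨s₀, heven⟩ := exists_even_model t s
  obtain ⟨k, θ, hmodel⟩ := exists_model_of_unsplit_band s₀ Δ f w
  refine ⟨k + (8 * t + 3), θ, ?_⟩
  intro V _ G x₀ ℓ hℓ hdeg hodd a C hC S hSC hS hθ
  have hS' : Unsplit (bandRel G C) S k f := fun X A hX => hS X A (by omega)
  obtain ⟨B₀, hB₀, hz₀⟩ := hmodel hℓ hdeg a C hC S hSC hS' hθ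
  obtain ⟨col, g, hg, hB⟩ := heven hB₀ hodd
  obtain ⟨X, h, κ₀, hX₀, hXc, J, hJ, hJ'⟩ := exists_halfCover hB (by omega) hodd
  obtain ⟨κ, hX, hκ⟩ := hX₀.normalize
  choose z hz1 hz2 using fun i => hz₀ (g i)
  refine ⟨X, h, κ, hX, hκ, hXc, ?_⟩
  intro τ F hF hFτ
  obtain ⟨X', hX', hXc'⟩ : ∃ X' : Finset V, (∀ v, v ∈ X' ↔ v ∈ X ∨ some v = τ) ∧
      X'.card ≤ 8 * t + 3 := by
    refine ⟨X ∪ τ.toFinset, fun v => ?_, ?_⟩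
    · simp [eq_comm]
    · have h1 := Finset.card_union_le X τ.toFinset
      have h2 : τ.toFinset.card ≤ 1 := by cases τ <;> simp
      omega
  have hfX : f * X'.card ≤ f * (8 * t + 3) := Nat.mul_le_mul_left _ hXc'
  have hcl : ∀ a ∈ wholeAt X h κ τ, ∀ b, G.Adj a b → b ∉ X' → b ∈ wholeAt X h κ τ := by
    intro a ha b hab hb
    rw [hX'] at hb
    push Not at hb
    exact hX.wholeAt_closed ha hab hb.1 hb.2
  rcases hS X' (wholeAt X h κ τ) (by omega) (by
      rintro a ⟨h1, -, -, h4⟩ ha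
      rw [hX'] at ha
      exact ha.elim h1 h4) (fun a ha b hab hb => hcl a ha b hab.1 hb) with hcase | hcase
  · exact (hcase F hF hFτ).trans hfX
  exfalso
  obtain ⟨J₁, hJ₁, hJ₁', hJ₁τ⟩ : ∃ J₁ ⊆ J, J.card ≤ J₁.card + 1 ∧
      ∀ i ∈ J₁, ∀ v ∈ B₀ (g i), some v ≠ τ := by
    by_cases hex : ∃ i ∈ J, ∃ v ∈ B₀ (g i), some v = τ
    · obtain ⟨i, hi, v, hv, rfl⟩ := hex
      refine ⟨J.erase i, Finset.erase_subset _ _, ?_, ?_⟩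
      · rw [Finset.card_erase_of_mem hi]; omega
      · intro j hj v' hv' hvv
        obtain rfl := Option.some.inj hvv
        exact Set.disjoint_left.1 (hB.disj j i (Finset.ne_of_mem_erase hj)) hv' hv
    · push Not at hex
      exact ⟨J, subset_rfl, by omega, fun i hi v hv => hex i hi v hv⟩
  have hzinj : Set.InjOn z J₁ := by
    intro i _ j _ hij
    by_contra hne
    exact Set.disjoint_left.1 (hB.disj i j hne) (hz2 i) (hij ▸ hz2 j)
  have hcard := hcase (J₁.image z) (by
    intro v hv
    obtain ⟨i, -, rfl⟩ := Finset.mem_image.1 hv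
    exact hz1 i) (by
    intro v hv
    obtain ⟨i, hi, rfl⟩ := Finset.mem_image.1 hv
    have hBX : ∀ v ∈ B₀ (g i), v ∉ X' := by
      intro v hv hvX
      rw [hX'] at hvX
      exact hvX.elim ((hJ' i (hJ₁ hi)).1 v hv) (hJ₁τ i hi v hv)
    refine ⟨fun hzA => ?_, hBX _ (hz2 i)⟩
    obtain ⟨v, hv, hvh⟩ := (hJ' i (hJ₁ hi)).2
    have := (hB₀.conn (g i)).induct (P := fun v => v ∈ wholeAt X h κ τ) (hz2 i) hzA
      (fun a _ b hb hab haA => hcl a haA b hab (hBX b hb)) v hv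
    exact hvh this.2.1)
  rw [Finset.card_image_of_injOn hzinj] at hcard
  omega

end BandCovers
end OddMinor

namespace OddMinor
open scoped Classical
open Relation

section PhaseSteps

variable {V : Type*} [Fintype V] {ρ : V → V → Prop}

/-- `U` has a colouring with clustering `N` for which the clusters meeting `S` are coloured `true`
and cover a small set. -/
def PhaseOK (ρ : V → V → Prop) (N A θ : ℕ) (U S : Finset V) : Prop :=
  ∃ (c : V → Bool) (R : Finset V), S ⊆ R ∧ R ⊆ U ∧ (∀ v ∈ R, c v = true) ∧
    (∀ u ∈ R, ∀ v ∈ U, v ∉ R → ρ u v → c v = false) ∧ R.card ≤ A * S.card ^ 2 ∧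
    (S.card ≤ θ → R = S) ∧
    ∀ M : Finset V, M ⊆ U → RConn ρ (M : Set V) → ∀ b, (∀ v ∈ M, c v = b) → M.card ≤ N

/-- A connected set meeting a set closed under the relevant steps is contained in it. -/
lemma RConn.subset_of_closed {M : Finset V} (hM : RConn ρ (M : Set V)) {D : Set V} {x : V}
    (hx : x ∈ M) (hxD : x ∈ D) (h : ∀ u ∈ M, ∀ v ∈ M, ρ u v → u ∈ D → v ∈ D) :
    ∀ v ∈ M, v ∈ D :=
  hM.induct (P := fun v => v ∈ D) hx hxD h

lemma phaseOK_of_small {N A θ Δ : ℕ} (hdeg : DegLE ρ Δ) (hA : 1 ≤ A) (hN : θ ≤ N)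
    {U S : Finset V} (hS : S ⊆ U) (hne : S.Nonempty) (hθ : S.card ≤ θ)
    (ih : ∀ U' ⊂ U, ∀ S' ⊆ U', S'.card ≤ θ * Δ → PhaseOK ρ N A θ U' S') :
    PhaseOK ρ N A θ U S := by
  obtain ⟨S', hS'⟩ : ∃ S' : Finset V, ∀ v, v ∈ S' ↔ v ∈ U \ S ∧ ∃ u ∈ S, ρ u v :=
    ⟨(U \ S).filter fun v => ∃ u ∈ S, ρ u v, fun v => by simp⟩
  have hcard : S'.card ≤ θ * Δ := by
    have h1 : S' ⊆ S.biUnion fun u => Finset.univ.filter (ρ u) := by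
      intro v hv
      obtain ⟨-, u, hu, huv⟩ := (hS' v).1 hv
      exact Finset.mem_biUnion.2 ⟨u, hu, by simpa using huv⟩
    exact (Finset.card_le_card h1).trans ((Finset.card_biUnion_le_card_mul _ _ _ fun u _ =>
      hdeg u).trans (Nat.mul_le_mul_right _ hθ))
  obtain ⟨c, R, h1, h2, h3, h4, h5, h6, h7⟩ := ih (U \ S)
    (Finset.sdiff_ssubset hS hne) S' (fun v hv => ((hS' v).1 hv).1) hcard
  have hout : ∀ u ∈ S, ∀ v ∈ U, v ∉ S → ρ u v → c v = true := fun u hu v hv hvS huv =>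
    h3 v (h1 ((hS' v).2 ⟨Finset.mem_sdiff.2 ⟨hv, hvS⟩, u, hu, huv⟩))
  refine ⟨fun v => if v ∈ S then true else !c v, S, subset_rfl, hS, ?_, ?_, ?_, fun _ => rfl, ?_⟩
  · intro v hv; simp [hv]
  · intro u hu v hv hvS huv
    simp [hvS, hout u hu v hv hvS huv]
  · nlinarith [Finset.card_pos.2 hne]
  · intro M hM hconn b hb
    by_cases hMS : ∃ x ∈ M, x ∈ S
    · obtain ⟨x, hx, hxS⟩ := hMS
      have hbt : b = true := by rw [← hb x hx]; simp [hxS]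
      have := hconn.subset_of_closed hx (D := {v | v ∈ S}) hxS (by
        intro u _ v hv huv huS
        by_contra hvS
        have h8 := hb v hv
        have h9 : v ∉ S := hvS
        simp [h9, hout u huS v (hM hv) hvS huv, hbt] at h8)
      exact (Finset.card_le_card (fun v hv => this v hv)).trans (hθ.trans hN)
    · push Not at hMS
      refine h7 M (fun v hv => Finset.mem_sdiff.2 ⟨hM hv, hMS v hv⟩) hconn (!b) ?_
      intro v hv
      have := hb v hv
      simp only [hMS v hv, if_false] at this
      rw [← this]; simp

lemma phaseOK_of_split {N A θ K : ℕ} (hρ : RSymm ρ) (hN : A * K ^ 2 ≤ N)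
    {U S P Q X : Finset V} (hS : S ⊆ U) (hθ : θ < S.card) (hK : S.card ≤ K)
    (hU : ∀ v, v ∈ U ↔ v ∈ P ∨ v ∈ Q ∨ v ∈ X) (hPX : Disjoint P X) (hQX : Disjoint Q X)
    (hPQ : Disjoint P Q) (hedge : ∀ u ∈ P, ∀ v ∈ Q, ¬ ρ u v)
    (hP : 5 * X.card < (S ∩ P).card) (hQ : 5 * X.card < (S ∩ Q).card)
    (ih : ∀ U' ⊂ U, ∀ S' ⊆ U', S'.card ≤ K → PhaseOK ρ N A θ U' S') :
    PhaseOK ρ N A θ U S := by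
  have hsum : (S ∩ P).card + (S ∩ Q).card ≤ S.card := by
    rw [← Finset.card_union_of_disjoint (hPQ.mono Finset.inter_subset_right
      Finset.inter_subset_right)]
    exact Finset.card_le_card (Finset.union_subset Finset.inter_subset_left
      Finset.inter_subset_left)
  have hPne : ∃ x, x ∈ S ∩ P := Finset.card_pos.1 (by omega)
  have hQne : ∃ x, x ∈ S ∩ Q := Finset.card_pos.1 (by omega)
  have hc1 := Finset.card_union_le (S ∩ P) X
  have hc2 := Finset.card_union_le (S ∩ Q) X
  obtain ⟨c₁, R₁, a1, a2, a3, a4, a5, -, a7⟩ := ih (P ∪ X) (by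
      refine Finset.ssubset_iff_subset_ne.2 ⟨fun v hv => (hU v).2 ?_, ?_⟩
      · rcases Finset.mem_union.1 hv with h | h
        · exact Or.inl h
        · exact Or.inr (Or.inr h)
      · intro h
        obtain ⟨x, hx⟩ := hQne
        have hxQ := (Finset.mem_inter.1 hx).2
        have : x ∈ P ∪ X := h ▸ (hU x).2 (Or.inr (Or.inl hxQ))
        rcases Finset.mem_union.1 this with h | h
        · exact Finset.disjoint_left.1 hPQ h hxQ
        · exact Finset.disjoint_left.1 hQX hxQ h) (S ∩ P ∪ X)
    (Finset.union_subset_union_left Finset.inter_subset_right) (by omega)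
  obtain ⟨c₂, R₂, b1, b2, b3, b4, b5, -, b7⟩ := ih (Q ∪ X) (by
      refine Finset.ssubset_iff_subset_ne.2 ⟨fun v hv => (hU v).2 ?_, ?_⟩
      · rcases Finset.mem_union.1 hv with h | h
        · exact Or.inr (Or.inl h)
        · exact Or.inr (Or.inr h)
      · intro h
        obtain ⟨x, hx⟩ := hPne
        have hxP := (Finset.mem_inter.1 hx).2
        have : x ∈ Q ∪ X := h ▸ (hU x).2 (Or.inl hxP)
        rcases Finset.mem_union.1 this with h | h
        · exact Finset.disjoint_left.1 hPQ hxP h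
        · exact Finset.disjoint_left.1 hPX hxP h) (S ∩ Q ∪ X)
    (Finset.union_subset_union_left Finset.inter_subset_right) (by omega)
  have hX1 : ∀ v ∈ X, v ∈ R₁ := fun v hv => a1 (Finset.mem_union_right _ hv)
  have hX2 : ∀ v ∈ X, v ∈ R₂ := fun v hv => b1 (Finset.mem_union_right _ hv)
  have hR1 : ∀ v ∈ R₁, v ∈ P ∨ v ∈ X := fun v hv => Finset.mem_union.1 (a2 hv)
  have hR2 : ∀ v ∈ R₂, v ∈ Q ∨ v ∈ X := fun v hv => Finset.mem_union.1 (b2 hv)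
  obtain ⟨c, hc⟩ : ∃ c : V → Bool, c = fun v => if v ∈ Q then c₂ v else c₁ v := ⟨_, rfl⟩
  have hcQ : ∀ v ∈ Q, c v = c₂ v := fun v hv => by rw [hc]; simp [hv]
  have hcP : ∀ v ∈ P, c v = c₁ v := fun v hv => by
    rw [hc]; simp [Finset.disjoint_left.1 hPQ hv]
  have hcX : ∀ v ∈ X, c v = true := fun v hv => by
    rw [hc]
    simp [Finset.disjoint_right.1 hQX hv, a3 v (hX1 v hv)]
  have hRt : ∀ v ∈ R₁ ∪ R₂, c v = true := by
    intro v hv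
    rcases Finset.mem_union.1 hv with h | h
    · rcases hR1 v h with h' | h'
      · rw [hcP v h', a3 v h]
      · exact hcX v h'
    · rcases hR2 v h with h' | h'
      · rw [hcQ v h', b3 v h]
      · exact hcX v h'
  have hRn : ∀ u ∈ R₁ ∪ R₂, ∀ v ∈ U, v ∉ R₁ ∪ R₂ → ρ u v → c v = false := by
    intro u hu v hv hvR huv
    rw [Finset.mem_union, not_or] at hvR
    rcases (hU v).1 hv with h | h | h
    · rw [hcP v h]
      refine a4 u ?_ v (Finset.mem_union_left _ h) hvR.1 huv
      rcases Finset.mem_union.1 hu with h' | h'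
      · exact h'
      · rcases hR2 u h' with h'' | h''
        · exact absurd (hρ huv) (hedge v h u h'')
        · exact hX1 u h''
    · rw [hcQ v h]
      refine b4 u ?_ v (Finset.mem_union_left _ h) hvR.2 huv
      rcases Finset.mem_union.1 hu with h' | h'
      · rcases hR1 u h' with h'' | h''
        · exact absurd huv (hedge u h'' v h)
        · exact hX2 u h''
      · exact h'
    · exact absurd (hX1 v h) hvR.1
  have hRc : (R₁ ∪ R₂).card ≤ A * S.card ^ 2 := by
    have h1 := Finset.card_union_le R₁ R₂
    have h2 : (S ∩ P ∪ X).card ^ 2 + (S ∩ Q ∪ X).card ^ 2 ≤ S.card ^ 2 := by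
      have h3 : (S ∩ P ∪ X).card ^ 2 ≤ ((S ∩ P).card + X.card) ^ 2 := Nat.pow_le_pow_left hc1 2
      have h4 : (S ∩ Q ∪ X).card ^ 2 ≤ ((S ∩ Q).card + X.card) ^ 2 := Nat.pow_le_pow_left hc2 2
      have h5 : ((S ∩ P).card + (S ∩ Q).card) ^ 2 ≤ S.card ^ 2 := Nat.pow_le_pow_left hsum 2
      have h6 := Nat.mul_le_mul hP.le (le_refl (S ∩ Q).card)
      have h7 := Nat.mul_le_mul (le_refl (S ∩ P).card) hQ.le
      have h8 := Nat.mul_le_mul hP.le (le_refl X.card)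
      nlinarith
    calc (R₁ ∪ R₂).card ≤ R₁.card + R₂.card := h1
      _ ≤ A * (S ∩ P ∪ X).card ^ 2 + A * (S ∩ Q ∪ X).card ^ 2 := Nat.add_le_add a5 b5
      _ = A * ((S ∩ P ∪ X).card ^ 2 + (S ∩ Q ∪ X).card ^ 2) := by ring
      _ ≤ A * S.card ^ 2 := Nat.mul_le_mul_left _ h2
  refine ⟨c, R₁ ∪ R₂, ?_, ?_, hRt, hRn, hRc, fun h => by omega, ?_⟩
  · intro v hv
    rcases (hU v).1 (hS hv) with h | h | h
    · exact Finset.mem_union_left _ (a1 (Finset.mem_union_left _ (Finset.mem_inter.2 ⟨hv, h⟩)))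
    · exact Finset.mem_union_right _ (b1 (Finset.mem_union_left _ (Finset.mem_inter.2 ⟨hv, h⟩)))
    · exact Finset.mem_union_left _ (hX1 v h)
  · intro v hv
    rw [hU]
    rcases Finset.mem_union.1 hv with h | h
    · exact (hR1 v h).imp_right Or.inr
    · exact Or.inr (hR2 v h)
  · intro M hM hconn b hb
    by_cases hMX : ∃ x ∈ M, x ∈ X
    · obtain ⟨x, hx, hxX⟩ := hMX
      have hbt : b = true := by rw [← hb x hx, hcX x hxX]
      have := hconn.subset_of_closed hx (D := {v | v ∈ R₁ ∪ R₂})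
        (Finset.mem_union_left _ (hX1 x hxX)) (by
          intro u _ v hv huv huR
          by_contra hvR
          have h8 := hb v hv
          rw [hRn u huR v (hM hv) hvR huv, hbt] at h8
          cases h8)
      exact (Finset.card_le_card (fun v hv => this v hv)).trans (hRc.trans
        ((Nat.mul_le_mul_left _ (Nat.pow_le_pow_left hK 2)).trans hN))
    · push Not at hMX
      by_cases hMP : ∃ x ∈ M, x ∈ P
      · obtain ⟨x, hx, hxP⟩ := hMP
        have := hconn.subset_of_closed hx (D := {v | v ∈ P}) hxP (by
          intro u _ v hv huv huP
          rcases (hU v).1 (hM hv) with h | h | h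
          · exact h
          · exact absurd huv (hedge u huP v h)
          · exact absurd h (hMX v hv))
        exact a7 M (fun v hv => Finset.mem_union_left _ (this v hv)) hconn b
          fun v hv => by rw [← hcP v (this v hv), hb v hv]
      · push Not at hMP
        have hMQ : ∀ v ∈ M, v ∈ Q := by
          intro v hv
          rcases (hU v).1 (hM hv) with h | h | h
          · exact absurd h (hMP v hv)
          · exact h
          · exact absurd h (hMX v hv)
        exact b7 M (fun v hv => Finset.mem_union_left _ (hMQ v hv)) hconn b
          fun v hv => by rw [← hcQ v (hMQ v hv), hb v hv]

end PhaseSteps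
end OddMinor

namespace OddMinor
open scoped Classical
open Relation

section PhaseParts

variable {V : Type*} [Fintype V] {ρ : V → V → Prop}

lemma phaseOK_of_parts {N A θ K q s Δ : ℕ} {ι κ : Type*} (hρ : RSymm ρ) (hdeg : DegLE ρ Δ)
    {U S X : Finset V} (part : V → Option ι) (bit : V → Bool) (key : V → κ) (T : ι → Finset V)
    (hS : S ⊆ U) (hθ : θ < S.card) (hK : S.card ≤ K) (hXU : X ⊆ U) (hXS : X.card ≤ S.card)
    (hsθ : s ≤ θ) (hθK : θ ≤ K) (hA : 1 + (2 * Δ + 1) * q ≤ A) (hAN : A * K ^ 2 ≤ N) (hqN : q ≤ N)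
    (hcross : ∀ u ∈ U, u ∉ X → ∀ v ∈ U, v ∉ X → ρ u v → ∀ τ, part u = some τ →
      part v ≠ some τ → key u = key v ∧ u ∈ T τ)
    (hin : ∀ u ∈ U, u ∉ X → ∀ v ∈ U, v ∉ X → ρ u v → ∀ τ, part u = some τ →
      part v = some τ → key u = key v)
    (hhalf : ∀ u ∈ U, u ∉ X → ∀ v ∈ U, v ∉ X → ρ u v → part u = none → part v = none →
      key u = key v ∨ bit u ≠ bit v)
    (hXT : ∀ u ∈ U, u ∉ X → ∀ τ, part u = some τ → ∀ x ∈ X, ρ u x → u ∈ T τ)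
    (hT : ∀ τ, ∀ v ∈ T τ, v ∈ U ∧ v ∉ X ∧ part v = some τ)
    (hST : ∀ v ∈ S, v ∉ X → ∀ τ, part v = some τ → v ∈ T τ)
    (hTs : ∀ τ, (T τ).card ≤ s)
    (hq : ∀ k, ∀ F : Finset V, (∀ v ∈ F, v ∈ U ∧ v ∉ X ∧ key v = k ∧
      ∀ τ, part v = some τ → v ∈ T τ) → F.card ≤ q)
    (ih : ∀ U' ⊂ U, ∀ S' ⊆ U', S'.card ≤ K → PhaseOK ρ N A θ U' S') :
    PhaseOK ρ N A θ U S := by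
  obtain ⟨D, hD⟩ : ∃ D : ι → Finset V, ∀ τ v, v ∈ D τ ↔ v ∈ U ∧ v ∉ X ∧ part v = some τ :=
    ⟨fun τ => Finset.univ.filter fun v => v ∈ U ∧ v ∉ X ∧ part v = some τ, fun τ v => by simp⟩
  have hTD : ∀ τ, T τ ⊆ D τ := fun τ v hv => (hD τ v).2 (hT τ v hv)
  have hDU : ∀ τ, D τ ⊂ U := by
    intro τ
    refine Finset.ssubset_iff_subset_ne.2 ⟨fun v hv => ((hD τ v).1 hv).1, fun h => ?_⟩
    have h1 : S ⊆ T τ := fun v hv => by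
      have h2 := (hD τ v).1 (h ▸ hS hv)
      exact hST v hv h2.2.1 τ h2.2.2
    have := Finset.card_le_card h1
    have := hTs τ
    omega
  have hex : ∀ τ, ∃ c : V → Bool, (∀ v ∈ T τ, c v = true) ∧
      (∀ u ∈ T τ, ∀ v ∈ D τ, v ∉ T τ → ρ u v → c v = false) ∧
      ∀ M : Finset V, M ⊆ D τ → RConn ρ (M : Set V) → ∀ b, (∀ v ∈ M, c v = b) → M.card ≤ N := by
    intro τ
    obtain ⟨c, R, h1, h2, h3, h4, h5, h6, h7⟩ := ih (D τ) (hDU τ) (T τ) (hTD τ)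
      ((hTs τ).trans (hsθ.trans hθK))
    have h8 := h6 ((hTs τ).trans hsθ)
    subst h8
    exact ⟨c, h3, h4, h7⟩
  choose cD hcT hcF hcN using hex
  obtain ⟨c, hc⟩ : ∃ c : V → Bool, c = fun v => if v ∈ X ∨ v ∈ S then true else
      match part v with
      | none => bit v
      | some τ => cD τ v := ⟨_, rfl⟩
  have hcX : ∀ v ∈ X, c v = true := fun v hv => by rw [hc]; simp [hv]
  have hcS : ∀ v ∈ S, c v = true := fun v hv => by rw [hc]; simp [hv]
  have hcb : ∀ v, v ∉ X → v ∉ S → part v = none → c v = bit v := fun v h1 h2 h3 => by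
    rw [hc]; simp [h1, h2, h3]
  have hcD : ∀ τ, ∀ v ∈ D τ, c v = cD τ v := by
    intro τ v hv
    have h1 := (hD τ v).1 hv
    by_cases hvS : v ∈ S
    · rw [hcS v hvS, hcT τ v (hST v hvS h1.2.1 τ h1.2.2)]
    · rw [hc]; simp [h1.2.1, hvS, h1.2.2]
  obtain ⟨Core, hCore⟩ : ∃ Core : V → Prop, ∀ v, Core v ↔ v ∈ U ∧ v ∉ X ∧
      ∀ τ, part v = some τ → v ∈ T τ := ⟨_, fun _ => Iff.rfl⟩
  have hTc : ∀ τ, ∀ v ∈ T τ, c v = true := fun τ v hv => by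
    rw [hcD τ v (hTD τ hv), hcT τ v hv]
  have hSCore : ∀ v ∈ S, v ∉ X → Core v := fun v hv hvX =>
    (hCore v).2 ⟨hS hv, hvX, hST v hv hvX⟩
  have hkey : ∀ u v, Core u → Core v → ρ u v → c u = c v → u ∉ S → v ∉ S → key u = key v := by
    intro u v hu hv huv hcc huS hvS
    obtain ⟨hu1, hu2, hu3⟩ := (hCore u).1 hu
    obtain ⟨hv1, hv2, hv3⟩ := (hCore v).1 hv
    rcases hpu : part u with _ | τ
    · rcases hpv : part v with _ | τ
      · rcases hhalf u hu1 hu2 v hv1 hv2 huv hpu hpv with h | h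
        · exact h
        · exact absurd (by rw [← hcb u hu2 huS hpu, hcc, hcb v hv2 hvS hpv]) h
      · exact (hcross v hv1 hv2 u hu1 hu2 (hρ huv) τ hpv (by rw [hpu]; simp)).1.symm
    · by_cases hpv : part v = some τ
      · exact hin u hu1 hu2 v hv1 hv2 huv τ hpu hpv
      · exact (hcross u hu1 hu2 v hv1 hv2 huv τ hpu hpv).1
  have hcoreStep : ∀ u v, Core u ∨ u ∈ X → ρ u v → v ∈ U → c v = true → Core v ∨ v ∈ X := by
    intro u v hu huv hvU hcv
    by_cases hvX : v ∈ X
    · exact Or.inr hvX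
    · refine Or.inl ((hCore v).2 ⟨hvU, hvX, fun τ hτ => ?_⟩)
      rcases hu with hu | hu
      · obtain ⟨hu1, hu2, hu3⟩ := (hCore u).1 hu
        by_cases hpu : part u = some τ
        · by_contra hvT
          have hvD := (hD τ v).2 ⟨hvU, hvX, hτ⟩
          rw [hcD τ v hvD, hcF τ u (hu3 τ hpu) v hvD hvT huv] at hcv
          cases hcv
        · exact (hcross v hvU hvX u hu1 hu2 (hρ huv) τ hτ hpu).2
      · exact hXT v hvU hvX τ hτ u hu (hρ huv)
  obtain ⟨R, hR⟩ : ∃ R : Finset V, ∀ v, v ∈ R ↔ ∃ x ∈ S ∪ X,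
      v ∈ rcomp ρ {v | v ∈ U ∧ c v = true} x :=
    ⟨Finset.univ.filter fun v => ∃ x ∈ S ∪ X, v ∈ rcomp ρ {v | v ∈ U ∧ c v = true} x,
      fun v => by simp⟩
  have hSX : ∀ v ∈ S ∪ X, v ∈ U ∧ c v = true := by
    intro v hv
    rcases Finset.mem_union.1 hv with h | h
    · exact ⟨hS h, hcS v h⟩
    · exact ⟨hXU h, hcX v h⟩
  have hR1 : ∀ v ∈ R, v ∈ U ∧ c v = true := by
    intro v hv
    obtain ⟨x, hx, hxv⟩ := (hR v).1 hv
    exact rcomp_subset (S := {v | v ∈ U ∧ c v = true}) (hSX x hx) hxv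
  have hSXR : ∀ v ∈ S ∪ X, v ∈ R := fun v hv => (hR v).2 ⟨v, hv, mem_rcomp_self v⟩
  have hR2 : ∀ u ∈ R, ∀ v ∈ U, v ∉ R → ρ u v → c v = false := by
    intro u hu v hv hvR huv
    obtain ⟨x, hx, hxu⟩ := (hR u).1 hu
    by_contra h
    exact hvR ((hR v).2 ⟨x, hx, rcomp_closed hxu huv ⟨hv, by simpa using h⟩⟩)
  have hRcard : R.card ≤ A * S.card ^ 2 := by
    obtain ⟨L, hL⟩ : ∃ L : Finset V, L = S ∪ (S ∪ X).biUnion fun u => Finset.univ.filter (ρ u) :=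
      ⟨_, rfl⟩
    have hLc : L.card ≤ (2 * Δ + 1) * S.card := by
      have h1 : ((S ∪ X).biUnion fun u => Finset.univ.filter (ρ u)).card ≤ (S ∪ X).card * Δ :=
        Finset.card_biUnion_le_card_mul _ _ _ fun u _ => hdeg u
      have h2 := Finset.card_union_le S X
      have h3 := Finset.card_union_le S ((S ∪ X).biUnion fun u => Finset.univ.filter (ρ u))
      rw [← hL] at h3
      have h4 : (S ∪ X).card * Δ ≤ (2 * S.card) * Δ := Nat.mul_le_mul_right _ (by omega)
      nlinarith
    obtain ⟨Un, hUn⟩ : ∃ Un : κ → Finset V, ∀ k v, v ∈ Un k ↔ v ∈ U ∧ v ∉ X ∧ key v = k ∧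
        ∀ τ, part v = some τ → v ∈ T τ :=
      ⟨fun k => Finset.univ.filter fun v => v ∈ U ∧ v ∉ X ∧ key v = k ∧
        ∀ τ, part v = some τ → v ∈ T τ, fun k v => by simp⟩
    have hRsub : R ⊆ X ∪ (L.image key).biUnion Un := by
      intro v hv
      obtain ⟨x, hx, hxv⟩ := (hR v).1 hv
      have hmem : ∀ v, v ∉ X → Core v → key v ∈ L.image key →
          v ∈ X ∪ (L.image key).biUnion Un := by
        intro v hvX hv hk
        have h1 := (hCore v).1 hv
        exact Finset.mem_union_right _ (Finset.mem_biUnion.2 ⟨key v, hk, (hUn _ v).2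
          ⟨h1.1, hvX, rfl, h1.2.2⟩⟩)
      have hcore' : ∀ v, v ∈ X ∪ (L.image key).biUnion Un →
          v ∈ X ∨ Core v ∧ key v ∈ L.image key := by
        intro v hv
        rcases Finset.mem_union.1 hv with h | h
        · exact Or.inl h
        · obtain ⟨k, hk, hk2⟩ := Finset.mem_biUnion.1 h
          obtain ⟨h1, h2, h3, h4⟩ := (hUn k v).1 hk2
          exact Or.inr ⟨(hCore v).2 ⟨h1, h2, h4⟩, h3 ▸ hk⟩
      refine (rconn_rcomp (S := {v | v ∈ U ∧ c v = true}) hρ).induct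
        (P := fun v => v ∈ X ∪ (L.image key).biUnion Un) (mem_rcomp_self x) ?_ ?_ v hxv
      · by_cases hxX : x ∈ X
        · exact Finset.mem_union_left _ hxX
        · have hxS : x ∈ S := (Finset.mem_union.1 hx).resolve_right hxX
          exact hmem x hxX (hSCore x hxS hxX) (Finset.mem_image_of_mem _ (by
            rw [hL]; exact Finset.mem_union_left _ hxS))
      · intro a ha b hb hab haP
        have haT := rcomp_subset (S := {v | v ∈ U ∧ c v = true}) (hSX x hx) ha
        have hbT := rcomp_subset (S := {v | v ∈ U ∧ c v = true}) (hSX x hx) hb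
        by_cases hbX : b ∈ X
        · exact Finset.mem_union_left _ hbX
        have haC := hcore' a haP
        have hbC : Core b := (hcoreStep a b (haC.symm.imp_left And.left) hab hbT.1
          hbT.2).resolve_right hbX
        refine hmem b hbX hbC ?_
        by_cases haS : a ∈ S ∪ X
        · refine Finset.mem_image_of_mem _ ?_
          rw [hL]
          exact Finset.mem_union_right _ (Finset.mem_biUnion.2 ⟨a, haS, by simpa using hab⟩)
        · by_cases hbS : b ∈ S
          · exact Finset.mem_image_of_mem _ (by rw [hL]; exact Finset.mem_union_left _ hbS)
          · rw [Finset.mem_union, not_or] at haS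
            obtain ⟨h1, h2⟩ := haC.resolve_left haS.2
            rw [← hkey a b h1 hbC hab (haT.2.trans hbT.2.symm) haS.1 hbS]
            exact h2
    have h1 : ((L.image key).biUnion Un).card ≤ (L.image key).card * q :=
      Finset.card_biUnion_le_card_mul _ _ _ fun k _ => hq k (Un k) fun v hv => (hUn k v).1 hv
    have h2 : (L.image key).card ≤ L.card := Finset.card_image_le
    have h3 := (Finset.card_le_card hRsub).trans (Finset.card_union_le _ _)
    have h4 : (L.image key).card * q ≤ ((2 * Δ + 1) * S.card) * q :=
      Nat.mul_le_mul_right _ (h2.trans hLc)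
    have h5 : (1 + (2 * Δ + 1) * q) * S.card ≤ A * S.card ^ 2 :=
      Nat.mul_le_mul hA (by nlinarith)
    calc R.card ≤ S.card + ((2 * Δ + 1) * S.card) * q := by omega
      _ = (1 + (2 * Δ + 1) * q) * S.card := by ring
      _ ≤ _ := h5
  refine ⟨c, R, fun v hv => hSXR v (Finset.mem_union_left _ hv), fun v hv => (hR1 v hv).1,
    fun v hv => (hR1 v hv).2, hR2, hRcard, fun h => by omega, ?_⟩
  intro M hM hconn b hb
  by_cases hMZ : ∃ x ∈ M, x ∈ S ∪ X
  · obtain ⟨x, hx, hxS⟩ := hMZ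
    have hbt : b = true := by rw [← hb x hx, (hSX x hxS).2]
    have := hconn.subset_of_closed hx (D := {v | v ∈ R}) (hSXR x hxS) (by
      intro u _ v hv huv huR
      by_contra hvR
      have h8 := hb v hv
      rw [hR2 u huR v (hM hv) hvR huv, hbt] at h8
      cases h8)
    exact (Finset.card_le_card (fun v hv => this v hv)).trans (hRcard.trans
      ((Nat.mul_le_mul_left _ (Nat.pow_le_pow_left hK 2)).trans hAN))
  push Not at hMZ
  have hMS : ∀ v ∈ M, v ∉ S := fun v hv h => hMZ v hv (Finset.mem_union_left _ h)
  have hMX : ∀ v ∈ M, v ∉ X := fun v hv h => hMZ v hv (Finset.mem_union_right _ h)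
  by_cases hMC : ∃ x ∈ M, ¬ Core x
  · obtain ⟨x, hx, hxC⟩ := hMC
    have h1 : ∃ τ, part x = some τ ∧ x ∉ T τ := by
      by_contra h
      push Not at h
      exact hxC ((hCore x).2 ⟨hM hx, hMX x hx, h⟩)
    obtain ⟨τ, hτ, hxT⟩ := h1
    have := hconn.subset_of_closed hx (D := {v | v ∈ D τ ∧ v ∉ T τ})
      ⟨(hD τ x).2 ⟨hM hx, hMX x hx, hτ⟩, hxT⟩ (by
        intro u hu v hv huv huD
        have h2 := (hD τ u).1 huD.1
        have hvD : v ∈ D τ := by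
          refine (hD τ v).2 ⟨hM hv, hMX v hv, ?_⟩
          by_contra hpv
          exact huD.2 (hcross u h2.1 h2.2.1 v (hM hv) (hMX v hv) huv τ h2.2.2 hpv).2
        refine ⟨hvD, fun hvT => ?_⟩
        have h3 := hb u hu
        rw [← hb v hv, hTc τ v hvT, hcD τ u huD.1, hcF τ v hvT u huD.1 huD.2 (hρ huv)] at h3
        cases h3)
    exact hcN τ M (fun v hv => (this v hv).1) hconn b
      fun v hv => by rw [← hcD τ v (this v hv).1, hb v hv]
  · push Not at hMC
    rcases M.eq_empty_or_nonempty with h | ⟨x, hx⟩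
    · rw [h]; simp
    · have := hconn.subset_of_closed hx (D := {v | key v = key x}) rfl (by
        intro u hu v hv huv huk
        exact (hkey u v (hMC u hu) (hMC v hv) huv ((hb u hu).trans (hb v hv).symm)
          (hMS u hu) (hMS v hv)).symm.trans huk)
      refine (hq (key x) M fun v hv => ?_).trans hqN
      obtain ⟨h1, h2, h3⟩ := (hCore v).1 (hMC v hv)
      exact ⟨h1, h2, this v hv, h3⟩

end PhaseParts
end OddMinor

namespace OddMinor
open scoped Classical
open Relation

section Phases

variable {V : Type*} [Fintype V] {ι : Type*} {G : SimpleGraph V} {C : Set V}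
  {cl : V → ι} {N₁ : ℕ}

/-- Adjacency in `C`, or membership in a common class of `cl`. -/
def classRel (G : SimpleGraph V) (C : Set V) (cl : V → ι) (a b : V) : Prop :=
  bandRel G C a b ∨ cl a = cl b

omit [Fintype V] in
lemma classRel_rsymm : RSymm (classRel G C cl) := by
  rintro a b (h | h)
  · exact Or.inl ⟨h.1.symm, h.2.2, h.2.1⟩
  · exact Or.inr h.symm

lemma classRel_degLE {Δ : ℕ} (hdeg : DegLE G.Adj Δ)
    (hcl : ∀ γ, ∀ F : Finset V, (∀ v ∈ F, cl v = γ) → F.card ≤ N₁) :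
    DegLE (classRel G C cl) (Δ + N₁) := by
  intro v
  have h1 : Finset.univ.filter (classRel G C cl v) ⊆
      Finset.univ.filter (G.Adj v) ∪ Finset.univ.filter fun u => cl v = cl u := by
    intro u hu
    simp only [Finset.mem_filter, Finset.mem_univ, true_and, Finset.mem_union] at hu ⊢
    exact hu.imp_left And.left
  refine (Finset.card_le_card h1).trans ((Finset.card_union_le _ _).trans
    (Nat.add_le_add (hdeg v) (hcl (cl v) _ fun u hu => ?_)))
  simp only [Finset.mem_filter, Finset.mem_univ, true_and] at hu
  exact hu.symm

/-- The vertices whose class meets `X`. -/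
lemma exists_saturation (cl : V → ι)
    (hcl : ∀ γ, ∀ F : Finset V, (∀ v ∈ F, cl v = γ) → F.card ≤ N₁) (U X : Finset V) :
    ∃ Y : Finset V, (∀ v, v ∈ Y ↔ v ∈ U ∧ ∃ x ∈ X, cl v = cl x) ∧ Y.card ≤ N₁ * X.card := by
  obtain ⟨Y, hY⟩ : ∃ Y : Finset V, ∀ v, v ∈ Y ↔ v ∈ U ∧ ∃ x ∈ X, cl v = cl x :=
    ⟨Finset.univ.filter fun v => v ∈ U ∧ ∃ x ∈ X, cl v = cl x, fun v => by simp⟩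
  refine ⟨Y, hY, ?_⟩
  have h1 : Y ⊆ X.biUnion fun x => Finset.univ.filter fun v => cl v = cl x := by
    intro v hv
    obtain ⟨-, x, hx, hvx⟩ := (hY v).1 hv
    exact Finset.mem_biUnion.2 ⟨x, hx, by simpa using hvx⟩
  refine (Finset.card_le_card h1).trans ((Finset.card_biUnion_le_card_mul _ _ N₁ fun x _ =>
    hcl (cl x) _ fun v hv => by simpa using hv).trans (mul_comm _ _).le)

lemma phaseOK_of_not_unsplit {N A θ K k : ℕ} (hN : A * K ^ 2 ≤ N)
    (hcl : ∀ γ, ∀ F : Finset V, (∀ v ∈ F, cl v = γ) → F.card ≤ N₁)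
    (hconn : ∀ v ∈ C, RConn (bandRel G C) {u | cl u = cl v})
    {U S : Finset V} (hUC : ∀ v ∈ U, v ∈ C) (hS : S ⊆ U) (hθ : θ < S.card) (hK : S.card ≤ K)
    (hun : ¬ Unsplit (bandRel G C) S k (6 * N₁))
    (ih : ∀ U' ⊂ U, ∀ S' ⊆ U', S'.card ≤ K → PhaseOK (classRel G C cl) N A θ U' S') :
    PhaseOK (classRel G C cl) N A θ U S := by
  unfold Unsplit at hun
  push Not at hun
  obtain ⟨X, B, -, hBX, hB, ⟨F₁, hF₁, hF₁B, hF₁c⟩, F₂, hF₂, hF₂B, hF₂c⟩ := hun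
  obtain ⟨Y, hY, hYc⟩ := exists_saturation cl hcl U X
  have hYc' : 6 * Y.card ≤ 6 * N₁ * X.card := by rw [mul_assoc]; exact Nat.mul_le_mul_left _ hYc
  obtain ⟨P, hP⟩ : ∃ P : Finset V, ∀ v, v ∈ P ↔ v ∈ U ∧ v ∉ Y ∧ v ∈ B :=
    ⟨Finset.univ.filter fun v => v ∈ U ∧ v ∉ Y ∧ v ∈ B, fun v => by simp⟩
  obtain ⟨Q, hQ⟩ : ∃ Q : Finset V, ∀ v, v ∈ Q ↔ v ∈ U ∧ v ∉ Y ∧ v ∉ B :=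
    ⟨Finset.univ.filter fun v => v ∈ U ∧ v ∉ Y ∧ v ∉ B, fun v => by simp⟩
  have hXY : ∀ v ∈ U, v ∉ Y → v ∉ X := fun v hvU hvY hvX => hvY ((hY v).2 ⟨hvU, v, hvX, rfl⟩)
  have hlarge : ∀ F Z : Finset V, F ⊆ S → (∀ v ∈ F, v ∉ Y → v ∈ Z) → 6 * N₁ * X.card < F.card →
      5 * Y.card < (S ∩ Z).card := by
    intro F Z hFS hFZ hFc
    have h1 : F ⊆ Y ∪ (S ∩ Z) := by
      intro v hv
      by_cases hvY : v ∈ Y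
      · exact Finset.mem_union_left _ hvY
      · exact Finset.mem_union_right _ (Finset.mem_inter.2 ⟨hFS hv, hFZ v hv hvY⟩)
    have h2 := (Finset.card_le_card h1).trans (Finset.card_union_le _ _)
    omega
  refine phaseOK_of_split (P := P) (Q := Q) (X := Y) classRel_rsymm hN hS hθ hK ?_ ?_ ?_ ?_ ?_
    (hlarge F₁ P hF₁ (fun v hv hvY => (hP v).2 ⟨hS (hF₁ hv), hvY, hF₁B v hv⟩) hF₁c)
    (hlarge F₂ Q hF₂ (fun v hv hvY => (hQ v).2 ⟨hS (hF₂ hv), hvY, (hF₂B v hv).1⟩) hF₂c) ih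
  · intro v
    rw [hP, hQ]
    constructor
    · intro hv
      by_cases h1 : v ∈ Y <;> by_cases h2 : v ∈ B <;> simp [hv, h1, h2]
    · rintro (h | h | h)
      · exact h.1
      · exact h.1
      · exact ((hY v).1 h).1
  · exact Finset.disjoint_left.2 fun v hv => ((hP v).1 hv).2.1
  · exact Finset.disjoint_left.2 fun v hv => ((hQ v).1 hv).2.1
  · exact Finset.disjoint_left.2 fun v hv hv' => ((hQ v).1 hv').2.2 ((hP v).1 hv).2.2
  · intro u hu v hv huv
    obtain ⟨hu1, hu2, hu3⟩ := (hP u).1 hu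
    obtain ⟨hv1, hv2, hv3⟩ := (hQ v).1 hv
    rcases huv with huv | huv
    · exact hv3 (hB u hu3 v huv (hXY v hv1 hv2))
    · refine hv3 ((hconn u (hUC u hu1)).induct (P := fun w => w ∈ B) (x := u) rfl hu3 ?_ v huv.symm)
      intro a _ b hb hab haB
      exact hB a haB b hab fun hbX => hu2 ((hY u).2 ⟨hu1, b, hbX, hb.symm⟩)

lemma phaseOK_of_halfCover {N A θ K Δ n₀ b s q : ℕ} (hN₁ : 1 ≤ N₁)
    (hdeg : DegLE (classRel G C cl) Δ)
    (hcl : ∀ γ, ∀ F : Finset V, (∀ v ∈ F, cl v = γ) → F.card ≤ N₁)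
    (hconn : ∀ v ∈ C, RConn (bandRel G C) {u | cl u = cl v})
    (hs : b + (N₁ * n₀ + N₁) * Δ ≤ s) (hq : N₁ + N₁ * s ≤ q) (hn₀ : N₁ * n₀ ≤ θ)
    (hsθ : s ≤ θ) (hθK : θ ≤ K) (hA : 1 + (2 * Δ + 1) * q ≤ A) (hAN : A * K ^ 2 ≤ N) (hqN : q ≤ N)
    {U S : Finset V} (hUC : ∀ v ∈ U, v ∈ C) (hS : S ⊆ U) (hθ : θ < S.card) (hK : S.card ≤ K)
    {X : Finset V} {h : V → Option Bool} {κ : V → Option V} (hX : HalfCover G X h κ)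
    (hκ : ∀ w v, κ w = some v → h v ≠ none) (hXc : X.card ≤ n₀)
    (hSw : ∀ τ, ∀ F ⊆ S, (∀ v ∈ F, v ∈ wholeAt X h κ τ) → F.card ≤ b)
    (ih : ∀ U' ⊂ U, ∀ S' ⊆ U', S'.card ≤ K → PhaseOK (classRel G C cl) N A θ U' S') :
    PhaseOK (classRel G C cl) N A θ U S := by
  obtain ⟨Y, hY, hYc⟩ := exists_saturation cl hcl U X
  have hYc' : Y.card ≤ N₁ * n₀ := hYc.trans (Nat.mul_le_mul_left _ hXc)
  have hXY : ∀ v ∈ U, v ∉ Y → v ∉ X := fun v hvU hvY hvX => hvY ((hY v).2 ⟨hvU, v, hvX, rfl⟩)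
  have hwhole : ∀ v ∈ U, v ∉ Y → h v = none → v ∈ wholeAt X h κ (κ v) :=
    fun v hvU hvY hv => ⟨hXY v hvU hvY, hv, rfl, fun h' => hκ v v h'.symm hv⟩
  have hclass : ∀ w ∈ U, w ∉ Y → h w = none → ∀ u, cl u = cl w →
      u ∈ wholeAt X h κ (κ w) ∨ (κ w).map cl = some (cl w) := by
    intro w hw hwY hhw u hu
    by_cases hz : (κ w).map cl = some (cl w)
    · exact Or.inr hz
    · refine Or.inl ((hconn w (hUC w hw)).induct (P := fun u => u ∈ wholeAt X h κ (κ w))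
        (x := w) rfl (hwhole w hw hwY hhw) ?_ u hu)
      intro a _ c hc hac ha
      refine hX.wholeAt_closed ha hac.1 (fun hcX => hwY ((hY w).2 ⟨hw, c, hcX, hc.symm⟩)) ?_
      intro hcw
      refine hz ?_
      rw [← hcw]
      exact congrArg some hc
  obtain ⟨part, hpart⟩ : ∃ part : V → Option (Option V),
      part = fun v => if h v = none then some (κ v) else none := ⟨_, rfl⟩
  have hpart1 : ∀ v τ, part v = some τ ↔ h v = none ∧ κ v = τ := by
    intro v τ
    rw [hpart]
    by_cases hv : h v = none <;> simp [hv]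
  have hpart2 : ∀ v, part v = none ↔ h v ≠ none := by
    intro v
    rw [hpart]
    by_cases hv : h v = none <;> simp [hv]
  obtain ⟨key, hkey⟩ : ∃ key : V → Option ι,
      key = fun v => if h v = none then (κ v).map cl else some (cl v) := ⟨_, rfl⟩
  have hkey1 : ∀ v, h v = none → key v = (κ v).map cl := fun v hv => by rw [hkey]; simp [hv]
  have hkey2 : ∀ v, h v ≠ none → key v = some (cl v) := fun v hv => by rw [hkey]; simp [hv]
  obtain ⟨T, hT⟩ : ∃ T : Option V → Finset V, ∀ τ v, v ∈ T τ ↔ (v ∈ U ∧ v ∉ Y ∧ part v = some τ) ∧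
      (v ∈ S ∨ ∃ y, (y ∈ Y ∨ τ.map cl = some (cl y)) ∧ classRel G C cl y v) :=
    ⟨fun τ => Finset.univ.filter fun v => (v ∈ U ∧ v ∉ Y ∧ part v = some τ) ∧
      (v ∈ S ∨ ∃ y, (y ∈ Y ∨ τ.map cl = some (cl y)) ∧ classRel G C cl y v), fun τ v => by simp⟩
  have hTs : ∀ τ, (T τ).card ≤ s := by
    intro τ
    obtain ⟨F, hF⟩ : ∃ F : Finset V, ∀ v, v ∈ F ↔ v ∈ S ∧ v ∈ wholeAt X h κ τ :=
      ⟨Finset.univ.filter fun v => v ∈ S ∧ v ∈ wholeAt X h κ τ, fun v => by simp⟩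
    obtain ⟨Z, hZ⟩ : ∃ Z : Finset V, ∀ v, v ∈ Z ↔ τ.map cl = some (cl v) :=
      ⟨Finset.univ.filter fun v => τ.map cl = some (cl v), fun v => by simp⟩
    have hZc : Z.card ≤ N₁ := by
      rcases τ with _ | z
      · have : Z = ∅ := Finset.eq_empty_of_forall_notMem fun v hv => by simpa using (hZ v).1 hv
        rw [this]; simp
      · exact hcl (cl z) Z fun v hv => by simpa using ((hZ v).1 hv).symm
    have h1 : T τ ⊆ F ∪ (Y ∪ Z).biUnion fun y => Finset.univ.filter (classRel G C cl y) := by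
      intro v hv
      obtain ⟨⟨hvU, hvY, hvp⟩, hv2⟩ := (hT τ v).1 hv
      rcases hv2 with hvS | ⟨y, hy, hyv⟩
      · obtain ⟨h3, h4⟩ := (hpart1 v τ).1 hvp
        exact Finset.mem_union_left _ ((hF v).2 ⟨hvS, h4 ▸ hwhole v hvU hvY h3⟩)
      · refine Finset.mem_union_right _ (Finset.mem_biUnion.2 ⟨y, ?_, by simpa using hyv⟩)
        rw [Finset.mem_union, hZ]
        exact hy
    have h2 := (Finset.card_le_card h1).trans (Finset.card_union_le _ _)
    have h3 := hSw τ F (fun v hv => ((hF v).1 hv).1) fun v hv => ((hF v).1 hv).2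
    have h4 : ((Y ∪ Z).biUnion fun y => Finset.univ.filter (classRel G C cl y)).card ≤
        (Y ∪ Z).card * Δ := Finset.card_biUnion_le_card_mul _ _ _ fun y _ => hdeg y
    have h5 : (Y ∪ Z).card * Δ ≤ (N₁ * n₀ + N₁) * Δ :=
      Nat.mul_le_mul_right _ ((Finset.card_union_le _ _).trans (Nat.add_le_add hYc' hZc))
    omega
  refine phaseOK_of_parts (X := Y) (s := s) (q := q) (Δ := Δ) classRel_rsymm hdeg part
    (fun v => (h v).getD false) key T hS hθ hK (fun v hv => ((hY v).1 hv).1) (by omega) hsθ hθK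
    hA hAN hqN ?_ ?_ ?_ ?_ ?_ ?_ hTs ?_ ih
  · intro u hu huY v hv hvY huv τ hpu hpv
    obtain ⟨hhu, hκu⟩ := (hpart1 u τ).1 hpu
    rcases huv with huv | huv
    · rcases hhv : h v with _ | c
      · have := hX.whole_whole u v (hXY u hu huY) (hXY v hv hvY) hhu hhv huv.1
        exact absurd ((hpart1 v τ).2 ⟨hhv, by rw [← this, hκu]⟩) hpv
      · have h1 := hX.whole_half u v c (hXY u hu huY) (hXY v hv hvY) hhu hhv huv.1
        have h2 : τ = some v := hκu ▸ h1
        refine ⟨by rw [hkey1 u hhu, hkey2 v (by simp [hhv]), h1]; rfl, (hT τ u).2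
          ⟨⟨hu, huY, hpu⟩, Or.inr ⟨v, Or.inr (by rw [h2]; rfl), ?_⟩⟩⟩
        exact classRel_rsymm (Or.inl huv)
    · have h1 : (κ u).map cl = some (cl u) := by
        rcases hclass u hu huY hhu v huv.symm with h' | h'
        · exact absurd ((hpart1 v τ).2 ⟨h'.2.1, h'.2.2.1.trans hκu⟩) hpv
        · exact h'
      refine ⟨?_, (hT τ u).2 ⟨⟨hu, huY, hpu⟩, Or.inr ?_⟩⟩
      · rw [hkey1 u hhu, h1, huv]
        by_cases hhv : h v = none
        · rw [hkey1 v hhv]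
          rcases hclass v hv hvY hhv u huv with h' | h'
          · exact absurd ((hpart1 v τ).2 ⟨hhv, h'.2.2.1.symm.trans hκu⟩) hpv
          · exact h'.symm
        · rw [hkey2 v hhv]
      · exact ⟨u, Or.inr (hκu ▸ h1), Or.inr rfl⟩
  · intro u hu huY v hv hvY huv τ hpu hpv
    obtain ⟨hhu, hκu⟩ := (hpart1 u τ).1 hpu
    obtain ⟨hhv, hκv⟩ := (hpart1 v τ).1 hpv
    rw [hkey1 u hhu, hkey1 v hhv, hκu, hκv]
  · intro u hu huY v hv hvY huv hpu hpv
    have hhu := (hpart2 u).1 hpu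
    have hhv := (hpart2 v).1 hpv
    rcases huv with huv | huv
    · obtain ⟨c, hc⟩ := Option.ne_none_iff_exists'.1 hhu
      obtain ⟨c', hc'⟩ := Option.ne_none_iff_exists'.1 hhv
      refine Or.inr ?_
      rw [hc, hc']
      exact hX.half_half u v c c' (hXY u hu huY) (hXY v hv hvY) hc hc' huv.1
    · exact Or.inl (by rw [hkey2 u hhu, hkey2 v hhv, huv])
  · intro u hu huY τ hpu x hx hux
    exact (hT τ u).2 ⟨⟨hu, huY, hpu⟩, Or.inr ⟨x, Or.inl hx, classRel_rsymm hux⟩⟩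
  · exact fun τ v hv => ((hT τ v).1 hv).1
  · exact fun v hv hvY τ hpv => (hT τ v).2 ⟨⟨hS hv, hvY, hpv⟩, Or.inl hv⟩
  · intro k F hF
    obtain ⟨F₁, hF₁⟩ : ∃ F₁ : Finset V, ∀ v, v ∈ F₁ ↔ k = some (cl v) :=
      ⟨Finset.univ.filter fun v => k = some (cl v), fun v => by simp⟩
    obtain ⟨L, hL⟩ : ∃ L : Finset (Option V), ∀ τ, τ ∈ L ↔ τ.map cl = k :=
      ⟨Finset.univ.filter fun τ => τ.map cl = k, fun v => by simp⟩
    have hF₁c : F₁.card ≤ N₁ := by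
      rcases k with _ | γ
      · have : F₁ = ∅ := Finset.eq_empty_of_forall_notMem fun v hv => by simpa using (hF₁ v).1 hv
        rw [this]; simp
      · exact hcl γ F₁ fun v hv => by simpa using ((hF₁ v).1 hv).symm
    have hLc : L.card ≤ N₁ := by
      rcases k with _ | γ
      · have : L ⊆ {none} := fun τ hτ => by simpa using (hL τ).1 hτ
        exact (Finset.card_le_card this).trans (by simpa using hN₁)
      · have : L ⊆ F₁.image some := by
          intro τ hτ
          have h1 := (hL τ).1 hτ
          rcases τ with _ | z
          · simp at h1
          · exact Finset.mem_image_of_mem _ ((hF₁ z).2 h1.symm)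
        exact (Finset.card_le_card this).trans (Finset.card_image_le.trans hF₁c)
    have hsub : F ⊆ F₁ ∪ L.biUnion T := by
      intro v hv
      obtain ⟨-, -, h3, h4⟩ := hF v hv
      by_cases hhv : h v = none
      · refine Finset.mem_union_right _ (Finset.mem_biUnion.2 ⟨κ v, (hL _).2 ?_, h4 (κ v)
          ((hpart1 v _).2 ⟨hhv, rfl⟩)⟩)
        rw [← hkey1 v hhv, h3]
      · exact Finset.mem_union_left _ ((hF₁ v).2 (by rw [← h3, hkey2 v hhv]))
    have h1 := (Finset.card_le_card hsub).trans (Finset.card_union_le _ _)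
    have h2 : (L.biUnion T).card ≤ L.card * s :=
      Finset.card_biUnion_le_card_mul _ _ _ fun τ _ => hTs τ
    have h3 : L.card * s ≤ N₁ * s := Nat.mul_le_mul_right _ hLc
    omega

end Phases

/-- A band of bounded width in a bounded degree graph without odd clique models can be coloured
with two colours and bounded clustering, even when small connected classes are contracted. -/
theorem exists_phase_coloring (t Δ N₁ : ℕ) (hN₁ : 1 ≤ N₁) : ∃ N : ℕ, ∀ {V : Type*} [Fintype V]
    {ι : Type*} {G : SimpleGraph V} {x₀ : V} {ℓ : V → ℕ} (_ : Layering G x₀ ℓ)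
    (_ : DegLE G.Adj Δ) (_ : ¬ HasOddClique G t) (a : ℕ) (C : Set V)
    (_ : C = {v | a ≤ ℓ v ∧ ℓ v < a + 7}) (cl : V → ι)
    (_ : ∀ γ, ∀ F : Finset V, (∀ v ∈ F, cl v = γ) → F.card ≤ N₁)
    (_ : ∀ v ∈ C, RConn (bandRel G C) {u | cl u = cl v}), ∃ c : V → Bool,
    ∀ M : Finset V, (∀ v ∈ M, v ∈ C) → RConn (classRel G C cl) (M : Set V) →
      ∀ b, (∀ v ∈ M, c v = b) → M.card ≤ N := by
  obtain ⟨k, θ₀, hcover⟩ := exists_halfCover_of_unsplit_band t Δ (6 * N₁) 7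
  obtain ⟨D, hD⟩ : ∃ D, D = Δ + N₁ := ⟨_, rfl⟩
  obtain ⟨n₀, hn₀⟩ : ∃ n₀, n₀ = 8 * t + 2 := ⟨_, rfl⟩
  obtain ⟨b, hb⟩ : ∃ b, b = 6 * N₁ * (8 * t + 3) := ⟨_, rfl⟩
  obtain ⟨s, hs⟩ : ∃ s, s = b + (N₁ * n₀ + N₁) * D := ⟨_, rfl⟩
  obtain ⟨θ, hθ⟩ : ∃ θ, θ = θ₀ + s + 1 + N₁ * n₀ := ⟨_, rfl⟩
  obtain ⟨K, hK⟩ : ∃ K, K = θ * (D + 1) := ⟨_, rfl⟩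
  obtain ⟨q, hq⟩ : ∃ q, q = N₁ + N₁ * s := ⟨_, rfl⟩
  obtain ⟨A, hA⟩ : ∃ A, A = 1 + (2 * D + 1) * q := ⟨_, rfl⟩
  obtain ⟨N, hN⟩ : ∃ N, N = A * K ^ 2 + θ + q := ⟨_, rfl⟩
  have hθK : θ ≤ K := by rw [hK]; nlinarith
  have hDK : θ * D ≤ K := by rw [hK]; nlinarith
  refine ⟨N, ?_⟩
  intro V _ ι G x₀ ℓ hℓ hdeg hodd a C hC cl hcl hconn
  have hdeg' : DegLE (classRel G C cl) D := hD ▸ classRel_degLE hdeg hcl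
  have main : ∀ U : Finset V, (∀ v ∈ U, v ∈ C) → ∀ S ⊆ U, S.card ≤ K →
      PhaseOK (classRel G C cl) N A θ U S := by
    intro U
    induction U using Finset.strongInduction with
    | H U ih =>
      intro hUC S hS hSK
      have ih' : ∀ U' ⊂ U, ∀ S' ⊆ U', S'.card ≤ K → PhaseOK (classRel G C cl) N A θ U' S' :=
        fun U' hU' => ih U' hU' fun v hv => hUC v (hU'.1 hv)
      have hsmall : ∀ S' ⊆ U, S'.Nonempty → S'.card ≤ θ →
          PhaseOK (classRel G C cl) N A θ U S' := fun S' h1 h2 h3 =>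
        phaseOK_of_small hdeg' (by omega) (by omega) h1 h2 h3 fun U' hU' S'' hS'' hc =>
          ih' U' hU' S'' hS'' (hc.trans hDK)
      rcases S.eq_empty_or_nonempty with hS0 | hS0
      · subst hS0
        rcases U.eq_empty_or_nonempty with hU0 | ⟨u, hu⟩
        · subst hU0
          refine ⟨fun _ => true, ∅, by simp, by simp, by simp, by simp, by simp, by simp, ?_⟩
          intro M hM _ _ _
          rw [Finset.subset_empty.1 hM]; simp
        · obtain ⟨c, R, -, -, -, -, -, -, h7⟩ := hsmall {u} (by simpa using hu) (by simp)
            (by rw [Finset.card_singleton]; omega)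
          exact ⟨c, ∅, by simp, by simp, by simp, by simp, by simp, by simp, h7⟩
      · by_cases hSθ : S.card ≤ θ
        · exact hsmall S hS hS0 hSθ
        · push Not at hSθ
          by_cases hun : Unsplit (bandRel G C) S k (6 * N₁)
          · obtain ⟨X, h, κ, hX, hκ, hXc, hSw⟩ := hcover hℓ hdeg hodd a C hC S
              (fun v hv => hUC v (hS hv)) hun (by omega)
            exact phaseOK_of_halfCover (n₀ := n₀) (b := b) (s := s) (q := q) hN₁ hdeg' hcl hconn
              hs.ge hq.ge (by omega) (by omega) hθK hA.ge (by omega) (by omega) hUC hS hSθ hSK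
              hX hκ (by omega) (fun τ F hF hFw => hb ▸ hSw τ F hF hFw) ih'
          · exact phaseOK_of_not_unsplit (by omega) hcl hconn hUC hS hSθ hSK hun ih'
  obtain ⟨U, hU⟩ : ∃ U : Finset V, ∀ v, v ∈ U ↔ v ∈ C :=
    ⟨Finset.univ.filter fun v => v ∈ C, fun v => by simp⟩
  obtain ⟨c, R, -, -, -, -, -, -, h7⟩ := main U (fun v hv => (hU v).1 hv) ∅ (by simp) (by simp)
  exact ⟨c, fun M hM => h7 M fun v hv => (hU v).2 (hM v hv)⟩

end OddMinor

namespace OddMinor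
open scoped Classical
open Relation

section Gluing

/-- A connected set is small if its part satisfying `O` is small after contracting the classes of
`cl` and all its edges leaving that part run inside classes. -/
lemma card_le_of_classes {V : Type*} {ι : Type*} {G : SimpleGraph V} {C : Set V}
    {cl : V → ι} {N₁ N₂ : ℕ} (hcl : ∀ γ, ∀ F : Finset V, (∀ v ∈ F, cl v = γ) → F.card ≤ N₁)
    {M : Finset V} (hM : RConn G.Adj (M : Set V)) {O : V → Prop}
    (hedge : ∀ u ∈ M, ∀ v ∈ M, G.Adj u v → (bandRel G C u v ∧ O u ∧ O v) ∨ cl u = cl v)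
    (hO : ∀ M' : Finset V, (∀ v, v ∈ M' ↔ v ∈ M ∧ O v) →
      RConn (classRel G C cl) (M' : Set V) → M'.card ≤ N₂)
    (hnO : (∀ v ∈ M, ¬ O v) → M.card ≤ N₁) : M.card ≤ N₁ * N₂ + N₁ := by
  obtain ⟨M', hM'⟩ : ∃ M' : Finset V, ∀ v, v ∈ M' ↔ v ∈ M ∧ O v :=
    ⟨M.filter O, fun v => by simp⟩
  rcases M'.eq_empty_or_nonempty with h0 | ⟨x, hx⟩
  · exact (hnO fun v hv hvO => by
      have := (hM' v).2 ⟨hv, hvO⟩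
      rw [h0] at this; simp at this).trans (Nat.le_add_left _ _)
  have key : ∀ x ∈ M', ∀ u ∈ (M : Set V), ∃ y ∈ M', ReflTransGen (fun a b =>
      classRel G C cl a b ∧ b ∈ (M' : Set V)) x y ∧ cl u = cl y := by
    intro x hx
    refine hM.induct (x := x) ((hM' x).1 hx).1 ⟨x, hx, ReflTransGen.refl, rfl⟩ ?_
    rintro u hu v hv huv ⟨y, hy, hxy, hyu⟩
    rcases hedge u hu v hv huv with ⟨h1, h2, h3⟩ | h
    · have hu' := (hM' u).2 ⟨hu, h2⟩
      have hv' := (hM' v).2 ⟨hv, h3⟩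
      exact ⟨v, hv', (hxy.tail ⟨Or.inr hyu.symm, hu'⟩).tail ⟨Or.inl h1, hv'⟩, rfl⟩
    · exact ⟨y, hy, hxy, h.symm.trans hyu⟩
  have hconn : RConn (classRel G C cl) (M' : Set V) := by
    intro x hx z hz
    obtain ⟨y, hy, hxy, hzy⟩ := key x hx z ((hM' z).1 hz).1
    exact hxy.tail ⟨Or.inr hzy.symm, hz⟩
  have h1 : M.card ≤ M'.card * N₁ := by
    have h2 : M ⊆ M'.biUnion fun y => M.filter fun u => cl u = cl y := by
      intro u hu
      obtain ⟨y, hy, -, huy⟩ := key x hx u hu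
      exact Finset.mem_biUnion.2 ⟨y, hy, by simp [hu, huy]⟩
    exact (Finset.card_le_card h2).trans (Finset.card_biUnion_le_card_mul _ _ _ fun y _ =>
      hcl (cl y) _ fun v hv => (Finset.mem_filter.1 hv).2)
  have h2 := Nat.mul_le_mul_right N₁ (hO M' hM' hconn)
  nlinarith

/-- The band of three layers around layer `2 * i`. -/
def inBand {V : Type*} (ℓ : V → ℕ) (i : ℕ) (v : V) : Prop :=
  2 * i ≤ ℓ v + 1 ∧ ℓ v ≤ 2 * i + 1

/-- The label of a vertex determined by two-colourings of the bands. -/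
def bandLabel {V : Type*} (ℓ : V → ℕ) (c : ℕ → V → Bool) (v : V) : ℕ :=
  if ℓ v % 2 = 0 then if c (ℓ v / 2) v = true then ℓ v / 2 + 1 else ℓ v / 2
  else if c (ℓ v / 2) v = false then ℓ v / 2
  else if c (ℓ v / 2 + 1) v = false then ℓ v / 2 + 1 else ℓ v / 2 + 2

lemma bandLabel_bounds {V : Type*} (ℓ : V → ℕ) (c : ℕ → V → Bool) (v : V) :
    ℓ v ≤ 2 * bandLabel ℓ c v + 1 ∧ 2 * bandLabel ℓ c v ≤ ℓ v + 3 := by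
  unfold bandLabel
  split_ifs <;> omega

lemma bandLabel_top {V : Type*} {ℓ : V → ℕ} {c : ℕ → V → Bool} {v : V}
    (h : inBand ℓ (bandLabel ℓ c v) v) : c (bandLabel ℓ c v) v = false := by
  unfold inBand at h
  unfold bandLabel at h ⊢
  split_ifs at h ⊢ with h1 h2 h2 h3
  · omega
  · simpa using h2
  · exact h2
  · exact h3
  · omega

lemma bandLabel_bot {V : Type*} {ℓ : V → ℕ} {c : ℕ → V → Bool} {v : V} {q : ℕ}
    (hq : q + 1 = bandLabel ℓ c v) (h : inBand ℓ q v) : c q v = true := by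
  unfold inBand at h
  unfold bandLabel at hq
  split_ifs at hq with h1 h2 h2 h3
  · obtain rfl : q = ℓ v / 2 := by omega
    exact h2
  · omega
  · omega
  · obtain rfl : q = ℓ v / 2 := by omega
    simpa using h2
  · obtain rfl : q = ℓ v / 2 + 1 := by omega
    simpa using h3

lemma bandLabel_inBand {V : Type*} (ℓ : V → ℕ) (c : ℕ → V → Bool) (v : V) :
    inBand ℓ (bandLabel ℓ c v) v ∨ ∃ q, q + 1 = bandLabel ℓ c v ∧ inBand ℓ q v := by
  have h := bandLabel_bounds ℓ c v
  unfold inBand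
  by_cases h1 : 2 * bandLabel ℓ c v ≤ ℓ v + 1
  · exact Or.inl ⟨h1, h.1⟩
  · exact Or.inr ⟨bandLabel ℓ c v - 1, by omega, by omega, by omega⟩

/-- A layered bounded degree graph without odd clique models has a three-colouring with bounded
clustering. -/
theorem exists_coloring_of_layering (t Δ : ℕ) : ∃ N : ℕ, ∀ {V : Type*} [Fintype V]
    {G : SimpleGraph V} {x₀ : V} {ℓ : V → ℕ} (_ : Layering G x₀ ℓ) (_ : DegLE G.Adj Δ)
    (_ : ¬ HasOddClique G t), ∃ φ : V → Fin 3, ∀ M : Finset V, RConn G.Adj (M : Set V) →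
      (∀ u ∈ M, ∀ v ∈ M, φ u = φ v) → M.card ≤ N := by
  obtain ⟨N₀, hN₀⟩ := exists_phase_coloring t Δ 1 le_rfl
  obtain ⟨N₁, hN₁⟩ : ∃ N₁, N₁ = N₀ + 1 := ⟨_, rfl⟩
  obtain ⟨N₂, hN₂⟩ := exists_phase_coloring t Δ N₁ (by omega)
  refine ⟨N₁ * N₂ + N₁, ?_⟩
  intro V _ G x₀ ℓ hℓ hdeg hodd
  obtain ⟨C, hC⟩ : ∃ C : ℕ → Set V, ∀ i, C i = {v | 2 * i - 3 ≤ ℓ v ∧ ℓ v < 2 * i - 3 + 7} :=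
    ⟨_, fun _ => rfl⟩
  have hbC : ∀ i v, inBand ℓ i v → v ∈ C i := by
    rintro i v ⟨h1, h2⟩
    rw [hC]
    exact ⟨by omega, by omega⟩
  have hE : ∀ i, ∃ c : V → Bool, ∀ M : Finset V, (∀ v ∈ M, inBand ℓ i v) →
      RConn G.Adj (M : Set V) → ∀ b, (∀ v ∈ M, c v = b) → M.card ≤ N₀ := by
    intro i
    obtain ⟨c, hc⟩ := hN₀ hℓ hdeg hodd (2 * i - 3) (C i) (hC i) (fun v => v)
      (fun γ F hF => Finset.card_le_one.2 fun a ha b hb => (hF a ha).trans (hF b hb).symm)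
      (fun v _ => rconn_singleton _ v)
    refine ⟨c, fun M hM hconn => hc M (fun v hv => hbC i v (hM v hv)) ?_⟩
    exact hconn.mono' fun a ha b hb hab => Or.inl ⟨hab, hbC i a (hM a ha), hbC i b (hM b hb)⟩
  choose cE hcE using hE
  obtain ⟨e, he⟩ : ∃ e : V → V → Prop, ∀ a b, e a b ↔ G.Adj a b ∧ ∃ i, Even i ∧ inBand ℓ i a ∧
      inBand ℓ i b ∧ cE i a = cE i b := ⟨_, fun _ _ => Iff.rfl⟩
  have hes : RSymm e := by
    intro a b hab
    obtain ⟨h1, i, h2, h3, h4, h5⟩ := (he a b).1 hab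
    exact (he b a).2 ⟨h1.symm, i, h2, h4, h3, h5.symm⟩
  obtain ⟨cl, hcl⟩ : ∃ cl : V → Set V, ∀ v, cl v = rcomp e Set.univ v := ⟨_, fun _ => rfl⟩
  have hcl1 : ∀ a b, cl a = cl b ↔ a ∈ rcomp e Set.univ b := by
    intro a b
    constructor
    · intro h
      rw [← hcl, ← h, hcl]
      exact mem_rcomp_self a
    · intro h
      have h' : b ∈ rcomp e Set.univ a := reach_symm hes (Set.mem_univ _) h
      rw [hcl, hcl]
      ext z
      exact ⟨fun hz => ReflTransGen.trans h hz, fun hz => ReflTransGen.trans h' hz⟩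
  have huniq : ∀ i j v, Even i → Even j → inBand ℓ i v → inBand ℓ j v → i = j := by
    rintro i j v ⟨r, hr⟩ ⟨r', hr'⟩ ⟨h1, h2⟩ ⟨h3, h4⟩
    omega
  have hcl2 : ∀ x, ∀ u ∈ rcomp e Set.univ x, u = x ∨ ∃ i, Even i ∧ inBand ℓ i x ∧
      inBand ℓ i u ∧ cE i u = cE i x := by
    intro x
    refine (rconn_rcomp hes).induct (mem_rcomp_self x) (Or.inl rfl) ?_
    intro a _ b _ hab ha
    obtain ⟨-, i, h2, h3, h4, h5⟩ := (he a b).1 hab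
    rcases ha with rfl | ⟨j, h6, h7, h8, h9⟩
    · exact Or.inr ⟨i, h2, h3, h4, h5.symm⟩
    · obtain rfl := huniq i j a h2 h6 h3 h8
      exact Or.inr ⟨i, h2, h7, h4, h5.symm.trans h9⟩
  have hsize : ∀ γ, ∀ F : Finset V, (∀ v ∈ F, cl v = γ) → F.card ≤ N₁ := by
    intro γ F hF
    rcases F.eq_empty_or_nonempty with h0 | ⟨x, hx⟩
    · rw [h0]; simp
    · obtain ⟨M, hM⟩ : ∃ M : Finset V, ∀ v, v ∈ M ↔ v ∈ rcomp e Set.univ x :=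
        ⟨Finset.univ.filter fun v => v ∈ rcomp e Set.univ x, fun v => by simp⟩
      have hMc : (M : Set V) = rcomp e Set.univ x := Set.ext hM
      have h1 : F ⊆ M := fun v hv => (hM v).2 ((hcl1 v x).1 ((hF v hv).trans (hF x hx).symm))
      refine (Finset.card_le_card h1).trans ?_
      by_cases hxi : ∃ i, Even i ∧ inBand ℓ i x
      · obtain ⟨i, hi, hix⟩ := hxi
        have h2 : ∀ v ∈ M, inBand ℓ i v ∧ cE i v = cE i x := by
          intro v hv
          rcases hcl2 x v ((hM v).1 hv) with rfl | ⟨j, h3, h4, h5, h6⟩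
          · exact ⟨hix, rfl⟩
          · obtain rfl := huniq i j x hi h3 hix h4
            exact ⟨h5, h6⟩
        have h3 : RConn G.Adj (M : Set V) := by
          rw [hMc]
          exact (rconn_rcomp hes).mono fun a b hab => ((he a b).1 hab).1
        have := hcE i M (fun v hv => (h2 v hv).1) h3 (cE i x) fun v hv => (h2 v hv).2
        omega
      · have h2 : M ⊆ {x} := by
          intro v hv
          rcases hcl2 x v ((hM v).1 hv) with h | ⟨j, h3, h4, -⟩
          · simpa using h
          · exact absurd ⟨j, h3, h4⟩ hxi
        have := Finset.card_le_card h2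
        rw [Finset.card_singleton] at this
        omega
  have hO : ∀ i, ∃ c : V → Bool, Odd i → ∀ M : Finset V, (∀ v ∈ M, v ∈ C i) →
      RConn (classRel G (C i) cl) (M : Set V) → ∀ b, (∀ v ∈ M, c v = b) → M.card ≤ N₂ := by
    intro i
    by_cases hi : Odd i
    · obtain ⟨c, hc⟩ := hN₂ hℓ hdeg hodd (2 * i - 3) (C i) (hC i) cl hsize (by
        intro v hv
        have h1 : {u | cl u = cl v} = rcomp e Set.univ v := Set.ext fun u => hcl1 u v
        rw [h1]
        have h2 : ∀ u ∈ rcomp e Set.univ v, u ∈ C i := by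
          intro u hu
          rcases hcl2 v u hu with rfl | ⟨j, ⟨r, hr⟩, ⟨h3, h4⟩, ⟨h5, h6⟩, -⟩
          · exact hv
          · obtain ⟨r', hr'⟩ := hi
            rw [hC] at hv ⊢
            obtain ⟨h7, h8⟩ := hv
            exact ⟨by omega, by omega⟩
        exact (rconn_rcomp hes).mono' fun a ha b hb hab =>
          ⟨((he a b).1 hab).1, h2 a ha, h2 b hb⟩)
      exact ⟨c, fun _ => hc⟩
    · exact ⟨fun _ => true, fun h => absurd h hi⟩
  choose cO hcO using hO
  obtain ⟨c, hc⟩ : ∃ c : ℕ → V → Bool, c = fun i => if Even i then cE i else cO i := ⟨_, rfl⟩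
  have hc1 : ∀ i, Even i → c i = cE i := fun i hi => by rw [hc]; simp [hi]
  have hc2 : ∀ i, Odd i → c i = cO i := fun i hi => by
    rw [hc]; simp [Nat.not_even_iff_odd.2 hi]
  have hpair : ∀ i j, Odd i → Even j → (i = j + 1 ∨ j = i + 1) → ∀ M : Finset V,
      RConn G.Adj (M : Set V) → (∀ v ∈ M, inBand ℓ i v ∨ inBand ℓ j v) →
      ∀ b b', (∀ v ∈ M, inBand ℓ i v → c i v = b) → (∀ v ∈ M, inBand ℓ j v → c j v = b') →
      M.card ≤ N₁ * N₂ + N₁ := by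
    intro i j hi hj hij M hM hMij b b' hb hb'
    refine card_le_of_classes (C := C i) hsize hM (O := inBand ℓ i) ?_ ?_ ?_
    · intro u hu v hv huv
      by_cases h : inBand ℓ j u ∧ inBand ℓ j v
      · refine Or.inr ((hcl1 u v).2 (ReflTransGen.single ⟨hes ((he u v).2 ⟨huv, j, hj, h.1, h.2,
          ?_⟩), Set.mem_univ _⟩))
        rw [← hc1 j hj, hb' u hu h.1, hb' v hv h.2]
      · have h1 := hℓ.lip u v huv
        have h2 := hℓ.lip v u huv.symm
        have h3 := hMij u hu
        have h4 := hMij v hv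
        have h5 : inBand ℓ i u ∧ inBand ℓ i v := by
          unfold inBand at h h3 h4 ⊢
          omega
        exact Or.inl ⟨⟨huv, hbC i u h5.1, hbC i v h5.2⟩, h5⟩
    · intro M' hM' hconn
      exact hcO i hi M' (fun v hv => hbC i v ((hM' v).1 hv).2) hconn b fun v hv => by
        rw [← hc2 i hi]
        exact hb v ((hM' v).1 hv).1 ((hM' v).1 hv).2
    · intro h
      have h1 : ∀ v ∈ M, inBand ℓ j v := fun v hv => (hMij v hv).resolve_left (h v hv)
      have := hcE j M h1 hM b' fun v hv => by rw [← hc1 j hj]; exact hb' v hv (h1 v hv)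
      omega
  refine ⟨fun v => ⟨bandLabel ℓ c v % 3, Nat.mod_lt _ (by norm_num)⟩, fun M hM hφ => ?_⟩
  rcases M.eq_empty_or_nonempty with h0 | ⟨x, hx⟩
  · rw [h0]; simp
  obtain ⟨p, hp⟩ : ∃ p, p = bandLabel ℓ c x := ⟨_, rfl⟩
  have hlab : ∀ v ∈ (M : Set V), p = bandLabel ℓ c v := by
    refine hM.induct hx hp ?_
    intro u hu v hv huv hpu
    have h1 := hℓ.lip u v huv
    have h2 := hℓ.lip v u huv.symm
    have h3 := congrArg Fin.val (hφ u hu v hv)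
    have h4 := bandLabel_bounds ℓ c u
    have h5 := bandLabel_bounds ℓ c v
    beta_reduce at h3
    simp only at h3
    omega
  have htop : ∀ v ∈ M, inBand ℓ p v → c p v = false := fun v hv h => by
    have h1 := hlab v hv
    rw [h1] at h ⊢
    exact bandLabel_top h
  have hbot : ∀ q, q + 1 = p → ∀ v ∈ M, inBand ℓ q v → c q v = true := fun q hq v hv h =>
    bandLabel_bot (hq.trans (hlab v hv)) h
  have hin : ∀ v ∈ M, inBand ℓ p v ∨ ∃ q, q + 1 = p ∧ inBand ℓ q v := fun v hv => by
    rw [hlab v hv]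
    exact bandLabel_inBand ℓ c v
  rcases p with _ | p
  · have h1 : ∀ v ∈ M, inBand ℓ 0 v := fun v hv => (hin v hv).resolve_right (by
      rintro ⟨q, hq, -⟩
      omega)
    have := hcE 0 M h1 hM false fun v hv => by
      rw [← hc1 0 (by simp)]
      exact htop v hv (h1 v hv)
    omega
  · have hin' : ∀ v ∈ M, inBand ℓ (p + 1) v ∨ inBand ℓ p v := fun v hv =>
      (hin v hv).imp_right fun ⟨q, hq, h⟩ => by
        obtain rfl : q = p := by omega
        exact h
    rcases Nat.even_or_odd p with hp2 | hp2
    · exact hpair (p + 1) p hp2.add_one hp2 (Or.inl rfl) M hM hin' false true htop (hbot p rfl)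
    · exact hpair p (p + 1) hp2 hp2.add_one (Or.inr rfl) M hM (fun v hv => (hin' v hv).symm)
        true false (hbot p rfl) htop

end Gluing
end OddMinor

namespace OddMinor
open scoped Classical
open Relation

section Reduction

lemma connected_induce_of_reachable {V : Type*} {F : SimpleGraph V} {B : Set V}
    (hne : B.Nonempty) (hF : ∀ x y, F.Adj x y → y ∈ B)
    (hreach : ∀ x ∈ B, ∀ y ∈ B, F.Reachable x y) : (F.induce B).Connected := by
  have key : ∀ {x y : V} (w : F.Walk x y) (hx : x ∈ B) (hy : y ∈ B),
      (F.induce B).Reachable ⟨x, hx⟩ ⟨y, hy⟩ := by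
    intro x y w
    induction w with
    | nil => intro _ _; exact SimpleGraph.Reachable.refl _
    | @cons a b d hab p ih =>
      intro hx hy
      have hb := hF a b hab
      have h1 : (F.induce B).Adj ⟨a, hx⟩ ⟨b, hb⟩ := hab
      exact h1.reachable.trans (ih hb hy)
  obtain ⟨x, hx⟩ := hne
  refine (SimpleGraph.connected_iff _).2 ⟨?_, ⟨⟨x, hx⟩⟩⟩
  rintro ⟨a, ha⟩ ⟨b, hb⟩
  obtain ⟨w⟩ := hreach a ha b hb
  exact key w ha hb

/-- A complete odd minor model gives every graph on as many vertices as an odd minor. -/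
lemma HasOddClique.isOddMinor {W V : Type*} [Fintype W] {H : SimpleGraph W} {G : SimpleGraph V}
    (h : HasOddClique G (Fintype.card W)) : IsOddMinor H G := by
  obtain ⟨B, col, hne, hconn, hdisj, hadj⟩ := h
  have hforest : ∀ i, ∃ F : SimpleGraph V, (∀ x y, F.Adj x y → bich G col x y ∧ x ∈ B i ∧ y ∈ B i) ∧
      F.IsAcyclic ∧ (F.induce (B i)).Connected := by
    intro i
    obtain ⟨D, hD⟩ : ∃ D : SimpleGraph V, ∀ x y, D.Adj x y ↔ bich G col x y ∧ x ∈ B i ∧ y ∈ B i :=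
      ⟨{ Adj := fun x y => bich G col x y ∧ x ∈ B i ∧ y ∈ B i
         symm := ⟨fun x y h => ⟨bich_rsymm G col h.1, h.2.2, h.2.1⟩⟩
         loopless := ⟨fun x h => h.1.2 rfl⟩ }, fun _ _ => Iff.rfl⟩
    obtain ⟨F, hFD, hF, hFr⟩ := D.exists_isAcyclic_reachable_eq_le
    refine ⟨F, fun x y hxy => (hD x y).1 (hFD hxy), hF, connected_induce_of_reachable (hne i)
      (fun x y hxy => ((hD x y).1 (hFD hxy)).2.2) fun x hx y hy => ?_⟩
    rw [hFr]
    have h1 := hconn i x hx y hy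
    induction h1 with
    | refl => exact SimpleGraph.Reachable.refl _
    | @tail b d h1 h2 ih =>
      have hb := rcomp_subset hx h1
      have h3 : D.Adj b d := (hD b d).2 ⟨h2.1, hb, h2.2⟩
      exact (ih hb).trans h3.reachable
  choose F hF1 hF2 hF3 using hforest
  have e := Fintype.equivFin W
  refine ⟨fun w => B (e w), fun w => F (e w), col, fun w => hne _, fun w x y hxy =>
    (hF1 _ x y hxy).1.1, fun w x y hxy => (hF1 _ x y hxy).2, fun w => hF3 _, fun w => hF2 _,
    fun w₁ w₂ hw => hdisj _ _ fun h => hw (e.injective h), fun w x y hxy =>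
    (hF1 _ x y hxy).1.2, fun w₁ w₂ hw => hadj _ _ fun h => ?_⟩
  rw [e.injective h] at hw
  exact hw.ne rfl

lemma HasOddClique.of_induce {V : Type*} {G : SimpleGraph V} {K : Set V} {t : ℕ}
    (h : HasOddClique (G.induce K) t) : HasOddClique G t := by
  obtain ⟨B, col, hne, hconn, hdisj, hadj⟩ := h
  obtain ⟨col', hcol'⟩ : ∃ col' : V → Bool, ∀ x : K, col' x = col x :=
    ⟨fun v => if hv : v ∈ K then col ⟨v, hv⟩ else false, fun x => by simp⟩
  refine ⟨fun i => Subtype.val '' B i, col', fun i => (hne i).image _, ?_, ?_, ?_⟩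
  · rintro i _ ⟨x, hx, rfl⟩ _ ⟨y, hy, rfl⟩
    refine (hconn i x hx y hy).lift Subtype.val ?_
    rintro a b ⟨⟨h1, h2⟩, h3⟩
    exact ⟨⟨h1, by rw [hcol', hcol']; exact h2⟩, b, h3, rfl⟩
  · intro i j hij
    exact (Set.disjoint_image_iff Subtype.val_injective).2 (hdisj i j hij)
  · intro i j hij
    obtain ⟨x, hx, y, hy, h1, h2⟩ := hadj i j hij
    exact ⟨x, ⟨x, hx, rfl⟩, y, ⟨y, hy, rfl⟩, h1, by rw [hcol', hcol', h2]⟩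

/-- The distances from a vertex of a connected graph form a layering. -/
lemma layering_dist {V : Type*} {G : SimpleGraph V} (hG : G.Connected) (x₀ : V) :
    Layering G x₀ fun v => G.dist x₀ v := by
  have hlip : ∀ u v, G.Adj u v → G.dist x₀ v ≤ G.dist x₀ u + 1 := by
    intro u v huv
    have h1 := hG.dist_triangle (u := x₀) (v := u) (w := v)
    rwa [SimpleGraph.dist_eq_one_iff_adj.2 huv] at h1
  refine ⟨fun v hv => (hG.dist_eq_zero_iff.1 hv).symm, fun v hv => ?_, hlip⟩
  obtain ⟨w, hw⟩ := hG.exists_walk_length_eq_dist v x₀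
  rw [SimpleGraph.dist_comm] at hw
  beta_reduce at hv
  cases w with
  | nil => simp at hv
  | @cons _ u _ h p =>
    refine ⟨u, h, ?_⟩
    have h1 := hlip u v h.symm
    have h2 := SimpleGraph.dist_le p
    rw [SimpleGraph.dist_comm] at h2
    rw [SimpleGraph.Walk.length_cons] at hw
    omega

/-- Bounded degree graphs without odd clique models have three-colourings with bounded
clustering. -/
lemma exists_coloring_of_not_hasOddClique (t Δ : ℕ) : ∃ N : ℕ, ∀ {V : Type*} [Fintype V]
    {G : SimpleGraph V} (_ : DegLE G.Adj Δ) (_ : ¬ HasOddClique G t), ∃ φ : V → Fin 3,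
    ∀ M : Finset V, RConn G.Adj (M : Set V) → (∀ u ∈ M, ∀ v ∈ M, φ u = φ v) → M.card ≤ N := by
  obtain ⟨N, hN⟩ := exists_coloring_of_layering t Δ
  refine ⟨N, ?_⟩
  intro V _ G hdeg hodd
  have hcomp : ∀ K : G.ConnectedComponent, ∃ φ : V → Fin 3, ∀ M : Finset V, (∀ v ∈ M, v ∈ K.supp) →
      RConn G.Adj (M : Set V) → (∀ u ∈ M, ∀ v ∈ M, φ u = φ v) → M.card ≤ N := by
    intro K
    obtain ⟨x₀⟩ := K.connected_toSimpleGraph.nonempty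
    have hdegK : DegLE (G.induce K.supp).Adj Δ := by
      intro v
      refine le_trans ?_ (hdeg v)
      refine Finset.card_le_card_of_injOn Subtype.val ?_ Subtype.val_injective.injOn
      intro u hu
      simpa using hu
    obtain ⟨φ, hφ⟩ := hN (G := G.induce K.supp) (layering_dist K.connected_toSimpleGraph x₀) hdegK
      fun h => hodd h.of_induce
    obtain ⟨ψ, hψ⟩ : ∃ ψ : V → Fin 3, ∀ x : K.supp, ψ x = φ x :=
      ⟨fun v => if hv : v ∈ K.supp then φ ⟨v, hv⟩ else 0, fun x => by simp⟩
    refine ⟨ψ, fun M hMK hM hmono => ?_⟩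
    obtain ⟨M', hM'⟩ : ∃ M' : Finset K.supp, ∀ v : K.supp, v ∈ M' ↔ (v : V) ∈ M :=
      ⟨Finset.univ.filter fun v => (v : V) ∈ M, fun v => by simp⟩
    have h1 : M.card ≤ M'.card := by
      have : M ⊆ M'.image Subtype.val := fun v hv =>
        Finset.mem_image.2 ⟨⟨v, hMK v hv⟩, (hM' _).2 hv, rfl⟩
      exact (Finset.card_le_card this).trans Finset.card_image_le
    refine h1.trans (hφ M' ?_ fun u hu v hv => ?_)
    · have key : ∀ x, ∀ hx : x ∈ M, ∀ y ∈ (M : Set V), ∃ hy : y ∈ M, ReflTransGen (fun a b =>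
          (G.induce K.supp).Adj a b ∧ b ∈ (M' : Set K.supp)) ⟨x, hMK x hx⟩ ⟨y, hMK y hy⟩ := by
        intro x hx
        refine hM.induct (x := x) hx ⟨hx, ReflTransGen.refl⟩ ?_
        rintro a ha b hb hab ⟨ha', hxa⟩
        exact ⟨hb, hxa.tail ⟨hab, (hM' _).2 hb⟩⟩
      rintro ⟨x, hxK⟩ hx ⟨y, hyK⟩ hy
      obtain ⟨_, h⟩ := key x ((hM' _).1 hx) y ((hM' _).1 hy)
      exact h
    · rw [← hψ, ← hψ]
      exact hmono _ ((hM' u).1 hu) _ ((hM' v).1 hv)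
  choose φ hφ using hcomp
  refine ⟨fun v => φ (G.connectedComponentMk v) v, fun M hM hmono => ?_⟩
  rcases M.eq_empty_or_nonempty with h0 | ⟨x, hx⟩
  · rw [h0]; simp
  have h1 : ∀ v ∈ (M : Set V), G.connectedComponentMk v = G.connectedComponentMk x := by
    refine hM.induct (x := x) hx rfl ?_
    intro a _ b _ hab ha
    rw [← ha]
    exact SimpleGraph.ConnectedComponent.sound hab.symm.reachable
  refine hφ (G.connectedComponentMk x) M (fun v hv => h1 v hv) hM fun u hu v hv => ?_
  have h2 := hmono u hu v hv
  beta_reduce at h2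
  rwa [h1 u hu, h1 v hv] at h2

lemma MonoReach.mem_rcomp {V α : Type*} {G : SimpleGraph V} {S : Set V} {c : V → α} {a b : V}
    (h : MonoReach G S c a b) : b ∈ rcomp G.Adj {v | c v = c a} a := by
  obtain ⟨w, hw⟩ := h
  have key : ∀ {x y : V} (w : G.Walk x y) (γ : α), (∀ v ∈ w.support, c v = γ) →
      y ∈ rcomp G.Adj {v | c v = γ} x := by
    intro x y w γ
    induction w with
    | nil => exact fun _ => mem_rcomp_self _
    | @cons u v d huv p ih =>
      intro h
      rw [SimpleGraph.Walk.support_cons] at h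
      refine ReflTransGen.head ⟨huv, h v ?_⟩ (ih fun z hz => h z (List.mem_cons_of_mem _ hz))
      exact List.mem_cons_of_mem _ p.start_mem_support
  exact key w (c a) fun v hv => (hw v hv).2

end Reduction
end OddMinor

/-- **Corollary.** For every graph `H` and every positive integer `Δ`, there exists a
positive integer `N` such that every odd `H`-minor free graph `G` with maximum degree at
most `Δ` has a 3-coloring with clustering at most `N`. -/
theorem odd_minor_free_bounded_degree_three_coloring_clustering
    {W : Type v} [Fintype W] (H : SimpleGraph W) (Δ : ℕ) (hΔ : 0 < Δ) :
    ∃ N : ℕ, 0 < N ∧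
      ∀ (V : Type u) [Fintype V] (G : SimpleGraph V),
        ¬ IsOddMinor H G →
        MaxDegreeLE G Δ →
        ∃ c : V → Fin 3, HasClusteringLE G Set.univ c N := by
  obtain ⟨N, hN⟩ := OddMinor.exists_coloring_of_not_hasOddClique (Fintype.card W) Δ
  refine ⟨N + 1, Nat.succ_pos _, fun V _ G hG hdeg => ?_⟩
  classical
  obtain ⟨φ, hφ⟩ := hN (G := G) (fun v => by
    rw [← Set.ncard_coe_finset]
    refine le_trans (le_of_eq ?_) (hdeg v)
    congr 1
    ext u
    simp) fun h => hG h.isOddMinor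
  refine ⟨φ, fun a => ?_⟩
  obtain ⟨M, hM⟩ : ∃ M : Finset V, ∀ v, v ∈ M ↔ v ∈ OddMinor.rcomp G.Adj {v | φ v = φ a} a :=
    ⟨Finset.univ.filter fun v => v ∈ OddMinor.rcomp G.Adj {v | φ v = φ a} a, fun v => by simp⟩
  have hMc : (M : Set V) = OddMinor.rcomp G.Adj {v | φ v = φ a} a := Set.ext hM
  have hmono : ∀ v ∈ M, φ v = φ a := fun v hv =>
    OddMinor.rcomp_subset (S := {v | φ v = φ a}) rfl ((hM v).1 hv)
  have h1 := hφ M (hMc ▸ OddMinor.rconn_rcomp (OddMinor.adj_rsymm G)) fun u hu v hv =>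
    (hmono u hu).trans (hmono v hv).symm
  have h2 : {b | MonoReach G Set.univ φ a b} ⊆ (M : Set V) := fun b hb =>
    (hM b).2 (OddMinor.MonoReach.mem_rcomp hb)
  have h3 := Set.ncard_le_ncard h2 M.finite_toSet
  rw [Set.ncard_coe_finset] at h3
  omega
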